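/- Let P = B ∪ R be a bichromatic set of 2n points in the plane in general position with |B| = |R| = n, let M be a BR-matching on P, and let ℓ be a ham-sandwich cut of P with k = |C_{M,ℓ}| edges of M crossing ℓ. Then there exists a BR-matching M^ℓ on P such that no edge of M^ℓ intersects ℓ, and M and M^ℓ are ⌊k/2⌋-compatible. -/

import Mathlib

open Finset
open scoped Classical

/-- Points in the plane. -/
abbrev Pt : Type := ℝ × ℝ

/-- A finite point set is in general position if no three distinct points are collinear. -/
def GenPos (S : Finset Pt) : Prop :=
  ∀ p ∈ S, ∀ q ∈ S, ∀ r ∈ S, p ≠ q → p ≠ r → q ≠ r →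
    ¬ Collinear ℝ ({p, q, r} : Set Pt)

/-- `M` is a plane perfect bichromatic (BR-) matching on the bichromatic point set `B ∪ R`:
each edge `e ∈ M` is a pair (blue endpoint, red endpoint); every blue point is the blue
endpoint of exactly one edge, every red point is the red endpoint of exactly one edge, and
the (closed) segments of distinct edges are disjoint. -/
def IsBRMatching (B R : Finset Pt) (M : Finset (Pt × Pt)) : Prop :=
  (∀ e ∈ M, e.1 ∈ B ∧ e.2 ∈ R) ∧
  (∀ b ∈ B, ∃! e, e ∈ M ∧ e.1 = b) ∧
  (∀ r ∈ R, ∃! e, e ∈ M ∧ e.2 = r) ∧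
  (∀ e ∈ M, ∀ e' ∈ M, e ≠ e' →
    segment ℝ e.1 e.2 ∩ segment ℝ e'.1 e'.2 = ∅)

/-- Two matchings are compatible if any two of their segments intersect in at most a
common endpoint (shared edges are allowed). -/
def Compatible (M M' : Finset (Pt × Pt)) : Prop :=
  ∀ e ∈ M, ∀ e' ∈ M', e = e' ∨
    segment ℝ e.1 e.2 ∩ segment ℝ e'.1 e'.2 ⊆
      {x : Pt | (x = e.1 ∨ x = e.2) ∧ (x = e'.1 ∨ x = e'.2)}

/-- `M` and `M'` are `t`-compatible: there is a transformation (sequence of BR-matchings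
on `B ∪ R` in which consecutive matchings are compatible) of length `k ≤ t` between them. -/
def TCompatible (B R : Finset Pt) (t : ℕ) (M M' : Finset (Pt × Pt)) : Prop :=
  ∃ k ≤ t, ∃ f : ℕ → Finset (Pt × Pt),
    f 0 = M ∧ f k = M' ∧ (∀ i ≤ k, IsBRMatching B R (f i)) ∧
    ∀ i < k, Compatible (f i) (f (i + 1))

/-- The line `{p | a * p.1 + b * p.2 = c}`. -/
def lineSet (a b c : ℝ) : Set Pt := {p : Pt | a * p.1 + b * p.2 = c}

/-- The line given by `a * x + b * y = c` is a ham-sandwich cut of the bichromatic point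
set `B ∪ R` (with `|B| = |R| = n`): it contains no point of `B ∪ R`, and one of its open
sides contains exactly `⌊n/2⌋` blue and `⌊n/2⌋` red points while the other open side
contains exactly `⌈n/2⌉` blue and `⌈n/2⌉` red points. -/
def IsHamSandwichCut (a b c : ℝ) (B R : Finset Pt) (n : ℕ) : Prop :=
  (a, b) ≠ ((0 : ℝ), (0 : ℝ)) ∧
  (∀ p ∈ B ∪ R, a * p.1 + b * p.2 ≠ c) ∧
  (((B.filter fun p => a * p.1 + b * p.2 < c).card = n / 2 ∧
    (R.filter fun p => a * p.1 + b * p.2 < c).card = n / 2 ∧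
    (B.filter fun p => a * p.1 + b * p.2 > c).card = (n + 1) / 2 ∧
    (R.filter fun p => a * p.1 + b * p.2 > c).card = (n + 1) / 2) ∨
   ((B.filter fun p => a * p.1 + b * p.2 < c).card = (n + 1) / 2 ∧
    (R.filter fun p => a * p.1 + b * p.2 < c).card = (n + 1) / 2 ∧
    (B.filter fun p => a * p.1 + b * p.2 > c).card = n / 2 ∧
    (R.filter fun p => a * p.1 + b * p.2 > c).card = n / 2))

/-- The edge `e` crosses the line `a * x + b * y = c`: its segment meets the line. -/
def Crosses (a b c : ℝ) (e : Pt × Pt) : Prop :=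
  ∃ x ∈ segment ℝ e.1 e.2, a * x.1 + b * x.2 = c

namespace WallSystem

open Filter Topology

/-- The planar cross product. -/
def cr (u v : Pt) : ℝ := u.1 * v.2 - u.2 * v.1

/-- Rotation by a quarter turn. -/
def rot (u : Pt) : Pt := (-u.2, u.1)

/-- The affine parametrisation of the oriented segment (dart) `κ`. -/
def pt (κ : Pt × Pt) (t : ℝ) : Pt := κ.1 + t • (κ.2 - κ.1)

/-- The relative interior of a dart. -/
def rel (κ : Pt × Pt) : Set Pt := pt κ '' Set.Ioo 0 1

/-- The closed segment of a dart. -/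
def cl (κ : Pt × Pt) : Set Pt := pt κ '' Set.Icc 0 1

/-- The signed side of `q` with respect to the dart `δ` (positive on the left). -/
def side (δ : Pt × Pt) (q : Pt) : ℝ := cr (δ.2 - δ.1) (q - δ.1)

/-- The dart `κ` ends in the interior of `δ`, coming from the left of `δ`. -/
def Hosts (δ κ : Pt × Pt) : Prop := κ.2 ∈ rel δ ∧ 0 < side δ κ.1

lemma pt_fst (κ : Pt × Pt) (t : ℝ) : (pt κ t).1 = κ.1.1 + t * (κ.2.1 - κ.1.1) := by
  simp [pt]

lemma pt_snd (κ : Pt × Pt) (t : ℝ) : (pt κ t).2 = κ.1.2 + t * (κ.2.2 - κ.1.2) := by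
  simp [pt]

lemma side_eq (δ : Pt × Pt) (q : Pt) :
    side δ q = (δ.2.1 - δ.1.1) * (q.2 - δ.1.2) - (δ.2.2 - δ.1.2) * (q.1 - δ.1.1) := by
  simp [side, cr]

@[simp] lemma pt_zero (κ : Pt × Pt) : pt κ 0 = κ.1 := by simp [pt]

@[simp] lemma pt_one (κ : Pt × Pt) : pt κ 1 = κ.2 := by simp [pt]

lemma pt_swap (κ : Pt × Pt) (t : ℝ) : pt κ.swap t = pt κ (1 - t) := by
  ext <;> simp [pt] <;> ring

lemma continuous_pt (κ : Pt × Pt) : Continuous (pt κ) := by unfold pt; fun_prop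

lemma pt_injective {κ : Pt × Pt} (h : κ.1 ≠ κ.2) : Function.Injective (pt κ) := by
  intro s t hst
  have h2 : κ.2 - κ.1 ≠ 0 := sub_ne_zero.2 h.symm
  have h3 : s • (κ.2 - κ.1) = t • (κ.2 - κ.1) := add_left_cancel hst
  exact smul_left_injective ℝ h2 h3

lemma rel_swap (κ : Pt × Pt) : rel κ.swap = rel κ := by
  ext x
  constructor
  · rintro ⟨t, ht, rfl⟩
    exact ⟨1 - t, ⟨by linarith [ht.2], by linarith [ht.1]⟩, (pt_swap κ t).symm⟩
  · rintro ⟨t, ht, rfl⟩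
    exact ⟨1 - t, ⟨by linarith [ht.2], by linarith [ht.1]⟩, by rw [pt_swap]; congr 1; ring⟩

lemma cl_swap (κ : Pt × Pt) : cl κ.swap = cl κ := by
  ext x
  constructor
  · rintro ⟨t, ht, rfl⟩
    exact ⟨1 - t, ⟨by linarith [ht.2], by linarith [ht.1]⟩, (pt_swap κ t).symm⟩
  · rintro ⟨t, ht, rfl⟩
    exact ⟨1 - t, ⟨by linarith [ht.2], by linarith [ht.1]⟩, by rw [pt_swap]; congr 1; ring⟩

lemma cl_eq_segment (κ : Pt × Pt) : cl κ = segment ℝ κ.1 κ.2 := by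
  rw [segment_eq_image']; rfl

lemma rel_subset_cl (κ : Pt × Pt) : rel κ ⊆ cl κ :=
  Set.image_mono Set.Ioo_subset_Icc_self

lemma mem_cl_cases {κ : Pt × Pt} {x : Pt} (h : x ∈ cl κ) :
    x ∈ rel κ ∨ x = κ.1 ∨ x = κ.2 := by
  obtain ⟨t, ht, rfl⟩ := h
  rcases eq_or_lt_of_le ht.1 with h0 | h0
  · right; left; rw [← h0]; simp
  rcases eq_or_lt_of_le ht.2 with h1 | h1
  · right; right; rw [h1]; simp
  · left; exact ⟨t, ⟨h0, h1⟩, rfl⟩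

lemma fst_mem_cl (κ : Pt × Pt) : κ.1 ∈ cl κ := ⟨0, by simp, by simp⟩

lemma snd_mem_cl (κ : Pt × Pt) : κ.2 ∈ cl κ := ⟨1, by simp, by simp⟩

lemma isClosed_cl (κ : Pt × Pt) : IsClosed (cl κ) :=
  (isCompact_Icc.image (continuous_pt κ)).isClosed

lemma fst_notMem_rel {κ : Pt × Pt} (h : κ.1 ≠ κ.2) : κ.1 ∉ rel κ := by
  rintro ⟨t, ht, e⟩
  have := pt_injective h (e.trans (pt_zero κ).symm)
  linarith [ht.1]

lemma snd_notMem_rel {κ : Pt × Pt} (h : κ.1 ≠ κ.2) : κ.2 ∉ rel κ := by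
  rintro ⟨t, ht, e⟩
  have := pt_injective h (e.trans (pt_one κ).symm)
  linarith [ht.2]

lemma side_swap (δ : Pt × Pt) (q : Pt) : side δ.swap q = - side δ q := by
  simp only [side_eq, Prod.fst_swap, Prod.snd_swap]; ring

lemma side_pt (δ κ : Pt × Pt) (t : ℝ) :
    side δ (pt κ t) = (1 - t) * side δ κ.1 + t * side δ κ.2 := by
  simp only [side_eq, pt_fst, pt_snd]; ring

lemma side_pt_self (δ : Pt × Pt) (t : ℝ) : side δ (pt δ t) = 0 := by
  simp only [side_eq, pt_fst, pt_snd]; ring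

lemma side_fst (δ : Pt × Pt) : side δ δ.1 = 0 := by simp [side, cr]

lemma side_snd (δ : Pt × Pt) : side δ δ.2 = 0 := by simp [side, cr]; ring

lemma side_of_mem_rel {δ : Pt × Pt} {x : Pt} (h : x ∈ rel δ) : side δ x = 0 := by
  obtain ⟨t, -, rfl⟩ := h; exact side_pt_self δ t

lemma side_of_mem_cl {δ : Pt × Pt} {x : Pt} (h : x ∈ cl δ) : side δ x = 0 := by
  obtain ⟨t, -, rfl⟩ := h; exact side_pt_self δ t

lemma continuous_side (δ : Pt × Pt) : Continuous (side δ) := by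
  unfold side cr; fun_prop

lemma sq_pos_of_ne {κ : Pt × Pt} (h : κ.1 ≠ κ.2) :
    0 < (κ.2.1 - κ.1.1) ^ 2 + (κ.2.2 - κ.1.2) ^ 2 := by
  by_contra hc
  apply h
  have h1 : (κ.2.1 - κ.1.1) ^ 2 = 0 := by nlinarith [sq_nonneg (κ.2.1 - κ.1.1), sq_nonneg (κ.2.2 - κ.1.2)]
  have h2 : (κ.2.2 - κ.1.2) ^ 2 = 0 := by nlinarith [sq_nonneg (κ.2.1 - κ.1.1), sq_nonneg (κ.2.2 - κ.1.2)]
  rw [sq_eq_zero_iff, sub_eq_zero] at h1 h2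
  exact Prod.ext h1.symm h2.symm

lemma exists_pt_of_side_eq_zero {δ : Pt × Pt} (h : δ.1 ≠ δ.2) {q : Pt} (hq : side δ q = 0) :
    ∃ t, q = pt δ t := by
  have hp := sq_pos_of_ne h
  rw [side_eq] at hq
  refine ⟨((q.1 - δ.1.1) * (δ.2.1 - δ.1.1) + (q.2 - δ.1.2) * (δ.2.2 - δ.1.2)) /
    ((δ.2.1 - δ.1.1) ^ 2 + (δ.2.2 - δ.1.2) ^ 2), ?_⟩
  ext
  · rw [pt_fst]; field_simp; linear_combination (-(δ.2.2 - δ.1.2)) * hq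
  · rw [pt_snd]; field_simp; linear_combination ((δ.2.1 - δ.1.1)) * hq

/-- Two darts on a common line: if an endpoint of `κ` is in the relative interior of `σ` and `κ` is
collinear with `σ`, then the relative interiors meet. -/
lemma rel_inter_of_collinear {σ κ : Pt × Pt} (hσ : σ.1 ≠ σ.2) (hx : κ.2 ∈ rel σ)
    (h0 : side σ κ.1 = 0) : ∃ x, x ∈ rel σ ∧ x ∈ rel κ := by
  obtain ⟨t, ht⟩ := exists_pt_of_side_eq_zero hσ h0
  obtain ⟨s, hs, hs'⟩ := hx
  have hc : Continuous fun r : ℝ => (1 - r) * t + r * s := by fun_prop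
  have h1 : ∀ᶠ r in 𝓝 (1 : ℝ), (1 - r) * t + r * s ∈ Set.Ioo (0 : ℝ) 1 :=
    hc.continuousAt.eventually_mem (by
      have : (1 - (1:ℝ)) * t + 1 * s = s := by ring
      simp only [this]; exact Ioo_mem_nhds hs.1 hs.2)
  have h2 : ∀ᶠ r in 𝓝[<] (1 : ℝ), r ∈ Set.Ioo (0:ℝ) 1 := Ioo_mem_nhdsLT (by norm_num)
  obtain ⟨r, hr1, hr2⟩ := ((h1.filter_mono nhdsWithin_le_nhds).and h2).exists
  refine ⟨pt σ ((1 - r) * t + r * s), ⟨_, hr1, rfl⟩, r, hr2, ?_⟩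
  ext
  · rw [pt_fst, ht, ← hs', pt_fst, pt_fst, pt_fst]; ring
  · rw [pt_snd, ht, ← hs', pt_snd, pt_snd, pt_snd]; ring

lemma side_pos_convex (σ : Pt × Pt) : Convex ℝ {q | 0 < side σ q} := by
  intro x hx y hy a b ha hb hab
  have : side σ (a • x + b • y) = a * side σ x + b * side σ y := by
    have : b = 1 - a := by linarith
    subst this
    simp [side, cr]; ring
  show 0 < side σ (a • x + b • y)
  rw [this]
  rcases ha.eq_or_lt with h | h
  · have : b = 1 := by linarith
    subst this; rw [← h]; simpa using hy
  · have h1 : 0 < a * side σ x := mul_pos h hx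
    have h2 : 0 ≤ b * side σ y := mul_nonneg hb (le_of_lt hy)
    linarith

lemma frequently_side_pos {σ : Pt × Pt} (h : σ.1 ≠ σ.2) {x : Pt} (hx : side σ x = 0) :
    ∃ᶠ y in 𝓝 x, 0 < side σ y := by
  have h1 : Tendsto (fun e : ℝ => x + e • rot (σ.2 - σ.1)) (𝓝[>] 0) (𝓝 x) := by
    have : Continuous (fun e : ℝ => x + e • rot (σ.2 - σ.1)) := by fun_prop
    have := this.tendsto 0
    simp only [zero_smul, add_zero] at this
    exact this.mono_left nhdsWithin_le_nhds
  refine h1.frequently (Eventually.frequently ?_)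
  filter_upwards [self_mem_nhdsWithin] with e he
  have he : 0 < e := he
  have hp := sq_pos_of_ne h
  have : side σ (x + e • rot (σ.2 - σ.1)) = side σ x + e * ((σ.2.1 - σ.1.1) ^ 2 + (σ.2.2 - σ.1.2) ^ 2) := by
    simp [side, cr, rot]; ring
  rw [this, hx]; positivity

/-- The union of the closed segments of a finite family of darts. -/
def wallSet (W : Finset (Pt × Pt)) : Set Pt := ⋃ κ ∈ W, cl κ

lemma mem_wallSet {W : Finset (Pt × Pt)} {x : Pt} : x ∈ wallSet W ↔ ∃ κ ∈ W, x ∈ cl κ := by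
  simp [wallSet]

lemma isClosed_wallSet (W : Finset (Pt × Pt)) : IsClosed (wallSet W) :=
  isClosed_biUnion_finset fun κ _ => isClosed_cl κ

/-- `h` is locally constant off `C`. -/
def LC (h : Pt → ℤ) (C : Set Pt) : Prop := ∀ q ∉ C, ∀ᶠ y in 𝓝 q, h y = h q

/-- A symmetric family of nondegenerate darts with disjoint relative interiors. -/
structure Walls (W : Finset (Pt × Pt)) : Prop where
  symm : ∀ κ ∈ W, κ.swap ∈ W
  ne : ∀ κ ∈ W, κ.1 ≠ κ.2
  disj : ∀ σ ∈ W, ∀ τ ∈ W, σ ≠ τ → σ ≠ τ.swap → Disjoint (rel σ) (rel τ)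

/-- `h` takes the value `c` on the left of `κ` close to the point with parameter `t`. -/
def SideVal (h : Pt → ℤ) (κ : Pt × Pt) (t : ℝ) (c : ℤ) : Prop :=
  ∀ᶠ y in 𝓝 (pt κ t), 0 < side κ y → h y = c

/-- The value of `h` on the left of `κ` close to its head. -/
noncomputable def hd (h : Pt → ℤ) (κ : Pt × Pt) : ℤ :=
  if H : ∃ c, ∀ᶠ t in 𝓝[<] (1 : ℝ), SideVal h κ t c then H.choose else 0

/-- The value of `h` on the left of `κ` close to its tail. -/
noncomputable def tl (h : Pt → ℤ) (κ : Pt × Pt) : ℤ :=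
  if H : ∃ c, ∀ᶠ t in 𝓝[>] (0 : ℝ), SideVal h κ t c then H.choose else 0

lemma LC.mono {h : Pt → ℤ} {C D : Set Pt} (H : LC h C) (hCD : C ⊆ D) : LC h D :=
  fun q hq => H q fun hC => hq (hCD hC)

lemma LC.eq_of_preconnected {h : Pt → ℤ} {C K : Set Pt} (H : LC h C) (hK : IsPreconnected K)
    (hC : ∀ x ∈ K, x ∉ C) {x y : Pt} (hx : x ∈ K) (hy : y ∈ K) : h x = h y := by
  refine hK.constant (f := h) ?_ hx hy
  intro q hq
  have h1 := H q (hC q hq)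
  exact ((continuousAt_const (y := h q)).congr (h1.mono fun y hy => hy.symm)).continuousWithinAt

lemma half_const {h : Pt → ℤ} {C : Set Pt} (H : LC h C) {σ : Pt × Pt} (hσ : σ.1 ≠ σ.2) {x : Pt}
    (hx : side σ x = 0) (hC : ∀ᶠ y in 𝓝 x, 0 < side σ y → y ∉ C) :
    ∃ c, ∀ᶠ y in 𝓝 x, 0 < side σ y → h y = c := by
  obtain ⟨r, hr, hb⟩ := Metric.eventually_nhds_iff_ball.1 hC
  have hconv : Convex ℝ (Metric.ball x r ∩ {q | 0 < side σ q}) :=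
    (convex_ball x r).inter (side_pos_convex σ)
  obtain ⟨y0, h0, h0'⟩ := ((frequently_side_pos hσ hx).and_eventually
    (Metric.ball_mem_nhds x hr)).exists
  refine ⟨h y0, ?_⟩
  filter_upwards [Metric.ball_mem_nhds x hr] with y hy hs
  exact H.eq_of_preconnected hconv.isPreconnected (fun z hz => hb z hz.1 hz.2) ⟨hy, hs⟩ ⟨h0', h0⟩

lemma SideVal.unique {h : Pt → ℤ} {κ : Pt × Pt} (hκ : κ.1 ≠ κ.2) {t : ℝ} {c d : ℤ}
    (hc : SideVal h κ t c) (hd : SideVal h κ t d) : c = d := by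
  obtain ⟨y, h0, h1, h2⟩ := ((frequently_side_pos hκ (side_pt_self κ t)).and_eventually
    (hc.and hd)).exists
  rw [← h1 h0, ← h2 h0]

lemma SideVal.eventually {h : Pt → ℤ} {κ : Pt × Pt} {t : ℝ} {c : ℤ}
    (hc : SideVal h κ t c) : ∀ᶠ u in 𝓝 t, SideVal h κ u c := by
  have h1 := eventually_eventually_nhds.2 hc
  exact (continuous_pt κ).continuousAt.eventually h1

lemma hd_spec_of_exists {h : Pt → ℤ} {κ : Pt × Pt}
    (H : ∃ c, ∀ᶠ t in 𝓝[<] (1 : ℝ), SideVal h κ t c) :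
    ∀ᶠ t in 𝓝[<] (1 : ℝ), SideVal h κ t (hd h κ) := by
  rw [hd, dif_pos H]; exact H.choose_spec

lemma tl_spec_of_exists {h : Pt → ℤ} {κ : Pt × Pt}
    (H : ∃ c, ∀ᶠ t in 𝓝[>] (0 : ℝ), SideVal h κ t c) :
    ∀ᶠ t in 𝓝[>] (0 : ℝ), SideVal h κ t (tl h κ) := by
  rw [tl, dif_pos H]; exact H.choose_spec

lemma hd_eq {h : Pt → ℤ} {κ : Pt × Pt} (hκ : κ.1 ≠ κ.2) {c : ℤ}
    (H : ∀ᶠ t in 𝓝[<] (1 : ℝ), SideVal h κ t c) : hd h κ = c := by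
  obtain ⟨t, h1, h2⟩ := ((hd_spec_of_exists ⟨c, H⟩).and H).exists
  exact h1.unique hκ h2

lemma tl_eq {h : Pt → ℤ} {κ : Pt × Pt} (hκ : κ.1 ≠ κ.2) {c : ℤ}
    (H : ∀ᶠ t in 𝓝[>] (0 : ℝ), SideVal h κ t c) : tl h κ = c := by
  obtain ⟨t, h1, h2⟩ := ((tl_spec_of_exists ⟨c, H⟩).and H).exists
  exact h1.unique hκ h2

lemma hd_eq_of_nhds {h : Pt → ℤ} {κ : Pt × Pt} (hκ : κ.1 ≠ κ.2) {c : ℤ}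
    (H : ∀ᶠ y in 𝓝 κ.2, 0 < side κ y → h y = c) : hd h κ = c := by
  have h1 : SideVal h κ 1 c := by rw [SideVal, pt_one]; exact H
  exact hd_eq hκ (h1.eventually.filter_mono nhdsWithin_le_nhds)

lemma tl_eq_of_nhds {h : Pt → ℤ} {κ : Pt × Pt} (hκ : κ.1 ≠ κ.2) {c : ℤ}
    (H : ∀ᶠ y in 𝓝 κ.1, 0 < side κ y → h y = c) : tl h κ = c := by
  have h1 : SideVal h κ 0 c := by rw [SideVal, pt_zero]; exact H
  exact tl_eq hκ (h1.eventually.filter_mono nhdsWithin_le_nhds)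

section

variable {W : Finset (Pt × Pt)} {h : Pt → ℤ}

lemma Walls.eventually_notMem_cl (hW : Walls W) {σ κ : Pt × Pt} (hσ : σ ∈ W) (hκ : κ ∈ W) {x : Pt}
    (hx : x ∈ rel σ) (h1 : ¬ (κ.2 = x ∧ 0 < side σ κ.1)) (h2 : ¬ (κ.1 = x ∧ 0 < side σ κ.2)) :
    ∀ᶠ y in 𝓝 x, 0 < side σ y → y ∉ cl κ := by
  by_cases hxc : x ∈ cl κ
  swap
  · filter_upwards [(isClosed_cl κ).isOpen_compl.mem_nhds hxc] with y hy _ using hy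
  have key : ∀ y ∈ cl κ, side σ y ≤ 0 := by
    rintro y ⟨t, ht, rfl⟩
    by_cases e1 : κ = σ
    · rw [e1, side_pt_self]
    by_cases e2 : κ = σ.swap
    · rw [e2, pt_swap, side_pt_self]
    rw [side_pt]
    have hs := side_of_mem_rel hx
    rcases mem_cl_cases hxc with h3 | h3 | h3
    · exact absurd hx (Set.disjoint_left.1 (hW.disj κ hκ σ hσ e1 e2) h3)
    · have h4 : ¬ 0 < side σ κ.2 := fun h5 => h2 ⟨h3.symm, h5⟩
      rw [h3] at hs
      rw [hs]
      nlinarith [ht.1, ht.2]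
    · have h4 : ¬ 0 < side σ κ.1 := fun h5 => h1 ⟨h3.symm, h5⟩
      rw [h3] at hs
      rw [hs]
      nlinarith [ht.1, ht.2]
  exact Eventually.of_forall fun y hy hc => absurd (key y hc) (not_le.2 hy)

lemma Walls.exists_sideVal (hW : Walls W) (H : LC h (wallSet W)) {σ : Pt × Pt} (hσ : σ ∈ W) {t : ℝ}
    (ht : t ∈ Set.Ioo (0 : ℝ) 1) (hn : ∀ κ ∈ W, κ.2 ≠ pt σ t) : ∃ c, SideVal h σ t c := by
  refine half_const H (hW.ne σ hσ) (side_pt_self σ t) ?_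
  have : ∀ κ ∈ W, ∀ᶠ y in 𝓝 (pt σ t), 0 < side σ y → y ∉ cl κ := fun κ hκ =>
    hW.eventually_notMem_cl hσ hκ ⟨t, ht, rfl⟩ (fun h => hn κ hκ h.1)
      (fun h => hn κ.swap (hW.symm κ hκ) h.1)
  filter_upwards [(eventually_all_finset W).2 this] with y hy hs hyC
  obtain ⟨κ, hκ, hc⟩ := mem_wallSet.1 hyC
  exact hy κ hκ hs hc

lemma Walls.exists_sideVal_on (hW : Walls W) (H : LC h (wallSet W)) {σ : Pt × Pt} (hσ : σ ∈ W)
    {U : Set ℝ} (hU : IsPreconnected U) (hU1 : U ⊆ Set.Ioo 0 1)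
    (hn : ∀ t ∈ U, ∀ κ ∈ W, κ.2 ≠ pt σ t) : ∃ c, ∀ t ∈ U, SideVal h σ t c := by
  rcases U.eq_empty_or_nonempty with rfl | ⟨t0, ht0⟩
  · exact ⟨0, by simp⟩
  have h1 : ∀ t, ∃ c, t ∈ U → SideVal h σ t c := by
    intro t
    by_cases ht : t ∈ U
    · obtain ⟨c, hc⟩ := hW.exists_sideVal H hσ (hU1 ht) (hn t ht)
      exact ⟨c, fun _ => hc⟩
    · exact ⟨0, fun h => absurd h ht⟩
  choose g hg using h1
  refine ⟨g t0, fun t ht => ?_⟩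
  have : g t = g t0 := by
    refine hU.constant (f := g) ?_ ht ht0
    intro u hu
    have h2 := (hg u hu).eventually
    have h3 : (fun _ => g u) =ᶠ[𝓝[U] u] g := by
      filter_upwards [h2.filter_mono nhdsWithin_le_nhds, self_mem_nhdsWithin] with v hv hvU
      exact hv.unique (hW.ne σ hσ) (hg v hvU)
    exact (continuousWithinAt_const (b := g u)).congr_of_eventuallyEq h3.symm rfl
  rw [← this]; exact hg t ht

lemma eventually_ne_lt {κ : Pt × Pt} (hκ : κ.1 ≠ κ.2) (x : Pt) :
    ∀ᶠ t in 𝓝[<] (1 : ℝ), x ≠ pt κ t := by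
  by_cases hx : ∃ u < (1 : ℝ), x = pt κ u
  · obtain ⟨u, hu, rfl⟩ := hx
    filter_upwards [Ioo_mem_nhdsLT hu] with t ht e
    have := pt_injective hκ e
    linarith [ht.1]
  · filter_upwards [self_mem_nhdsWithin] with t ht e
    exact hx ⟨t, ht, e⟩

lemma eventually_ne_gt {κ : Pt × Pt} (hκ : κ.1 ≠ κ.2) (x : Pt) :
    ∀ᶠ t in 𝓝[>] (0 : ℝ), x ≠ pt κ t := by
  by_cases hx : ∃ u > (0 : ℝ), x = pt κ u
  · obtain ⟨u, hu, rfl⟩ := hx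
    filter_upwards [Ioo_mem_nhdsGT hu] with t ht e
    have := pt_injective hκ e
    linarith [ht.2]
  · filter_upwards [self_mem_nhdsWithin] with t ht e
    exact hx ⟨t, ht, e⟩

lemma Walls.hd_spec (hW : Walls W) (H : LC h (wallSet W)) {σ : Pt × Pt} (hσ : σ ∈ W) :
    ∀ᶠ t in 𝓝[<] (1 : ℝ), SideVal h σ t (hd h σ) := by
  apply hd_spec_of_exists
  have h1 : ∀ᶠ t in 𝓝[<] (1 : ℝ), t ∈ Set.Ioo (0 : ℝ) 1 ∧ ∀ κ ∈ W, κ.2 ≠ pt σ t :=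
    Eventually.and (Ioo_mem_nhdsLT (by norm_num : (0 : ℝ) < 1))
      ((eventually_all_finset W).2 fun κ _ => eventually_ne_lt (hW.ne σ hσ) κ.2)
  obtain ⟨l, hl, hl'⟩ := (mem_nhdsLT_iff_exists_Ioo_subset).1 h1
  obtain ⟨c, hc⟩ := hW.exists_sideVal_on H hσ (isPreconnected_Ioo (a := l) (b := 1))
    (fun t ht => (hl' ht).1) (fun t ht => (hl' ht).2)
  exact ⟨c, mem_of_superset (Ioo_mem_nhdsLT hl) hc⟩

lemma Walls.tl_spec (hW : Walls W) (H : LC h (wallSet W)) {σ : Pt × Pt} (hσ : σ ∈ W) :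
    ∀ᶠ t in 𝓝[>] (0 : ℝ), SideVal h σ t (tl h σ) := by
  apply tl_spec_of_exists
  have h1 : ∀ᶠ t in 𝓝[>] (0 : ℝ), t ∈ Set.Ioo (0 : ℝ) 1 ∧ ∀ κ ∈ W, κ.2 ≠ pt σ t :=
    Eventually.and (Ioo_mem_nhdsGT (by norm_num : (0 : ℝ) < 1))
      ((eventually_all_finset W).2 fun κ _ => eventually_ne_gt (hW.ne σ hσ) κ.2)
  obtain ⟨l, hl, hl'⟩ := (mem_nhdsGT_iff_exists_Ioo_subset).1 h1
  obtain ⟨c, hc⟩ := hW.exists_sideVal_on H hσ (isPreconnected_Ioo (a := 0) (b := l))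
    (fun t ht => (hl' ht).1) (fun t ht => (hl' ht).2)
  exact ⟨c, mem_of_superset (Ioo_mem_nhdsGT hl) hc⟩

end

/-- The total variation of a piecewise constant function is the sum of its jumps. -/
lemma sub_eq_sum_jumps {ι : Type*} (s : Finset ι) (e : ι → ℝ) (he : Set.InjOn e s) {a b : ℝ}
    (hab : a ≤ b) :
    ∀ (f : ℝ → ℤ) (L R : ι → ℤ), (∀ i ∈ s, a < e i ∧ e i < b) →
    (∀ t ∈ Set.Icc a b, (∀ i ∈ s, t ≠ e i) → ∀ᶠ u in 𝓝 t, f u = f t) →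
    (∀ i ∈ s, ∀ᶠ u in 𝓝[<] (e i), f u = L i) →
    (∀ i ∈ s, ∀ᶠ u in 𝓝[>] (e i), f u = R i) →
    f b - f a = ∑ i ∈ s, (R i - L i) := by
  induction s using Finset.induction_on with
  | empty =>
    intro f L R _ h2 _ _
    simp only [sum_empty]
    rw [sub_eq_zero]
    refine (isPreconnected_Icc (a := a) (b := b)).constant (f := f) ?_ ⟨hab, le_rfl⟩ ⟨le_rfl, hab⟩
    intro q hq
    exact ((continuousAt_const (y := f q)).congr
      ((h2 q hq (by simp)).mono fun y hy => hy.symm)).continuousWithinAt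
  | insert i0 s hi ih =>
    intro f L R h1 h2 h3 h4
    have hne : ∀ i ∈ s, e i ≠ e i0 := fun i his h =>
      hi (he (by simp [his]) (by simp) h ▸ his)
    set J : ℤ := R i0 - L i0 with hJ
    let f' : ℝ → ℤ := fun u => if u < e i0 then f u + J else if u = e i0 then R i0 else f u
    let K : ι → ℤ := fun i => if e i < e i0 then J else 0
    have hlt : ∀ t < e i0, ∀ᶠ u in 𝓝 t, f' u = f u + J := by
      intro t ht
      filter_upwards [Iio_mem_nhds ht] with u hu
      have hu : u < e i0 := hu
      simp [f', hu]
    have hgt : ∀ t > e i0, ∀ᶠ u in 𝓝 t, f' u = f u := by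
      intro t ht
      filter_upwards [Ioi_mem_nhds ht] with u hu
      have hu : e i0 < u := hu
      simp [f', hu.not_gt, hu.ne']
    have hK : ∀ i ∈ s, ∀ᶠ u in 𝓝 (e i), f' u = f u + K i := by
      intro i his
      rcases lt_or_gt_of_ne (hne i his) with h | h
      · simpa [K, h] using hlt _ h
      · simpa [K, h.not_gt] using hgt _ h
    have := ih (he.mono (by simp)) f' (fun i => L i + K i) (fun i => R i + K i)
      (fun i his => h1 i (by simp [his])) ?_ ?_ ?_
    · rw [sum_insert hi]
      have e1 : f' b = f b := by
        have := (h1 i0 (by simp)).2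
        simp [f', this.not_gt, this.ne']
      have e2 : f' a = f a + J := by
        have := (h1 i0 (by simp)).1
        simp [f', this]
      rw [e1, e2] at this
      simp only [add_sub_add_right_eq_sub] at this
      rw [← this, hJ]; ring
    · intro t ht hts
      rcases lt_trichotomy t (e i0) with h | h | h
      · have := h2 t ht (by simp only [mem_insert, forall_eq_or_imp]; exact ⟨h.ne, hts⟩)
        filter_upwards [hlt t h, this] with u hu hu'
        rw [hu, hu', (hlt t h).self_of_nhds]
      · subst h
        have hv : f' (e i0) = R i0 := by simp [f']
        rw [hv]
        have l := h3 i0 (by simp)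
        have r := h4 i0 (by simp)
        rw [eventually_nhdsWithin_iff] at l r
        filter_upwards [l, r] with u hl hr
        rcases lt_trichotomy u (e i0) with h | h | h
        · have : f' u = f u + J := by simp [f', h]
          rw [this, hl h, hJ]; ring
        · simp [f', h]
        · have : f' u = f u := by simp [f', h.not_gt, h.ne']
          rw [this, hr h]
      · have := h2 t ht (by simp only [mem_insert, forall_eq_or_imp]; exact ⟨h.ne', hts⟩)
        filter_upwards [hgt t h, this] with u hu hu'
        rw [hu, hu', (hgt t h).self_of_nhds]
    · intro i his
      filter_upwards [h3 i (by simp [his]), (hK i his).filter_mono nhdsWithin_le_nhds] with u hu hu'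
      rw [hu', hu]
    · intro i his
      filter_upwards [h4 i (by simp [his]), (hK i his).filter_mono nhdsWithin_le_nhds] with u hu hu'
      rw [hu', hu]

lemma smul_add_smul_rot_eq_zero {σ : Pt × Pt} (hσ : σ.1 ≠ σ.2) {x y : ℝ}
    (h : x • (σ.2 - σ.1) + y • rot (σ.2 - σ.1) = 0) : x = 0 ∧ y = 0 := by
  have hp := sq_pos_of_ne hσ
  have h1 := congrArg Prod.fst h
  have h2 := congrArg Prod.snd h
  simp [rot] at h1 h2
  constructor
  · have : x * ((σ.2.1 - σ.1.1) ^ 2 + (σ.2.2 - σ.1.2) ^ 2) = 0 := by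
      linear_combination (σ.2.1 - σ.1.1) * h1 + (σ.2.2 - σ.1.2) * h2
    exact (mul_eq_zero.1 this).resolve_right hp.ne'
  · have : y * ((σ.2.1 - σ.1.1) ^ 2 + (σ.2.2 - σ.1.2) ^ 2) = 0 := by
      linear_combination (-(σ.2.2 - σ.1.2)) * h1 + (σ.2.1 - σ.1.1) * h2
    exact (mul_eq_zero.1 this).resolve_right hp.ne'

lemma Hosts.exists_frame {σ κ : Pt × Pt} (hσ : σ.1 ≠ σ.2) (h : Hosts σ κ) :
    ∃ τ α β : ℝ, τ ∈ Set.Ioo (0 : ℝ) 1 ∧ 0 < β ∧ κ.2 = pt σ τ ∧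
      κ.1 = κ.2 + α • (σ.2 - σ.1) + β • rot (σ.2 - σ.1) := by
  obtain ⟨⟨τ, hτ, hτ'⟩, hs⟩ := h
  have hp := sq_pos_of_ne hσ
  refine ⟨τ, ((κ.1.1 - κ.2.1) * (σ.2.1 - σ.1.1) + (κ.1.2 - κ.2.2) * (σ.2.2 - σ.1.2)) /
    ((σ.2.1 - σ.1.1) ^ 2 + (σ.2.2 - σ.1.2) ^ 2), side σ κ.1 /
    ((σ.2.1 - σ.1.1) ^ 2 + (σ.2.2 - σ.1.2) ^ 2), hτ, by positivity, hτ'.symm, ?_⟩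
  have h0 : side σ κ.2 = 0 := by rw [← hτ']; exact side_pt_self σ τ
  rw [side_eq] at h0 ⊢
  ext
  · simp [rot]; field_simp; linear_combination (σ.2.2 - σ.1.2) * h0
  · simp [rot]; field_simp; linear_combination (-(σ.2.1 - σ.1.1)) * h0

/-- Walking along the left side of a wall `σ`, the values of `h` only change where walls end
on `σ` from the left. -/
lemma Walls.hd_sub_tl {W : Finset (Pt × Pt)} {h : Pt → ℤ} (hW : Walls W) (H : LC h (wallSet W))
    {σ : Pt × Pt} (hσ : σ ∈ W) :
    hd h σ - tl h σ = ∑ κ ∈ W with Hosts σ κ, (hd h κ - tl h κ.swap) := by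
  have hne := hW.ne σ hσ
  have hp := sq_pos_of_ne hne
  set D := W.filter (Hosts σ) with hD
  have hfr : ∀ κ : Pt × Pt, ∃ τ α β : ℝ, Hosts σ κ → τ ∈ Set.Ioo (0 : ℝ) 1 ∧ 0 < β ∧ κ.2 = pt σ τ ∧
      κ.1 = κ.2 + α • (σ.2 - σ.1) + β • rot (σ.2 - σ.1) := by
    intro κ
    by_cases hh : Hosts σ κ
    · obtain ⟨τ, α, β, hx⟩ := hh.exists_frame hne
      exact ⟨τ, α, β, fun _ => hx⟩
    · exact ⟨0, 0, 0, fun h => absurd h hh⟩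
  choose τ α β hF using hfr
  have hDh : ∀ κ ∈ D, Hosts σ κ := fun κ hκ => (mem_filter.1 hκ).2
  have hDW : ∀ κ ∈ D, κ ∈ W := fun κ hκ => (mem_filter.1 hκ).1
  -- endpoints of the walk
  obtain ⟨t0, ht0s, ht0, ht0D⟩ : ∃ t0, SideVal h σ t0 (tl h σ) ∧ t0 ∈ Set.Ioo (0 : ℝ) (1 / 2) ∧
      ∀ κ ∈ D, t0 < τ κ := by
    have e1 : ∀ᶠ t in 𝓝[>] (0 : ℝ), ∀ κ ∈ D, t < τ κ :=
      (eventually_all_finset D).2 fun κ hκ =>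
        nhdsWithin_le_nhds (Iio_mem_nhds (hF κ (hDh κ hκ)).1.1)
    exact ((hW.tl_spec H hσ).and (Eventually.and
      (Ioo_mem_nhdsGT (by norm_num : (0 : ℝ) < 1 / 2)) e1)).exists
  obtain ⟨t1, ht1s, ht1, ht1D⟩ : ∃ t1, SideVal h σ t1 (hd h σ) ∧ t1 ∈ Set.Ioo (1 / 2 : ℝ) 1 ∧
      ∀ κ ∈ D, τ κ < t1 := by
    have e1 : ∀ᶠ t in 𝓝[<] (1 : ℝ), ∀ κ ∈ D, τ κ < t :=
      (eventually_all_finset D).2 fun κ hκ =>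
        nhdsWithin_le_nhds (Ioi_mem_nhds (hF κ (hDh κ hκ)).1.2)
    exact ((hW.hd_spec H hσ).and (Eventually.and
      (Ioo_mem_nhdsLT (by norm_num : (1 / 2 : ℝ) < 1)) e1)).exists
  let y : ℝ → ℝ → Pt := fun ε s => pt σ s + ε • rot (σ.2 - σ.1)
  have hy0 : ∀ s, y 0 s = pt σ s := fun s => by simp [y]
  have hyc : Continuous fun p : ℝ × ℝ => y p.1 p.2 := by
    have := continuous_pt σ
    simp only [y]; fun_prop
  have hyc1 : ∀ s, Tendsto (fun ε => y ε s) (𝓝 0) (𝓝 (pt σ s)) := fun s => by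
    have : Continuous fun ε => y ε s := hyc.comp (by fun_prop : Continuous fun ε : ℝ => (ε, s))
    have := this.tendsto 0
    rwa [hy0] at this
  have hside : ∀ ε s, side σ (y ε s) = ε * ((σ.2.1 - σ.1.1) ^ 2 + (σ.2.2 - σ.1.2) ^ 2) := by
    intro ε s
    simp [side_eq, y, pt, rot]; ring
  have hside_pos : ∀ ε s, 0 < ε → 0 < side σ (y ε s) := fun ε s hε => by
    rw [hside]; positivity
  let e : ℝ → Pt × Pt → ℝ := fun ε κ => τ κ + ε * α κ / β κ
  -- the conditions on `ε`
  have c1 : ∀ᶠ ε in 𝓝[>] (0 : ℝ), h (y ε t0) = tl h σ := by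
    filter_upwards [((hyc1 t0).eventually ht0s).filter_mono nhdsWithin_le_nhds,
      self_mem_nhdsWithin] with ε h1 h2 using h1 (hside_pos ε t0 h2)
  have c2 : ∀ᶠ ε in 𝓝[>] (0 : ℝ), h (y ε t1) = hd h σ := by
    filter_upwards [((hyc1 t1).eventually ht1s).filter_mono nhdsWithin_le_nhds,
      self_mem_nhdsWithin] with ε h1 h2 using h1 (hside_pos ε t1 h2)
  have c3 : ∀ᶠ ε in 𝓝[>] (0 : ℝ), ∀ κ ∈ D, e ε κ ∈ Set.Ioo t0 t1 := by
    refine (eventually_all_finset D).2 fun κ hκ => ?_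
    have : Continuous fun ε => e ε κ := by simp only [e]; fun_prop
    have h2 := this.tendsto 0
    have h3 : e 0 κ = τ κ := by simp [e]
    rw [h3] at h2
    exact (h2.eventually (Ioo_mem_nhds (ht0D κ hκ) (ht1D κ hκ))).filter_mono nhdsWithin_le_nhds
  have c4 : ∀ᶠ ε in 𝓝[>] (0 : ℝ), ∀ κ ∈ D, 0 < ε / β κ ∧ ε / β κ < 1 ∧
      SideVal h κ (1 - ε / β κ) (hd h κ) ∧ SideVal h κ.swap (ε / β κ) (tl h κ.swap) := by
    refine (eventually_all_finset D).2 fun κ hκ => ?_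
    have hβ := (hF κ (hDh κ hκ)).2.1
    have t2 : Tendsto (fun ε => ε / β κ) (𝓝[>] 0) (𝓝[>] 0) := by
      refine tendsto_nhdsWithin_iff.2 ⟨?_, ?_⟩
      · have : Continuous fun ε : ℝ => ε / β κ := by fun_prop
        have := this.tendsto 0
        rw [zero_div] at this
        exact this.mono_left nhdsWithin_le_nhds
      · filter_upwards [self_mem_nhdsWithin] with ε hε
        exact div_pos hε hβ
    have t1 : Tendsto (fun ε => 1 - ε / β κ) (𝓝[>] 0) (𝓝[<] 1) := by
      refine tendsto_nhdsWithin_iff.2 ⟨?_, ?_⟩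
      · have : Continuous fun ε : ℝ => 1 - ε / β κ := by fun_prop
        have := this.tendsto 0
        rw [zero_div, sub_zero] at this
        exact this.mono_left nhdsWithin_le_nhds
      · filter_upwards [self_mem_nhdsWithin] with ε hε
        have : 0 < ε / β κ := div_pos hε hβ
        show 1 - ε / β κ < 1
        linarith
    filter_upwards [t2.eventually (Ioo_mem_nhdsGT (by norm_num : (0 : ℝ) < 1)),
      t1.eventually (hW.hd_spec H (hDW κ hκ)),
      t2.eventually (hW.tl_spec H (hW.symm κ (hDW κ hκ)))] with ε h1 h2 h3
    exact ⟨h1.1, h1.2, h2, h3⟩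
  have c5 : ∀ᶠ ε in 𝓝[>] (0 : ℝ), ∀ κ ∈ W, ¬ Hosts σ κ → ¬ Hosts σ κ.swap →
      ∀ s ∈ Set.Icc t0 t1, y ε s ∉ cl κ := by
    refine (eventually_all_finset W).2 fun κ hκ => ?_
    by_cases h1 : Hosts σ κ
    · exact Eventually.of_forall fun _ h => absurd h1 h
    by_cases h2 : Hosts σ κ.swap
    · exact Eventually.of_forall fun _ _ h => absurd h2 h
    have := (isCompact_Icc (a := t0) (b := t1)).eventually_forall_of_forall_eventually
      (x₀ := (0 : ℝ)) (P := fun ε s => 0 < ε → y ε s ∉ cl κ) ?_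
    · filter_upwards [this.filter_mono nhdsWithin_le_nhds, self_mem_nhdsWithin] with ε h3 h4 _ _ s hs
      exact h3 s hs h4
    intro s hs
    have hx : pt σ s ∈ rel σ := ⟨s, ⟨lt_of_lt_of_le ht0.1 hs.1, lt_of_le_of_lt hs.2 ht1.2⟩, rfl⟩
    have h3 := hW.eventually_notMem_cl hσ hκ hx (fun h => h1 ⟨h.1 ▸ hx, h.2⟩)
      (fun h => h2 ⟨by rw [← h.1] at hx; exact hx, h.2⟩)
    have h4 : Tendsto (fun p : ℝ × ℝ => y p.1 p.2) (𝓝 (0, s)) (𝓝 (pt σ s)) := by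
      have := hyc.tendsto (0, s)
      simpa only [hy0] using this
    filter_upwards [h4.eventually h3] with p hp1 hp2
    exact hp1 (hside_pos _ _ hp2)
  obtain ⟨ε, h1, h2, h3, h4, h5, hε⟩ := (c1.and (c2.and (c3.and (c4.and (c5.and
    self_mem_nhdsWithin))))).exists
  have hε : 0 < ε := hε
  have hcross : ∀ κ ∈ D, y ε (e ε κ) = pt κ (1 - ε / β κ) := by
    intro κ hκ
    obtain ⟨-, hβ, e1, e2⟩ := hF κ (hDh κ hκ)
    have : pt κ (1 - ε / β κ) = κ.2 + (ε / β κ) • (κ.1 - κ.2) := by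
      ext <;> simp [pt] <;> ring
    rw [this, e2, add_assoc, add_sub_cancel_left, e1]
    ext
    · simp [y, e, pt, rot]; field_simp; ring
    · simp [y, e, pt, rot]; field_simp; ring
  have hcl : ∀ κ ∈ D, ∀ s, y ε s ∈ cl κ → s = e ε κ := by
    rintro κ hκ s ⟨t, ht, hts⟩
    obtain ⟨-, hβ, e1, e2⟩ := hF κ (hDh κ hκ)
    have : pt κ t = κ.2 + (1 - t) • (κ.1 - κ.2) := by
      ext <;> simp [pt] <;> ring
    rw [this, e2, add_assoc, add_sub_cancel_left, e1] at hts
    have h6 : (τ κ + (1 - t) * α κ - s) • (σ.2 - σ.1) + ((1 - t) * β κ - ε) • rot (σ.2 - σ.1) = 0 := by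
      rw [← sub_eq_zero] at hts
      rw [← hts]
      ext <;> simp [y, pt, rot] <;> ring
    obtain ⟨h7, h8⟩ := smul_add_smul_rot_eq_zero hne h6
    have h9 : 1 - t = ε / β κ := by field_simp; linarith
    rw [h9] at h7
    simp only [e]
    rw [mul_div_right_comm]; linarith
  have hinj : Set.InjOn (e ε) D := by
    intro κ hκ κ' hκ' hee
    by_contra hcon
    have m1 : y ε (e ε κ) ∈ rel κ := by
      rw [hcross κ hκ]
      exact ⟨_, ⟨by linarith [(h4 κ hκ).2.1], by linarith [(h4 κ hκ).1]⟩, rfl⟩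
    have m2 : y ε (e ε κ) ∈ rel κ' := by
      rw [hee, hcross κ' hκ']
      exact ⟨_, ⟨by linarith [(h4 κ' hκ').2.1], by linarith [(h4 κ' hκ').1]⟩, rfl⟩
    have : κ = κ'.swap := by
      by_contra hc
      exact Set.disjoint_left.1 (hW.disj κ (hDW κ hκ) κ' (hDW κ' hκ') hcon hc) m1 m2
    have h6 := (hDh κ hκ).2
    rw [this] at h6
    have h7 := side_of_mem_rel (hDh κ' hκ').1
    simp only [Prod.fst_swap] at h6
    linarith
  have hslope : ∀ κ ∈ D, ∀ s, side κ (y ε s) =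
      (s - e ε κ) * (β κ * ((σ.2.1 - σ.1.1) ^ 2 + (σ.2.2 - σ.1.2) ^ 2)) := by
    intro κ hκ s
    obtain ⟨-, hβ, e1, e2⟩ := hF κ (hDh κ hκ)
    have h6 : side κ (y ε (e ε κ)) = 0 := by rw [hcross κ hκ, side_pt_self]
    have h7 : side κ (y ε s) - side κ (y ε (e ε κ)) =
        (s - e ε κ) * (β κ * ((σ.2.1 - σ.1.1) ^ 2 + (σ.2.2 - σ.1.2) ^ 2)) := by
      have a1 := congrArg Prod.fst e2
      have a2 := congrArg Prod.snd e2
      simp [rot] at a1 a2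
      simp only [side_eq]
      simp [y, pt, rot]
      rw [a1, a2]
      ring
    rw [← h7, h6, sub_zero]
  have hconts : ∀ s0, Tendsto (fun s => y ε s) (𝓝 s0) (𝓝 (y ε s0)) := fun s0 => by
    have : Continuous fun s => y ε s := hyc.comp (by fun_prop : Continuous fun s : ℝ => (ε, s))
    exact this.tendsto s0
  have := sub_eq_sum_jumps D (e ε) hinj (by linarith [ht0.2, ht1.1] : t0 ≤ t1) (fun s => h (y ε s))
    (fun κ => tl h κ.swap) (fun κ => hd h κ) (fun κ hκ => h3 κ hκ) ?_ ?_ ?_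
  · rw [← this, h1, h2]
  · intro s hs hsD
    have : y ε s ∉ wallSet W := by
      intro hc
      obtain ⟨κ, hκ, hk⟩ := mem_wallSet.1 hc
      by_cases q1 : Hosts σ κ
      · exact hsD κ (mem_filter.2 ⟨hκ, q1⟩) (hcl κ (mem_filter.2 ⟨hκ, q1⟩) s hk)
      by_cases q2 : Hosts σ κ.swap
      · have q3 : κ.swap ∈ D := mem_filter.2 ⟨hW.symm κ hκ, q2⟩
        exact hsD _ q3 (hcl _ q3 s (by rwa [cl_swap]))
      exact h5 κ hκ q1 q2 s hs hk
    exact (hconts s).eventually (H _ this)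
  · intro κ hκ
    have h6 := (h4 κ hκ).2.2.2
    have hβ := (hF κ (hDh κ hκ)).2.1
    rw [SideVal, pt_swap, ← hcross κ hκ] at h6
    filter_upwards [((hconts _).eventually h6).filter_mono nhdsWithin_le_nhds,
      self_mem_nhdsWithin] with s hs1 hs2
    apply hs1
    rw [side_swap, hslope κ hκ]
    have hs2 : s < e ε κ := hs2
    have : 0 < (e ε κ - s) * (β κ * ((σ.2.1 - σ.1.1) ^ 2 + (σ.2.2 - σ.1.2) ^ 2)) :=
      mul_pos (by linarith) (by positivity)
    linarith
  · intro κ hκ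
    have h6 := (h4 κ hκ).2.2.1
    have hβ := (hF κ (hDh κ hκ)).2.1
    rw [SideVal, ← hcross κ hκ] at h6
    filter_upwards [((hconts _).eventually h6).filter_mono nhdsWithin_le_nhds,
      self_mem_nhdsWithin] with s hs1 hs2
    apply hs1
    rw [hslope κ hκ]
    have hs2 : e ε κ < s := hs2
    exact mul_pos (by linarith) (by positivity)

/-- Points outside the closed square of half-width `K`. -/
def Far (K : ℝ) (p : Pt) : Prop := K < |p.1| ∨ K < |p.2|

/-- A signed wall system. Walls end at points of `P` (tips), far away, or on another wall of the
same sign; only the walls in `Mis`, lying on the line through `L`, end on a wall of the opposite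
sign. -/
structure Sys (K : ℝ) (P : Finset Pt) (L : Pt × Pt) (W : Finset (Pt × Pt)) (φ : Pt × Pt → ℤ)
    (Mis : Finset (Pt × Pt)) : Prop extends Walls W where
  sign : ∀ κ ∈ W, φ κ = 1 ∨ φ κ = -1
  flat : ∀ κ ∈ W, κ.2 ∉ P → φ κ.swap = φ κ
  head : ∀ κ ∈ W, κ.2 ∈ P ∨ Far K κ.2 ∨
    ∃ δ ∈ W, Hosts δ κ ∧ φ δ = if κ ∈ Mis then -φ κ else φ κ
  tip : ∀ κ ∈ W, ∀ v ∈ P, v ∉ rel κ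
  mis_sub : Mis ⊆ W
  mis_line : ∀ μ ∈ Mis, side L μ.1 = 0 ∧ side L μ.2 = 0
  mis_swap : ∀ μ ∈ Mis, μ.swap ∉ Mis
  mis_free : ∀ μ ∈ Mis, ∀ κ ∈ W, κ.2 ∉ rel μ

lemma Hosts.unique {W : Finset (Pt × Pt)} (hW : Walls W) {δ δ' κ : Pt × Pt} (hδ : δ ∈ W)
    (hδ' : δ' ∈ W) (h : Hosts δ κ) (h' : Hosts δ' κ) : δ = δ' := by
  by_contra hne
  have : δ = δ'.swap := by
    by_contra hc
    exact Set.disjoint_left.1 (hW.disj δ hδ δ' hδ' hne hc) h.1 h'.1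
  have h1 := h.2
  rw [this, side_swap] at h1
  linarith [h'.2]

section

variable {K : ℝ} {P : Finset Pt} {L : Pt × Pt} {W Mis : Finset (Pt × Pt)} {φ : Pt × Pt → ℤ}

lemma sum_swap {M : Type*} [AddCommMonoid M] (hW : Walls W) (f : Pt × Pt → M) :
    ∑ κ ∈ W, f κ = ∑ κ ∈ W, f κ.swap :=
  sum_nbij' Prod.swap Prod.swap (fun κ hκ => hW.symm κ hκ) (fun κ hκ => hW.symm κ hκ)
    (fun κ _ => Prod.swap_swap κ) (fun κ _ => Prod.swap_swap κ) (fun κ _ => by simp)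

/-- The balance identity. -/
lemma Sys.balance (S : Sys K P L W φ Mis) (hP : ∀ v ∈ P, side L v ≠ 0) {h : Pt → ℤ}
    (H : LC h (wallSet W)) (hfar : ∀ p, Far K p → ∀ᶠ y in 𝓝 p, h y = 0) :
    ∑ κ ∈ W with κ.2 ∈ P, (φ κ * hd h κ - φ κ.swap * tl h κ.swap) +
      ∑ μ ∈ Mis, 2 * φ μ * (hd h μ - tl h μ.swap) = 0 := by
  have hW := S.toWalls
  let g : Pt × Pt → ℤ := fun κ => ∑ δ ∈ W with Hosts δ κ, φ δ
  let T : Pt × Pt → ℤ := fun κ =>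
    φ κ * hd h κ - φ κ.swap * tl h κ.swap - g κ * (hd h κ - tl h κ.swap)
  have hT : ∑ κ ∈ W, T κ = 0 := by
    have h1 : ∑ δ ∈ W, φ δ * (hd h δ - tl h δ) = ∑ κ ∈ W, g κ * (hd h κ - tl h κ.swap) := by
      calc ∑ δ ∈ W, φ δ * (hd h δ - tl h δ)
          = ∑ δ ∈ W, ∑ κ ∈ W, if Hosts δ κ then φ δ * (hd h κ - tl h κ.swap) else 0 := by
            refine sum_congr rfl fun δ hδ => ?_
            rw [hW.hd_sub_tl H hδ, mul_sum, sum_filter]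
        _ = ∑ κ ∈ W, ∑ δ ∈ W, if Hosts δ κ then φ δ * (hd h κ - tl h κ.swap) else 0 := sum_comm
        _ = _ := by
            refine sum_congr rfl fun κ _ => ?_
            simp only [g]
            rw [sum_mul, sum_filter]
    have h2 : ∑ δ ∈ W, φ δ * tl h δ = ∑ κ ∈ W, φ κ.swap * tl h κ.swap :=
      sum_swap hW fun κ => φ κ * tl h κ
    simp only [T, sum_sub_distrib]
    rw [← h1, ← h2, ← sum_sub_distrib]
    simp only [mul_sub, sub_self]
  have g_host : ∀ κ, ∀ δ ∈ W, Hosts δ κ → g κ = φ δ := by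
    intro κ δ hδ hh
    have : W.filter (fun δ => Hosts δ κ) = {δ} := by
      ext δ'
      simp only [mem_filter, mem_singleton]
      exact ⟨fun h' => Hosts.unique hW h'.1 hδ h'.2 hh, fun h' => h' ▸ ⟨hδ, hh⟩⟩
    simp only [g, this, sum_singleton]
  have hMisP : ∀ μ ∈ Mis, μ.2 ∉ P := fun μ hμ hc => hP _ hc (S.mis_line μ hμ).2
  have t1 : ∀ κ ∈ W, κ.2 ∈ P → T κ = φ κ * hd h κ - φ κ.swap * tl h κ.swap := by
    intro κ hκ hκP
    have : W.filter (fun δ => Hosts δ κ) = ∅ := by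
      rw [filter_eq_empty_iff]
      exact fun δ hδ hh => S.tip δ hδ _ hκP hh.1
    simp only [T, g, this, sum_empty, zero_mul, sub_zero]
  have t2 : ∀ κ ∈ W, κ.2 ∉ P → T κ = if κ ∈ Mis then 2 * φ κ * (hd h κ - tl h κ.swap) else 0 := by
    intro κ hκ hκP
    have hf := S.flat κ hκ hκP
    rcases S.head κ hκ with h1 | h1 | ⟨δ, hδ, hh, hv⟩
    · exact absurd h1 hκP
    · have e1 : hd h κ = 0 := hd_eq_of_nhds (hW.ne κ hκ) ((hfar _ h1).mono fun y hy _ => hy)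
      have e2 : tl h κ.swap = 0 := tl_eq_of_nhds (hW.ne _ (hW.symm κ hκ))
        ((hfar _ h1).mono fun y hy _ => hy)
      simp only [T, e1, e2]; simp
    · simp only [T, g_host κ δ hδ hh, hv, hf]
      split_ifs <;> ring
  rw [← hT, ← sum_filter_add_sum_filter_not W (fun κ => κ.2 ∈ P) T]
  congr 1
  · exact sum_congr rfl fun κ hκ => (t1 κ (mem_filter.1 hκ).1 (mem_filter.1 hκ).2).symm
  · rw [sum_congr rfl fun κ hκ => t2 κ (mem_filter.1 hκ).1 (mem_filter.1 hκ).2, ← sum_filter]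
    congr 1
    ext κ
    simp only [mem_filter]
    exact ⟨fun h => ⟨⟨S.mis_sub h, hMisP κ h⟩, h⟩, fun h => h.2⟩

end

/-- Prescribe the values of a sign function on both darts of a segment. -/
noncomputable def setSign (φ : Pt × Pt → ℤ) (N : Pt × Pt) (α β : ℤ) : Pt × Pt → ℤ := fun κ =>
  if κ = N then α else if κ = N.swap then β else φ κ

lemma swap_ne {N : Pt × Pt} (hN : N.1 ≠ N.2) : N.swap ≠ N := fun h => hN (congrArg Prod.snd h)

lemma setSign_self (φ : Pt × Pt → ℤ) (N : Pt × Pt) (α β : ℤ) : setSign φ N α β N = α := by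
  simp [setSign]

lemma setSign_swap (φ : Pt × Pt → ℤ) {N : Pt × Pt} (hN : N.1 ≠ N.2) (α β : ℤ) :
    setSign φ N α β N.swap = β := by
  simp [setSign, swap_ne hN]

lemma setSign_of_ne (φ : Pt × Pt → ℤ) {N κ : Pt × Pt} (α β : ℤ) (h1 : κ ≠ N) (h2 : κ ≠ N.swap) :
    setSign φ N α β κ = φ κ := by
  simp [setSign, h1, h2]

lemma rel_nonempty (N : Pt × Pt) : (rel N).Nonempty := ⟨_, 1 / 2, by norm_num, rfl⟩

lemma rel_fst_subset {μ : Pt × Pt} {x : Pt} (hx : x ∈ rel μ) : rel (μ.1, x) ⊆ rel μ := by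
  obtain ⟨t, ht, rfl⟩ := hx
  rintro y ⟨s, hs, rfl⟩
  refine ⟨s * t, ⟨mul_pos hs.1 ht.1, by nlinarith [hs.1, hs.2, ht.1, ht.2]⟩, ?_⟩
  ext <;> simp [pt] <;> ring

lemma rel_snd_subset {μ : Pt × Pt} {x : Pt} (hx : x ∈ rel μ) : rel (x, μ.2) ⊆ rel μ := by
  rw [← rel_swap μ] at hx ⊢
  rw [← rel_swap]
  exact rel_fst_subset hx

lemma side_pos_of_mem_rel {N κ : Pt × Pt} (h1 : 0 < side N κ.1) (h2 : side N κ.2 = 0) {y : Pt}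
    (hy : y ∈ rel κ) : 0 < side N y := by
  obtain ⟨t, ht, rfl⟩ := hy
  rw [side_pt, h2]
  have := mul_pos (sub_pos.2 ht.2) h1
  linarith

lemma side_pos_of_mem_rel' {N κ : Pt × Pt} (h1 : side N κ.1 = 0) (h2 : 0 < side N κ.2) {y : Pt}
    (hy : y ∈ rel κ) : 0 < side N y := by
  rw [← rel_swap] at hy
  exact side_pos_of_mem_rel (N := N) (κ := κ.swap) h2 h1 hy

section

variable {K : ℝ} {P : Finset Pt} {L : Pt × Pt} {W Mis : Finset (Pt × Pt)} {φ : Pt × Pt → ℤ}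

lemma notMem_of_disjoint {N : Pt × Pt} (hfree : ∀ κ ∈ W, Disjoint (rel N) (cl κ)) : N ∉ W := by
  intro h
  obtain ⟨x, hx⟩ := rel_nonempty N
  exact Set.disjoint_left.1 (hfree N h) hx (rel_subset_cl N hx)

lemma swap_notMem_of_disjoint {N : Pt × Pt} (hfree : ∀ κ ∈ W, Disjoint (rel N) (cl κ)) :
    N.swap ∉ W := by
  intro h
  obtain ⟨x, hx⟩ := rel_nonempty N
  refine Set.disjoint_left.1 (hfree N.swap h) hx ?_
  rw [cl_swap]; exact rel_subset_cl N hx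

/-- Insertion of a new wall whose relative interior avoids all other walls. -/
lemma Sys.attach (S : Sys K P L W φ Mis) {N : Pt × Pt} (hN : N.1 ≠ N.2) (α β : ℤ) (m : Prop)
    (hfree : ∀ κ ∈ W, Disjoint (rel N) (cl κ))
    (hα : α = 1 ∨ α = -1) (hβ : β = 1 ∨ β = -1)
    (hflat : N.1 ∉ P ∨ N.2 ∉ P → α = β)
    (h2 : N.2 ∈ P ∨ Far K N.2 ∨ ∃ δ ∈ W, Hosts δ N ∧ φ δ = if m then -α else α)
    (h1 : N.1 ∈ P ∨ Far K N.1 ∨ ∃ δ ∈ W, Hosts δ N.swap ∧ φ δ = β)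
    (htip : ∀ v ∈ P, v ∉ rel N)
    (hm : m → side L N.1 = 0 ∧ side L N.2 = 0)
    (hmis : ∀ μ ∈ Mis, N.1 ∉ rel μ ∧ N.2 ∉ rel μ) :
    Sys K P L (insert N (insert N.swap W)) (setSign φ N α β)
      (if m then insert N Mis else Mis) := by
  have hNW := notMem_of_disjoint hfree
  have hNW' := swap_notMem_of_disjoint hfree
  have hφ : ∀ κ ∈ W, setSign φ N α β κ = φ κ := fun κ hκ =>
    setSign_of_ne φ α β (fun h => hNW (h ▸ hκ)) (fun h => hNW' (h ▸ hκ))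
  have hφ1 := setSign_self φ N α β
  have hφ2 := setSign_swap φ hN α β
  have hMisW : ∀ κ ∈ W, (κ ∈ (if m then insert N Mis else Mis) ↔ κ ∈ Mis) := by
    intro κ hκ
    have : κ ≠ N := fun h => hNW (h ▸ hκ)
    split_ifs <;> simp [this]
  have hMisN : N ∈ (if m then insert N Mis else Mis) ↔ m := by
    have : N ∉ Mis := fun h => hNW (S.mis_sub h)
    split_ifs with h <;> simp [h, this]
  have hMisN' : N.swap ∉ (if m then insert N Mis else Mis) := by
    have : N.swap ∉ Mis := fun h => hNW' (S.mis_sub h)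
    split_ifs with h <;> simp [swap_ne hN, this]
  have hMis' : ∀ κ ∈ (if m then insert N Mis else Mis), κ ∈ Mis ∨ (κ = N ∧ m) := by
    intro κ hκ
    split_ifs at hκ with h
    · rcases mem_insert.1 hκ with h' | h'
      · exact Or.inr ⟨h', h⟩
      · exact Or.inl h'
    · exact Or.inl hκ
  have mem_cases : ∀ κ ∈ insert N (insert N.swap W), κ = N ∨ κ = N.swap ∨ κ ∈ W := by
    intro κ hκ; simpa using hκ
  refine { symm := ?_, ne := ?_, disj := ?_, sign := ?_, flat := ?_, head := ?_, tip := ?_,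
           mis_sub := ?_, mis_line := ?_, mis_swap := ?_, mis_free := ?_ }
  · intro κ hκ
    rcases mem_cases κ hκ with rfl | rfl | h
    · simp
    · simp
    · simp [S.symm κ h]
  · intro κ hκ
    rcases mem_cases κ hκ with rfl | rfl | h
    · exact hN
    · exact hN.symm
    · exact S.ne κ h
  · have dW : ∀ κ ∈ W, Disjoint (rel N) (rel κ) := fun κ hκ =>
      (hfree κ hκ).mono_right (rel_subset_cl κ)
    intro σ hσ τ hτ e1 e2
    rcases mem_cases σ hσ with rfl | rfl | hσ'
    · rcases mem_cases τ hτ with rfl | rfl | hτ'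
      · exact absurd rfl e1
      · simp at e2
      · exact dW τ hτ'
    · rcases mem_cases τ hτ with rfl | rfl | hτ'
      · exact absurd rfl e2
      · exact absurd rfl e1
      · rw [rel_swap]; exact dW τ hτ'
    · rcases mem_cases τ hτ with rfl | rfl | hτ'
      · exact (dW σ hσ').symm
      · rw [rel_swap]; exact (dW σ hσ').symm
      · exact S.disj σ hσ' τ hτ' e1 e2
  · intro κ hκ
    rcases mem_cases κ hκ with rfl | rfl | h
    · rwa [hφ1]
    · rwa [hφ2]
    · rw [hφ κ h]; exact S.sign κ h
  · intro κ hκ hκP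
    rcases mem_cases κ hκ with rfl | rfl | h
    · rw [hφ1, hφ2]; exact (hflat (Or.inr hκP)).symm
    · rw [Prod.swap_swap, hφ1, hφ2]; exact hflat (Or.inl hκP)
    · rw [hφ κ h, hφ _ (S.symm κ h)]; exact S.flat κ h hκP
  · intro κ hκ
    rcases mem_cases κ hκ with rfl | rfl | h
    · rcases h2 with h | h | ⟨δ, hδ, hh, hv⟩
      · exact Or.inl h
      · exact Or.inr (Or.inl h)
      · refine Or.inr (Or.inr ⟨δ, by simp [hδ], hh, ?_⟩)
        rw [hφ1, hφ δ hδ, hv]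
        by_cases hm' : m
        · rw [if_pos hm', if_pos (hMisN.2 hm')]
        · rw [if_neg hm', if_neg (fun h => hm' (hMisN.1 h))]
    · rcases h1 with h | h | ⟨δ, hδ, hh, hv⟩
      · exact Or.inl h
      · exact Or.inr (Or.inl h)
      · refine Or.inr (Or.inr ⟨δ, by simp [hδ], hh, ?_⟩)
        rw [hφ2, hφ δ hδ, hv, if_neg hMisN']
    · rcases S.head κ h with h' | h' | ⟨δ, hδ, hh, hv⟩
      · exact Or.inl h'
      · exact Or.inr (Or.inl h')
      · refine Or.inr (Or.inr ⟨δ, by simp [hδ], hh, ?_⟩)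
        rw [hφ κ h, hφ δ hδ, hv]
        by_cases hm' : κ ∈ Mis
        · rw [if_pos hm', if_pos ((hMisW κ h).2 hm')]
        · rw [if_neg hm', if_neg (fun h'' => hm' ((hMisW κ h).1 h''))]
  · intro κ hκ v hv
    rcases mem_cases κ hκ with rfl | rfl | h
    · exact htip v hv
    · rw [rel_swap]; exact htip v hv
    · exact S.tip κ h v hv
  · intro κ hκ
    rcases hMis' κ hκ with h | ⟨rfl, -⟩
    · simp [S.mis_sub h]
    · simp
  · intro κ hκ
    rcases hMis' κ hκ with h | ⟨rfl, h⟩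
    · exact S.mis_line κ h
    · exact hm h
  · intro κ hκ
    rcases hMis' κ hκ with h | ⟨rfl, h⟩
    · intro hc
      exact S.mis_swap κ h ((hMisW _ (S.symm κ (S.mis_sub h))).1 hc)
    · exact hMisN'
  · intro κ hκ τ hτ
    rcases hMis' κ hκ with h | ⟨rfl, -⟩
    · rcases mem_cases τ hτ with rfl | rfl | h'
      · exact (hmis κ h).2
      · exact (hmis κ h).1
      · exact S.mis_free κ h τ h'
    · rcases mem_cases τ hτ with rfl | rfl | h'
      · exact snd_notMem_rel hN
      · exact fst_notMem_rel hN
      · exact fun hc => Set.disjoint_left.1 (hfree τ h') hc (snd_mem_cl τ)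

/-- Removal of a wall on which no other wall ends. -/
lemma Sys.remove (S : Sys K P L W φ Mis) {μ : Pt × Pt} (hfree : ∀ κ ∈ W, κ.2 ∉ rel μ) :
    Sys K P L ((W.erase μ).erase μ.swap) φ ((Mis.erase μ).erase μ.swap) := by
  have hsub : ∀ κ ∈ (W.erase μ).erase μ.swap, κ ∈ W ∧ κ ≠ μ ∧ κ ≠ μ.swap := by
    intro κ hκ
    simp only [mem_erase] at hκ
    exact ⟨hκ.2.2, hκ.2.1, hκ.1⟩
  have hsub' : ∀ κ ∈ (Mis.erase μ).erase μ.swap, κ ∈ Mis := by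
    intro κ hκ
    simp only [mem_erase] at hκ
    exact hκ.2.2
  refine { symm := ?_, ne := fun κ hκ => S.ne κ (hsub κ hκ).1,
           disj := fun σ hσ τ hτ => S.disj σ (hsub σ hσ).1 τ (hsub τ hτ).1,
           sign := fun κ hκ => S.sign κ (hsub κ hκ).1,
           flat := fun κ hκ => S.flat κ (hsub κ hκ).1, head := ?_,
           tip := fun κ hκ => S.tip κ (hsub κ hκ).1,
           mis_sub := ?_, mis_line := fun κ hκ => S.mis_line κ (hsub' κ hκ),
           mis_swap := fun κ hκ hc => S.mis_swap κ (hsub' κ hκ) (hsub' _ hc),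
           mis_free := fun κ hκ τ hτ => S.mis_free κ (hsub' κ hκ) τ (hsub τ hτ).1 }
  · intro κ hκ
    obtain ⟨h1, h2, h3⟩ := hsub κ hκ
    simp only [mem_erase]
    refine ⟨fun h => h2 (Prod.swap_injective h), fun h => h3 ?_, S.symm κ h1⟩
    rw [← h, Prod.swap_swap]
  · intro κ hκ
    obtain ⟨h1, h2, h3⟩ := hsub κ hκ
    have hiff : κ ∈ (Mis.erase μ).erase μ.swap ↔ κ ∈ Mis := by
      simp [h2, h3]
    rcases S.head κ h1 with h' | h' | ⟨δ, hδ, hh, hv⟩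
    · exact Or.inl h'
    · exact Or.inr (Or.inl h')
    · refine Or.inr (Or.inr ⟨δ, ?_, hh, ?_⟩)
      · simp only [mem_erase]
        refine ⟨fun h => hfree κ h1 ?_, fun h => hfree κ h1 ?_, hδ⟩
        · rw [← rel_swap, ← h]; exact hh.1
        · rw [← h]; exact hh.1
      · rw [hv]
        by_cases hm' : κ ∈ Mis
        · rw [if_pos hm', if_pos (hiff.2 hm')]
        · rw [if_neg hm', if_neg (fun h'' => hm' (hiff.1 h''))]
  · intro κ hκ
    simp only [mem_erase] at hκ ⊢
    exact ⟨hκ.1, hκ.2.1, S.mis_sub hκ.2.2⟩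

end

section

variable {K : ℝ} {P : Finset Pt} {L : Pt × Pt} {W Mis : Finset (Pt × Pt)} {φ : Pt × Pt → ℤ}

lemma eq_of_side_eq_zero {N μ : Pt × Pt} (hA : 0 < side N μ.1) {x y : Pt} (hx : x ∈ rel μ)
    (hy : y ∈ cl μ) (h0 : side N x = 0) (h1 : side N y = 0) : y = x := by
  obtain ⟨s, hs, rfl⟩ := hx
  obtain ⟨t, ht, rfl⟩ := hy
  rw [side_pt] at h0 h1
  congr 1
  have e1 : (1 - s) * side N μ.1 * t = (1 - t) * side N μ.1 * s := by
    linear_combination t * h0 - s * h1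
  have e2 : side N μ.1 * (t - s) = 0 := by linear_combination e1
  rcases mul_eq_zero.1 e2 with h | h <;> linarith

lemma side_snd_neg {N μ : Pt × Pt} (hA : 0 < side N μ.1) {x : Pt} (hx : x ∈ rel μ)
    (h0 : side N x = 0) : side N μ.2 < 0 := by
  obtain ⟨s, hs, rfl⟩ := hx
  rw [side_pt] at h0
  by_contra hc
  have h1 := mul_pos (sub_pos.2 hs.2) hA
  have h2 := mul_nonneg hs.1.le (not_lt.1 hc)
  linarith

set_option maxHeartbeats 2000000 in
/-- Insertion of a wall `N` crossing the wall `μ` at `x`, cutting `μ` into two pieces. -/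
lemma Sys.cross (S : Sys K P L W φ Mis) (hP : ∀ v ∈ P, side L v ≠ 0) {μ N : Pt × Pt} {x : Pt}
    (hμ : μ ∈ W) (hμfree : ∀ κ ∈ W, κ.2 ∉ rel μ) (hμs : μ.swap ∉ Mis)
    (hμ1 : side L μ.1 = 0) (hμ2 : side L μ.2 = 0) (hN : N.1 ≠ N.2)
    (hxμ : x ∈ rel μ) (hxN : x ∈ rel N) (hA : 0 < side N μ.1) (α β : ℤ)
    (hfree : ∀ κ ∈ W, κ ≠ μ → κ ≠ μ.swap → Disjoint (rel N) (cl κ))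
    (hα : α = 1 ∨ α = -1) (hβ : β = 1 ∨ β = -1)
    (hflat : N.1 ∉ P ∨ N.2 ∉ P → α = β)
    (h2 : N.2 ∈ P ∨ Far K N.2 ∨ ∃ δ ∈ W, Hosts δ N ∧ φ δ = α)
    (h1 : N.1 ∈ P ∨ Far K N.1 ∨ ∃ δ ∈ W, Hosts δ N.swap ∧ φ δ = β)
    (htip : ∀ v ∈ P, v ∉ rel N)
    (hmis : ∀ ν ∈ Mis, ν ≠ μ → N.1 ∉ rel ν ∧ N.2 ∉ rel ν) :
    ∃ W' φ' Mis', Sys K P L W' φ' Mis' ∧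
      (∀ κ, κ ∈ W' ↔ κ = (x, μ.2) ∨ κ = (μ.2, x) ∨ κ = (μ.1, x) ∨ κ = (x, μ.1) ∨ κ = N ∨
        κ = N.swap ∨ κ ∈ W ∧ κ ≠ μ ∧ κ ≠ μ.swap) ∧
      (∀ κ ∈ W, κ ≠ μ → κ ≠ μ.swap → φ' κ = φ κ) ∧ φ' N = α ∧ φ' N.swap = β ∧
      φ' (μ.1, x) = φ μ ∧ φ' (x, μ.2) = β ∧
      (Mis'.card = (Mis.erase μ).card + (if α ≠ φ μ then 1 else 0) +
        (if β ≠ (if μ ∈ Mis then - φ μ else φ μ) then 1 else 0)) ∧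
      ((x, μ.2) ∈ Mis' ↔ β ≠ (if μ ∈ Mis then - φ μ else φ μ)) := by
  have hμne := S.ne μ hμ
  have hxN0 : side N x = 0 := side_of_mem_rel hxN
  have hB := side_snd_neg hA hxμ hxN0
  have hμP1 : μ.1 ∉ P := fun h => hP _ h hμ1
  have hμP2 : μ.2 ∉ P := fun h => hP _ h hμ2
  have hxL : side L x = 0 := by
    obtain ⟨t, -, rfl⟩ := hxμ
    rw [side_pt, hμ1, hμ2]; ring
  have hxP : x ∉ P := fun h => hP _ h hxL
  have hAx : μ.1 ≠ x := fun h => fst_notMem_rel hμne (h ▸ hxμ)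
  have hxB : x ≠ μ.2 := fun h => snd_notMem_rel hμne (h ▸ hxμ)
  have hφs : φ μ.swap = φ μ := S.flat μ hμ hμP2
  have hrelμ : ∀ κ ∈ W, κ ≠ μ → κ ≠ μ.swap → Disjoint (rel μ) (cl κ) := by
    intro κ hκ e1 e2
    rw [Set.disjoint_left]
    intro y hy hyc
    rcases mem_cl_cases hyc with h | h | h
    · exact Set.disjoint_left.1 (S.disj κ hκ μ hμ e1 e2) h hy
    · exact hμfree _ (S.symm κ hκ) (by rw [h] at hy; exact hy)
    · exact hμfree κ hκ (h ▸ hy)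
  -- removal of `μ`
  have hM1 : (Mis.erase μ).erase μ.swap = Mis.erase μ := by
    rw [erase_eq_of_notMem]
    exact fun h => hμs (mem_of_mem_erase h)
  have S1 := S.remove hμfree
  rw [hM1] at S1
  set W1 := (W.erase μ).erase μ.swap with hW1
  have memW1 : ∀ κ, κ ∈ W1 ↔ κ ∈ W ∧ κ ≠ μ ∧ κ ≠ μ.swap := by
    intro κ; simp only [hW1, mem_erase]; tauto
  have hostW1 : ∀ δ ∈ W, ∀ z, z ∈ rel δ → z ∉ rel μ → δ ∈ W1 := by
    intro δ hδ z hz hz'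
    refine (memW1 δ).2 ⟨hδ, fun h => hz' (h ▸ hz), fun h => hz' ?_⟩
    rw [h, rel_swap] at hz; exact hz
  have hNμ : ∀ z, side N z = 0 → z ∉ rel N → z ∉ rel μ := by
    intro z hz hz' hzμ
    exact hz' (eq_of_side_eq_zero hA hxμ (rel_subset_cl _ hzμ) hxN0 hz ▸ hxN)
  have hN1μ := hNμ N.1 (side_fst N) (fst_notMem_rel hN)
  have hN2μ := hNμ N.2 (side_snd N) (snd_notMem_rel hN)
  -- insertion of `N`
  have hf1 : ∀ κ ∈ W1, Disjoint (rel N) (cl κ) := fun κ hκ =>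
    hfree κ ((memW1 κ).1 hκ).1 ((memW1 κ).1 hκ).2.1 ((memW1 κ).1 hκ).2.2
  have S2 := S1.attach hN α β False hf1 hα hβ hflat
    (by
      rcases h2 with h | h | ⟨δ, hδ, hh, hv⟩
      · exact Or.inl h
      · exact Or.inr (Or.inl h)
      · exact Or.inr (Or.inr ⟨δ, hostW1 δ hδ _ hh.1 hN2μ, hh, by rw [if_neg not_false]; exact hv⟩))
    (by
      rcases h1 with h | h | ⟨δ, hδ, hh, hv⟩
      · exact Or.inl h
      · exact Or.inr (Or.inl h)
      · exact Or.inr (Or.inr ⟨δ, hostW1 δ hδ _ hh.1 hN1μ, hh, hv⟩))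
    htip (fun h => h.elim) (fun ν hν => hmis ν (mem_of_mem_erase hν) (ne_of_mem_erase hν))
  rw [if_neg not_false] at S2
  have hNW1 := notMem_of_disjoint hf1
  have hNW1' := swap_notMem_of_disjoint hf1
  set W2 := insert N (insert N.swap W1) with hW2
  set φ2 := setSign φ N α β with hφ2
  have memW2 : ∀ κ, κ ∈ W2 ↔ κ = N ∨ κ = N.swap ∨ κ ∈ W1 := by intro κ; simp [hW2]
  have φ2W1 : ∀ κ ∈ W1, φ2 κ = φ κ := fun κ hκ =>
    setSign_of_ne φ α β (fun h => hNW1 (h ▸ hκ)) (fun h => hNW1' (h ▸ hκ))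
  have φ2N : φ2 N = α := setSign_self φ N α β
  have φ2N' : φ2 N.swap = β := setSign_swap φ hN α β
  -- insertion of the first piece
  have relA : ∀ y ∈ rel (μ.1, x), 0 < side N y := fun y hy =>
    side_pos_of_mem_rel (κ := (μ.1, x)) hA hxN0 hy
  have hf2 : ∀ κ ∈ W2, Disjoint (rel (μ.1, x)) (cl κ) := by
    intro κ hκ
    rcases (memW2 κ).1 hκ with rfl | rfl | h
    · exact Set.disjoint_left.2 fun y hy hyc => (relA y hy).ne' (side_of_mem_cl hyc)
    · rw [cl_swap]
      exact Set.disjoint_left.2 fun y hy hyc => (relA y hy).ne' (side_of_mem_cl hyc)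
    · obtain ⟨a, b, c⟩ := (memW1 κ).1 h
      exact (hrelμ κ a b c).mono_left (rel_fst_subset hxμ)
  have hAmis : ∀ ν ∈ Mis.erase μ, μ.1 ∉ rel ν ∧ μ.2 ∉ rel ν ∧ x ∉ rel ν := by
    intro ν hν
    have hν' := mem_of_mem_erase hν
    refine ⟨S.mis_free ν hν' _ (S.symm μ hμ), S.mis_free ν hν' _ hμ, fun hc => ?_⟩
    exact Set.disjoint_left.1 (S.disj ν (S.mis_sub hν') μ hμ (ne_of_mem_erase hν)
      (fun h => hμs (h ▸ hν'))) hc hxμ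
  have hostA : Far K μ.1 ∨ ∃ δ ∈ W1, Hosts δ (x, μ.1) ∧ φ δ = φ μ := by
    rcases S.head _ (S.symm μ hμ) with h | h | ⟨δ, hδ, hh, hv⟩
    · exact absurd h hμP1
    · exact Or.inl h
    · refine Or.inr ⟨δ, hostW1 δ hδ _ hh.1 (fst_notMem_rel hμne), ⟨hh.1, ?_⟩, ?_⟩
      · exact side_pos_of_mem_rel' (κ := μ) (side_of_mem_rel hh.1) hh.2 hxμ
      · rw [hv, if_neg hμs, hφs]
  have S3 := S2.attach (N := (μ.1, x)) hAx (φ μ) (φ μ) (α ≠ φ μ) hf2 (S.sign μ hμ) (S.sign μ hμ)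
    (fun _ => rfl)
    (by
      refine Or.inr (Or.inr ⟨N, by simp [hW2], ⟨hxN, hA⟩, ?_⟩)
      rw [φ2N]
      by_cases hc : α = φ μ
      · simp [hc]
      · rw [if_pos hc]
        rcases hα with h | h <;> rcases S.sign μ hμ with h' | h' <;> rw [h, h'] at hc ⊢ <;>
          simp at hc ⊢)
    (by
      rcases hostA with h | ⟨δ, hδ, hh, hv⟩
      · exact Or.inr (Or.inl h)
      · exact Or.inr (Or.inr ⟨δ, (memW2 δ).2 (Or.inr (Or.inr hδ)), hh, by rw [φ2W1 δ hδ, hv]⟩))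
    (fun v hv hc => S.tip μ hμ v hv (rel_fst_subset hxμ hc))
    (fun _ => ⟨hμ1, hxL⟩) (fun ν hν => ⟨(hAmis ν hν).1, (hAmis ν hν).2.2⟩)
  have hAW2 := notMem_of_disjoint hf2
  have hAW2' := swap_notMem_of_disjoint hf2
  set W3 := insert (μ.1, x) (insert (x, μ.1) W2) with hW3
  have hW3' : insert (μ.1, x) (insert (μ.1, x).swap W2) = W3 := rfl
  rw [hW3'] at S3
  set φ3 := setSign φ2 (μ.1, x) (φ μ) (φ μ) with hφ3
  have memW3 : ∀ κ, κ ∈ W3 ↔ κ = (μ.1, x) ∨ κ = (x, μ.1) ∨ κ ∈ W2 := by intro κ; simp [hW3]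
  have φ3W2 : ∀ κ ∈ W2, φ3 κ = φ2 κ := fun κ hκ =>
    setSign_of_ne φ2 _ _ (fun h => hAW2 (h ▸ hκ)) (fun h => hAW2' (h ▸ hκ))
  set Mis3 := (if α ≠ φ μ then insert (μ.1, x) (Mis.erase μ) else Mis.erase μ) with hMis3
  replace S3 : Sys K P L W3 φ3 Mis3 := by convert S3
  -- insertion of the second piece
  have relB : ∀ y ∈ rel (x, μ.2), side N y < 0 := fun y hy => by
    have : 0 < side N.swap y := by
      refine side_pos_of_mem_rel' (κ := (x, μ.2)) ?_ ?_ hy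
      · rw [side_swap]; simp [hxN0]
      · rw [side_swap]; simpa using hB
    rw [side_swap] at this
    linarith
  have hf3 : ∀ κ ∈ W3, Disjoint (rel (x, μ.2)) (cl κ) := by
    have hA' : Disjoint (rel (x, μ.2)) (cl (μ.1, x)) := by
      refine Set.disjoint_left.2 fun y hy hyc => ?_
      have := relB y hy
      rcases mem_cl_cases hyc with h | h | h
      · linarith [relA y h]
      · rw [h] at this; exact absurd this (by simpa using hA.le)
      · rw [h] at this; simp only at this; linarith
    intro κ hκ
    rcases (memW3 κ).1 hκ with rfl | rfl | h
    · exact hA'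
    · have : cl (x, μ.1) = cl (μ.1, x) := cl_swap (μ.1, x)
      rw [this]; exact hA'
    rcases (memW2 κ).1 h with rfl | rfl | h
    · exact Set.disjoint_left.2 fun y hy hyc => (relB y hy).ne (side_of_mem_cl hyc)
    · rw [cl_swap]
      exact Set.disjoint_left.2 fun y hy hyc => (relB y hy).ne (side_of_mem_cl hyc)
    · obtain ⟨a, b, c⟩ := (memW1 κ).1 h
      exact (hrelμ κ a b c).mono_left (rel_snd_subset hxμ)
  set q : ℤ := if μ ∈ Mis then - φ μ else φ μ with hq
  have hq1 : q = 1 ∨ q = -1 := by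
    rw [hq]; rcases S.sign μ hμ with h | h <;> rw [h] <;> split_ifs <;> simp
  have hostB : Far K μ.2 ∨ ∃ δ ∈ W1, Hosts δ (x, μ.2) ∧ φ δ = q := by
    rcases S.head _ hμ with h | h | ⟨δ, hδ, hh, hv⟩
    · exact absurd h hμP2
    · exact Or.inl h
    · refine Or.inr ⟨δ, hostW1 δ hδ _ hh.1 (snd_notMem_rel hμne), ⟨hh.1, ?_⟩, hv⟩
      exact side_pos_of_mem_rel (κ := μ) hh.2 (side_of_mem_rel hh.1) hxμ
  have S4 := S3.attach (N := (x, μ.2)) hxB β β (β ≠ q) hf3 hβ hβ (fun _ => rfl)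
    (by
      rcases hostB with h | ⟨δ, hδ, hh, hv⟩
      · exact Or.inr (Or.inl h)
      · have hδ2 := (memW2 δ).2 (Or.inr (Or.inr hδ))
        refine Or.inr (Or.inr ⟨δ, (memW3 δ).2 (Or.inr (Or.inr hδ2)), hh, ?_⟩)
        rw [φ3W2 δ hδ2, φ2W1 δ hδ, hv]
        by_cases hc : β = q
        · simp [hc]
        · rw [if_pos hc]
          rcases hβ with h | h <;> rcases hq1 with h' | h' <;> rw [h, h'] at hc ⊢ <;>
            simp at hc ⊢)
    (by
      have : N.swap ∈ W2 := by simp [hW2]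
      refine Or.inr (Or.inr ⟨N.swap, (memW3 _).2 (Or.inr (Or.inr this)), ⟨?_, ?_⟩, ?_⟩)
      · rw [rel_swap]; exact hxN
      · rw [side_swap]; simpa using hB
      · rw [φ3W2 _ this, φ2N'])
    (fun v hv hc => S.tip μ hμ v hv (rel_snd_subset hxμ hc))
    (fun _ => ⟨hxL, hμ2⟩)
    (by
      intro ν hν
      have : ν ∈ Mis.erase μ ∨ ν = (μ.1, x) := by
        rw [hMis3] at hν
        split_ifs at hν
        · exact (mem_insert.1 hν).symm
        · exact Or.inl hν
      rcases this with h | rfl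
      · exact ⟨(hAmis ν h).2.2, (hAmis ν h).2.1⟩
      · refine ⟨snd_notMem_rel (κ := (μ.1, x)) hAx, fun hc => ?_⟩
        exact snd_notMem_rel hμne (rel_fst_subset hxμ hc))
  have hBW3 := notMem_of_disjoint hf3
  have hBW3' := swap_notMem_of_disjoint hf3
  set φ4 := setSign φ3 (x, μ.2) β β with hφ4
  have φ4W3 : ∀ κ ∈ W3, φ4 κ = φ3 κ := fun κ hκ =>
    setSign_of_ne φ3 _ _ (fun h => hBW3 (h ▸ hκ)) (fun h => hBW3' (h ▸ hκ))
  have W23 : ∀ κ ∈ W2, κ ∈ W3 := fun κ hκ => (memW3 κ).2 (Or.inr (Or.inr hκ))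
  have hAMis : (μ.1, x) ∉ Mis.erase μ := fun h =>
    hAW2 ((memW2 _).2 (Or.inr (Or.inr ((memW1 _).2 ⟨S.mis_sub (mem_of_mem_erase h),
      ne_of_mem_erase h, fun h' => hμs (h' ▸ mem_of_mem_erase h)⟩))))
  have hBMis3 : (x, μ.2) ∉ Mis3 := fun h => hBW3 (S3.mis_sub h)
  refine ⟨_, φ4, _, S4, ?_, ?_, ?_, ?_, ?_, ?_, ?_, ?_⟩
  · intro κ
    rw [← memW1]
    simp only [mem_insert, memW3, memW2, Prod.swap_prod_mk]
  · intro κ hκ e1 e2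
    have k1 := (memW1 κ).2 ⟨hκ, e1, e2⟩
    have k2 := (memW2 κ).2 (Or.inr (Or.inr k1))
    rw [φ4W3 κ (W23 κ k2), φ3W2 κ k2, φ2W1 κ k1]
  · have k2 := (memW2 N).2 (Or.inl rfl)
    rw [φ4W3 _ (W23 _ k2), φ3W2 _ k2, φ2N]
  · have k2 := (memW2 N.swap).2 (Or.inr (Or.inl rfl))
    rw [φ4W3 _ (W23 _ k2), φ3W2 _ k2, φ2N']
  · rw [φ4W3 _ ((memW3 _).2 (Or.inl rfl))]; exact setSign_self _ _ _ _
  · exact setSign_self _ _ _ _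
  · by_cases hc : β ≠ q
    · rw [if_pos hc, if_pos hc, card_insert_of_notMem hBMis3]
      congr 1
      rw [hMis3]
      split_ifs
      · rw [card_insert_of_notMem hAMis]
      · rfl
    · rw [if_neg hc, if_neg hc, add_zero]
      rw [hMis3]
      split_ifs
      · rw [card_insert_of_notMem hAMis]
      · rfl
  · by_cases hc : β ≠ q
    · simp [hc]
    · simp only [if_neg hc]
      exact iff_of_false hBMis3 hc

end

lemma far_iff {K : ℝ} {p : Pt} : Far K p ↔ K < ‖p‖ := by
  rw [Far, Prod.norm_def, lt_max_iff, Real.norm_eq_abs, Real.norm_eq_abs]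

lemma pt_pt (κ : Pt × Pt) (s t u : ℝ) : pt (pt κ s, pt κ t) u = pt κ (s + u * (t - s)) := by
  ext <;> simp [pt] <;> ring

lemma rel_pt (κ : Pt × Pt) {s t : ℝ} (h : s < t) : rel (pt κ s, pt κ t) = pt κ '' Set.Ioo s t := by
  ext x
  constructor
  · rintro ⟨u, hu, rfl⟩
    exact ⟨_, ⟨by nlinarith [hu.1, hu.2], by nlinarith [hu.1, hu.2]⟩, (pt_pt κ s t u).symm⟩
  · rintro ⟨u, hu, rfl⟩
    have h' : 0 < t - s := sub_pos.2 h
    refine ⟨(u - s) / (t - s), ⟨div_pos (sub_pos.2 hu.1) h', (div_lt_one h').2 (by linarith [hu.2])⟩, ?_⟩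
    rw [pt_pt]; congr 1; field_simp; ring

lemma cl_pt (κ : Pt × Pt) {s t : ℝ} (h : s < t) : cl (pt κ s, pt κ t) = pt κ '' Set.Icc s t := by
  ext x
  constructor
  · rintro ⟨u, hu, rfl⟩
    exact ⟨_, ⟨by nlinarith [hu.1, hu.2], by nlinarith [hu.1, hu.2]⟩, (pt_pt κ s t u).symm⟩
  · rintro ⟨u, hu, rfl⟩
    have h' : 0 < t - s := sub_pos.2 h
    refine ⟨(u - s) / (t - s), ⟨div_nonneg (sub_nonneg.2 hu.1) h'.le,
      (div_le_one h').2 (by linarith [hu.2])⟩, ?_⟩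
    rw [pt_pt]; congr 1; field_simp; ring

lemma convex_cl {s : Set Pt} (hs : Convex ℝ s) {κ : Pt × Pt} (h1 : κ.1 ∈ s) (h2 : κ.2 ∈ s) :
    cl κ ⊆ s := by
  rw [cl_eq_segment]; exact hs.segment_subset h1 h2

lemma norm_lt_of_mem_cl {K : ℝ} {κ : Pt × Pt} (h1 : ‖κ.1‖ < K) (h2 : ‖κ.2‖ < K) {x : Pt}
    (hx : x ∈ cl κ) : ‖x‖ < K := by
  have := convex_cl (convex_ball (0 : Pt) K) (κ := κ) (by simpa using h1) (by simpa using h2) hx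
  simpa using this

/-- Three points with zero `side` with respect to a common line are collinear. -/
lemma side_eq_zero_of_line {L κ : Pt × Pt} (hL : L.1 ≠ L.2) (h1 : side L κ.1 = 0)
    (h2 : side L κ.2 = 0) {x : Pt} (hx : side L x = 0) : side κ x = 0 := by
  obtain ⟨s, hs⟩ := exists_pt_of_side_eq_zero hL h1
  obtain ⟨t, ht⟩ := exists_pt_of_side_eq_zero hL h2
  obtain ⟨u, rfl⟩ := exists_pt_of_side_eq_zero hL hx
  rw [side_eq, hs, ht]
  simp only [pt_fst, pt_snd]; ring

/-- For a dart `μ` on the line of `L`, the functions `side L` and `side μ` are proportional. -/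
lemma exists_side_eq_mul {L μ : Pt × Pt} (hL : L.1 ≠ L.2) (hμ : μ.1 ≠ μ.2) (h1 : side L μ.1 = 0)
    (h2 : side L μ.2 = 0) : ∃ c : ℝ, c ≠ 0 ∧ ∀ v, side μ v = c * side L v := by
  obtain ⟨s, hs⟩ := exists_pt_of_side_eq_zero hL h1
  obtain ⟨t, ht⟩ := exists_pt_of_side_eq_zero hL h2
  refine ⟨t - s, fun h => hμ ?_, fun v => ?_⟩
  · rw [hs, ht, sub_eq_zero.1 h]
  · simp only [side_eq, hs, ht, pt_fst, pt_snd]; ring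

lemma exists_large_norm {κ : Pt × Pt} (h : κ.1 ≠ κ.2) (K t0 : ℝ) : ∃ T, t0 ≤ T ∧ K ≤ ‖pt κ T‖ := by
  have hd : 0 < ‖κ.2 - κ.1‖ := norm_pos_iff.2 (sub_ne_zero.2 h.symm)
  refine ⟨max t0 (max 0 ((K + ‖κ.1‖) / ‖κ.2 - κ.1‖)), le_max_left _ _, ?_⟩
  set T := max t0 (max 0 ((K + ‖κ.1‖) / ‖κ.2 - κ.1‖))
  have h1 : (K + ‖κ.1‖) / ‖κ.2 - κ.1‖ ≤ T := (le_max_right _ _).trans (le_max_right _ _)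
  have h0 : 0 ≤ T := (le_max_left _ _).trans (le_max_right _ _)
  rw [div_le_iff₀ hd] at h1
  have h2 : ‖T • (κ.2 - κ.1)‖ = T * ‖κ.2 - κ.1‖ := by rw [norm_smul, Real.norm_of_nonneg h0]
  have h3 : ‖T • (κ.2 - κ.1)‖ ≤ ‖pt κ T‖ + ‖κ.1‖ := by
    have : T • (κ.2 - κ.1) = pt κ T - κ.1 := by simp [pt]
    rw [this]; exact norm_sub_le _ _
  linarith

/-- The first point of a closed set containing the sphere met by a ray from inside. -/
lemma exists_first_hit {K : ℝ} {C : Set Pt} (hC : IsClosed C) (hsph : ∀ x : Pt, ‖x‖ = K → x ∈ C)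
    {κ : Pt × Pt} (h : κ.1 ≠ κ.2) {t0 : ℝ} (h0 : ‖pt κ t0‖ < K)
    (hev : ∀ᶠ t in 𝓝[>] t0, pt κ t ∉ C) :
    ∃ t1, t0 < t1 ∧ pt κ t1 ∈ C ∧ (∀ t ∈ Set.Ioo t0 t1, pt κ t ∉ C) ∧ ‖pt κ t1‖ ≤ K := by
  have hcn : Continuous fun t => ‖pt κ t‖ := (continuous_pt κ).norm
  have ivt : ∀ T, t0 ≤ T → K ≤ ‖pt κ T‖ → ∃ T0 ∈ Set.Icc t0 T, ‖pt κ T0‖ = K := by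
    intro T h1 h2
    exact intermediate_value_Icc h1 hcn.continuousOn ⟨h0.le, h2⟩
  obtain ⟨T, hT, hTK⟩ := exists_large_norm h K t0
  obtain ⟨T0, hT0, hT0K⟩ := ivt T hT hTK
  obtain ⟨ε, hε, hfree⟩ := mem_nhdsGT_iff_exists_Ioo_subset.1 hev
  have hε : t0 < ε := hε
  have big : ∀ t, t0 ≤ t → pt κ t ∈ C → ‖pt κ t‖ ≥ K → ε ≤ t := by
    intro t ht htC hK
    by_contra hc
    rcases ht.eq_or_lt with rfl | h'
    · linarith
    · exact hfree ⟨h', not_le.1 hc⟩ htC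
  set A := Set.Icc ((t0 + ε) / 2) T0 ∩ pt κ ⁻¹' C with hA
  have hAc : IsCompact A := isCompact_Icc.inter_right (hC.preimage (continuous_pt κ))
  have hT0A : T0 ∈ A := by
    have := big T0 hT0.1 (hsph _ hT0K) hT0K.ge
    exact ⟨⟨by linarith, le_rfl⟩, hsph _ hT0K⟩
  obtain ⟨t1, ht1, hmin⟩ := hAc.exists_isLeast ⟨T0, hT0A⟩
  have hlt : t0 < t1 := by have := ht1.1.1; linarith
  have hfr : ∀ t ∈ Set.Ioo t0 t1, pt κ t ∉ C := by
    intro t ht htC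
    rcases lt_or_ge t ε with h' | h'
    · exact hfree ⟨ht.1, h'⟩ htC
    · have : t ∈ A := ⟨⟨by linarith, ht.2.le.trans ht1.1.2⟩, htC⟩
      exact absurd (hmin this) (not_le.2 ht.2)
  refine ⟨t1, hlt, ht1.2, hfr, ?_⟩
  by_contra hc
  obtain ⟨t', ht', hK'⟩ := ivt t1 hlt.le (not_le.1 hc).le
  have hne : t' ≠ t1 := fun e => by rw [e] at hK'; exact hc hK'.le
  have hne0 : t' ≠ t0 := fun e => by rw [e] at hK'; linarith
  exact hfr t' ⟨lt_of_le_of_ne ht'.1 hne0.symm, lt_of_le_of_ne ht'.2 hne⟩ (hsph _ hK')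

section

variable {K : ℝ} {P : Finset Pt} {L : Pt × Pt} {W Mis : Finset (Pt × Pt)} {φ : Pt × Pt → ℤ}

/-- A point of a wall that is neither a tip nor far away is interior to some wall. -/
lemma Sys.exists_mem_rel (S : Sys K P L W φ Mis) {z : Pt} (hz : z ∈ wallSet W) (hzP : z ∉ P)
    (hzK : ‖z‖ ≤ K) : ∃ δ ∈ W, z ∈ rel δ := by
  have key : ∀ κ ∈ W, z = κ.2 → ∃ δ ∈ W, z ∈ rel δ := by
    rintro κ hκ rfl
    rcases S.head κ hκ with h | h | ⟨δ, hδ, h, -⟩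
    · exact absurd h hzP
    · rw [far_iff] at h; linarith
    · exact ⟨δ, hδ, h.1⟩
  obtain ⟨κ, hκ, h⟩ := mem_wallSet.1 hz
  rcases mem_cl_cases h with h | h | h
  · exact ⟨κ, hκ, h⟩
  · exact key κ.swap (S.symm κ hκ) h
  · exact key κ hκ h

/-- A free segment that ends in the interior of a wall is not collinear with it. -/
lemma exists_hosts {δ N : Pt × Pt} (hδ : δ.1 ≠ δ.2) (hz : N.2 ∈ rel δ)
    (hfree : Disjoint (rel N) (rel δ)) : ∃ δ', (δ' = δ ∨ δ' = δ.swap) ∧ Hosts δ' N := by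
  rcases lt_trichotomy (side δ N.1) 0 with h | h | h
  · exact ⟨δ.swap, Or.inr rfl, by rw [rel_swap]; exact hz, by rw [side_swap]; linarith⟩
  · obtain ⟨x, hx, hx'⟩ := rel_inter_of_collinear hδ hz h
    exact absurd hx (Set.disjoint_left.1 hfree hx')
  · exact ⟨δ, Or.inl rfl, hz, h⟩

end

section

variable {K : ℝ} {P : Finset Pt} {L : Pt × Pt} {W Mis : Finset (Pt × Pt)} {φ : Pt × Pt → ℤ}

lemma Sys.empty (K : ℝ) (P : Finset Pt) (L : Pt × Pt) (φ : Pt × Pt → ℤ) : Sys K P L ∅ φ ∅ :=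
  { symm := by simp, ne := by simp, disj := by simp, sign := by simp, flat := by simp,
    head := by simp, tip := by simp, mis_sub := by simp, mis_line := by simp,
    mis_swap := by simp, mis_free := by simp }

lemma Sys.attach_const {c : ℤ} (S : Sys K P L W φ ∅) (hφ : ∀ κ ∈ W, φ κ = c) (hc : c = 1 ∨ c = -1)
    {N : Pt × Pt} (hN : N.1 ≠ N.2) (hfree : ∀ κ ∈ W, Disjoint (rel N) (cl κ))
    (h2 : Far K N.2 ∨ ∃ δ ∈ W, Hosts δ N) (h1 : Far K N.1 ∨ ∃ δ ∈ W, Hosts δ N.swap)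
    (htip : ∀ v ∈ P, v ∉ rel N) :
    ∃ φ', Sys K P L (insert N (insert N.swap W)) φ' ∅ ∧
      ∀ κ ∈ insert N (insert N.swap W), φ' κ = c := by
  have S' := S.attach hN c c False hfree hc hc (fun _ => rfl)
    (Or.inr (h2.imp id fun ⟨δ, hδ, h⟩ => ⟨δ, hδ, h, by rw [if_neg not_false]; exact hφ δ hδ⟩))
    (Or.inr (h1.imp id fun ⟨δ, hδ, h⟩ => ⟨δ, hδ, h, hφ δ hδ⟩)) htip (fun h => h.elim) (by simp)
  rw [if_neg not_false] at S'
  refine ⟨_, S', fun κ hκ => ?_⟩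
  simp only [setSign]
  split_ifs with h h'
  · rfl
  · rfl
  · simp only [mem_insert] at hκ
    exact hφ κ (by tauto)

lemma cl_horizontal {a b y : ℝ} {x : Pt} (hx : x ∈ cl ((a, y), (b, y))) : x.2 = y := by
  obtain ⟨t, -, rfl⟩ := hx
  simp [pt]

lemma cl_vertical {a b x : ℝ} {p : Pt} (hp : p ∈ cl ((x, a), (x, b))) : p.1 = x := by
  obtain ⟨t, -, rfl⟩ := hp
  simp [pt]

lemma rel_vertical {x K : ℝ} (hK : 0 < K) {p : Pt} (hp : p ∈ rel ((x, -K), (x, K))) :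
    p.1 = x ∧ -K < p.2 ∧ p.2 < K := by
  obtain ⟨t, ht, rfl⟩ := hp
  refine ⟨by simp [pt], ?_, ?_⟩ <;> simp only [pt_snd] <;> nlinarith [ht.1, ht.2]

lemma le_norm_of_fst {K : ℝ} {p : Pt} (h : p.1 = K ∨ p.1 = -K) : K ≤ ‖p‖ := by
  refine le_trans ?_ (norm_fst_le p)
  rw [Real.norm_eq_abs]
  rcases h with h | h <;> rw [h]
  · exact le_abs_self K
  · rw [abs_neg]; exact le_abs_self K

lemma le_norm_of_snd {K : ℝ} {p : Pt} (h : p.2 = K ∨ p.2 = -K) : K ≤ ‖p‖ := by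
  refine le_trans ?_ (norm_snd_le p)
  rw [Real.norm_eq_abs]
  rcases h with h | h <;> rw [h]
  · exact le_abs_self K
  · rw [abs_neg]; exact le_abs_self K

/-- A wall system whose walls cover the boundary of the square of half-width `K`. -/
lemma exists_frame (hK : 0 < K) (hPK : ∀ v ∈ P, ‖v‖ < K) (L : Pt × Pt) {c : ℤ}
    (hc : c = 1 ∨ c = -1) :
    ∃ W φ, Sys K P L W φ ∅ ∧ (∀ κ ∈ W, φ κ = c) ∧ (∀ κ ∈ W, ∀ x ∈ cl κ, K ≤ ‖x‖) ∧
      (∀ κ ∈ W, ∀ x : Pt, ‖x‖ < K → side κ x ≠ 0) ∧ ∀ x : Pt, ‖x‖ = K → x ∈ wallSet W := by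
  let H1 : Pt × Pt := ((-(2 * K), -K), (2 * K, -K))
  let H2 : Pt × Pt := ((-(2 * K), K), (2 * K, K))
  let V1 : Pt × Pt := ((-K, -K), (-K, K))
  let V2 : Pt × Pt := ((K, -K), (K, K))
  have habs : K < |2 * K| := by rw [abs_of_pos] <;> linarith
  have far1 : ∀ y, Far K (-(2 * K), y) := fun y => Or.inl (by simpa [abs_neg] using habs)
  have far2 : ∀ y, Far K (2 * K, y) := fun y => Or.inl (by simpa using habs)
  have hcH1 : ∀ x ∈ cl H1, x.2 = -K := fun x => cl_horizontal
  have hcH2 : ∀ x ∈ cl H2, x.2 = K := fun x => cl_horizontal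
  have hcV1 : ∀ x ∈ cl V1, x.1 = -K := fun x => cl_vertical
  have hcV2 : ∀ x ∈ cl V2, x.1 = K := fun x => cl_vertical
  have hbig : ∀ N ∈ ({H1, H2, V1, V2} : Finset (Pt × Pt)), ∀ x ∈ cl N, K ≤ ‖x‖ := by
    intro N hN x hx
    simp only [mem_insert, mem_singleton] at hN
    rcases hN with rfl | rfl | rfl | rfl
    · exact le_norm_of_snd (Or.inr (hcH1 x hx))
    · exact le_norm_of_snd (Or.inl (hcH2 x hx))
    · exact le_norm_of_fst (Or.inr (hcV1 x hx))
    · exact le_norm_of_fst (Or.inl (hcV2 x hx))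
  have htip : ∀ N ∈ ({H1, H2, V1, V2} : Finset (Pt × Pt)), ∀ v ∈ P, v ∉ rel N :=
    fun N hN v hv hvN => (hPK v hv).not_ge (hbig N hN v (rel_subset_cl N hvN))
  obtain ⟨φ1, S1, h1⟩ := (Sys.empty K P L fun _ => c).attach_const (c := c) (N := H1) (by simp) hc
    (by intro h; have := congrArg Prod.fst h; simp [H1] at this; linarith) (by simp)
    (Or.inl (far2 _)) (Or.inl (far1 _)) (htip H1 (by simp))
  obtain ⟨φ2, S2, h2⟩ := S1.attach_const (N := H2) h1 hc
    (by intro h; have := congrArg Prod.fst h; simp [H2] at this; linarith)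
    (by
      have : Disjoint (rel H2) (cl H1) := Set.disjoint_left.2 fun x hx hx' => by
        have e1 := hcH2 x (rel_subset_cl _ hx)
        have e2 := hcH1 x hx'
        linarith
      intro κ hκ
      simp only [mem_insert, notMem_empty, or_false] at hκ
      rcases hκ with rfl | rfl
      · exact this
      · rw [cl_swap]; exact this)
    (Or.inl (far2 _)) (Or.inl (far1 _)) (htip H2 (by simp))
  have hrV : ∀ x0 : ℝ, ∀ x ∈ rel ((x0, -K), (x0, K)), x.1 = x0 ∧ -K < x.2 ∧ x.2 < K :=
    fun x0 x hx => rel_vertical hK hx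
  have hdV : ∀ x0 : ℝ, ∀ κ ∈ insert H2 (insert H2.swap (insert H1 (insert H1.swap (∅ : Finset (Pt × Pt))))),
      Disjoint (rel ((x0, -K), (x0, K))) (cl κ) := by
    intro x0 κ hκ
    refine Set.disjoint_left.2 fun x hx hx' => ?_
    obtain ⟨-, e1, e2⟩ := hrV x0 x hx
    simp only [mem_insert, notMem_empty, or_false] at hκ
    rcases hκ with rfl | rfl | rfl | rfl
    · linarith [hcH2 x hx']
    · rw [cl_swap] at hx'; linarith [hcH2 x hx']
    · linarith [hcH1 x hx']
    · rw [cl_swap] at hx'; linarith [hcH1 x hx']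
  have hostT : ∀ x0 : ℝ, |x0| = K → Hosts H2.swap ((x0, -K), (x0, K)) := by
    intro x0 hx0
    have := abs_le.1 hx0.le
    refine ⟨?_, ?_⟩
    · rw [rel_swap]
      refine ⟨(x0 + 2 * K) / (4 * K), ⟨by apply div_pos <;> linarith,
        by rw [div_lt_one] <;> linarith⟩, ?_⟩
      ext
      · rw [pt_fst]; simp only [H2]; field_simp; ring
      · rw [pt_snd]; simp [H2]
    · rw [side_swap, side_eq]; simp only [H2]; nlinarith
  have hostB : ∀ x0 : ℝ, |x0| = K → Hosts H1 ((x0, -K), (x0, K)).swap := by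
    intro x0 hx0
    have := abs_le.1 hx0.le
    refine ⟨?_, ?_⟩
    · refine ⟨(x0 + 2 * K) / (4 * K), ⟨by apply div_pos <;> linarith,
        by rw [div_lt_one] <;> linarith⟩, ?_⟩
      ext
      · rw [pt_fst]; simp only [H1, Prod.snd_swap]; field_simp; ring
      · rw [pt_snd]; simp [H1]
    · rw [side_eq]; simp only [H1, Prod.fst_swap]; nlinarith
  have hneV : ∀ x0 : ℝ, ((x0, -K) : Pt) ≠ (x0, K) := by
    intro x0 h; have := congrArg Prod.snd h; simp at this; linarith
  obtain ⟨φ3, S3, h3⟩ := S2.attach_const (N := V1) h2 hc (hneV _) (hdV _)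
    (Or.inr ⟨H2.swap, by simp, hostT _ (by rw [abs_neg, abs_of_pos hK])⟩)
    (Or.inr ⟨H1, by simp, hostB _ (by rw [abs_neg, abs_of_pos hK])⟩) (htip V1 (by simp))
  obtain ⟨φ4, S4, h4⟩ := S3.attach_const (N := V2) h3 hc (hneV _)
    (by
      intro κ hκ
      have : Disjoint (rel V2) (cl V1) := Set.disjoint_left.2 fun x hx hx' => by
        have e1 := hcV2 x (rel_subset_cl _ hx)
        have e2 := hcV1 x hx'
        linarith
      rw [mem_insert, mem_insert] at hκ
      rcases hκ with rfl | rfl | hκ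
      · exact this
      · rw [cl_swap]; exact this
      · exact hdV _ κ hκ)
    (Or.inr ⟨H2.swap, by simp, hostT _ (abs_of_pos hK)⟩)
    (Or.inr ⟨H1, by simp, hostB _ (abs_of_pos hK)⟩) (htip V2 (by simp))
  refine ⟨_, φ4, S4, h4, ?_, ?_, ?_⟩
  · intro κ hκ x hx
    simp only [mem_insert, notMem_empty, or_false] at hκ
    rcases hκ with rfl | rfl | rfl | rfl | rfl | rfl | rfl | rfl <;>
      first
      | (rw [cl_swap] at hx; exact hbig _ (by simp) x hx)
      | exact hbig _ (by simp) x hx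
  · have key : ∀ κ ∈ ({H1, H2, V1, V2} : Finset (Pt × Pt)), ∀ x : Pt, ‖x‖ < K → side κ x ≠ 0 := by
      intro κ hκ x hx h
      simp only [mem_insert, mem_singleton] at hκ
      have hx1 := abs_lt.1 ((norm_fst_le x).trans_lt hx)
      have hx2 := abs_lt.1 ((norm_snd_le x).trans_lt hx)
      rw [side_eq] at h
      rcases hκ with rfl | rfl | rfl | rfl <;> simp only [H1, H2, V1, V2] at h <;> nlinarith
    intro κ hκ x hx
    simp only [mem_insert, notMem_empty, or_false] at hκ
    rcases hκ with rfl | rfl | rfl | rfl | rfl | rfl | rfl | rfl <;>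
      first
      | (rw [side_swap]; exact neg_ne_zero.2 (key _ (by simp) x hx))
      | exact key _ (by simp) x hx
  · intro x hx
    have hx1 := abs_le.1 ((norm_fst_le x).trans hx.le)
    have hx2 := abs_le.1 ((norm_snd_le x).trans hx.le)
    rw [Prod.norm_def] at hx
    have hh : ∀ y, x.2 = y → x ∈ cl ((-(2 * K), y), (2 * K, y)) := by
      intro y hy
      refine ⟨(x.1 + 2 * K) / (4 * K), ⟨by apply div_nonneg <;> linarith,
        by rw [div_le_one] <;> linarith⟩, ?_⟩
      ext
      · rw [pt_fst]; simp only; field_simp; ring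
      · rw [pt_snd]; simp [hy]
    have hv : ∀ z, x.1 = z → x ∈ cl ((z, -K), (z, K)) := by
      intro y hy
      refine ⟨(x.2 + K) / (2 * K), ⟨by apply div_nonneg <;> linarith,
        by rw [div_le_one] <;> linarith⟩, ?_⟩
      ext
      · rw [pt_fst]; simp [hy]
      · rw [pt_snd]; simp only; field_simp; ring
    rw [mem_wallSet]
    rcases max_choice ‖x.1‖ ‖x.2‖ with h | h <;> rw [h, Real.norm_eq_abs] at hx
    · rcases eq_or_eq_neg_of_abs_eq hx with h | h
      · exact ⟨V2, by simp, hv _ h⟩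
      · exact ⟨V1, by simp, hv _ h⟩
    · rcases eq_or_eq_neg_of_abs_eq hx with h | h
      · exact ⟨H2, by simp, hh _ h⟩
      · exact ⟨H1, by simp, hh _ h⟩

end

/-- Both endpoints of `κ` lie on the line of `L`. -/
def OnLine (L κ : Pt × Pt) : Prop := side L κ.1 = 0 ∧ side L κ.2 = 0

/-- A wall system made of a frame, the edges in `T`, and walls on the line of `L`. -/
structure EdgeSys (K : ℝ) (P : Finset Pt) (L : Pt × Pt) (T W : Finset (Pt × Pt)) (φ : Pt × Pt → ℤ)
    (Mis : Finset (Pt × Pt)) : Prop extends Sys K P L W φ Mis where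
  cover : ∀ x : Pt, ‖x‖ < K → side L x = 0 → x ∈ wallSet W
  frame : ∀ x : Pt, ‖x‖ = K → ∃ κ ∈ W, x ∈ cl κ ∧ ¬ OnLine L κ
  edge : ∀ e ∈ T, e ∈ W ∧ e.swap ∈ W ∧ φ e = 1 ∧ φ e.swap = -1
  kind : ∀ κ ∈ W, (∀ x ∈ cl κ, K ≤ ‖x‖) ∨ κ ∈ T ∨ κ.swap ∈ T ∨
    OnLine L κ ∧ ∀ κ' ∈ W, κ'.2 ∉ rel κ

lemma side_of_mem_cl_onLine {L κ : Pt × Pt} (h : OnLine L κ) {x : Pt} (hx : x ∈ cl κ) :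
    side L x = 0 := by
  obtain ⟨t, -, rfl⟩ := hx
  rw [side_pt, h.1, h.2]; ring

lemma side_before (N L : Pt × Pt) (s t : ℝ) (h : side N (pt L s) = 0) :
    side N (pt L t) = (s - t) * (side L N.2 - side L N.1) := by
  rw [side_eq, pt_fst, pt_snd] at h
  simp only [side_eq, pt_fst, pt_snd]
  linear_combination h

lemma norm_pt_lt {K : ℝ} {κ : Pt × Pt} {s t u : ℝ} (hs : ‖pt κ s‖ < K) (hu : ‖pt κ u‖ < K)
    (h1 : s ≤ t) (h2 : t ≤ u) : ‖pt κ t‖ < K := by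
  rcases (h1.trans h2).eq_or_lt with h | h
  · have : t = s := by linarith
    rwa [this]
  · exact norm_lt_of_mem_cl (κ := (pt κ s, pt κ u)) hs hu (by rw [cl_pt κ h]; exact ⟨t, ⟨h1, h2⟩, rfl⟩)

lemma subset_wallSet {W : Finset (Pt × Pt)} {κ : Pt × Pt} (h : κ ∈ W) {x : Pt} (hx : x ∈ cl κ) :
    x ∈ wallSet W := mem_wallSet.2 ⟨κ, h, hx⟩

section

variable {K : ℝ} {P : Finset Pt} {L : Pt × Pt} {W Mis T : Finset (Pt × Pt)} {φ : Pt × Pt → ℤ}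

/-- The frame together with a chord on the line of `L`. -/
lemma exists_edgeSys_empty (hK : 0 < K) (hPK : ∀ v ∈ P, ‖v‖ < K) (hP : ∀ v ∈ P, side L v ≠ 0)
    (hL : L.1 ≠ L.2) {t0 : ℝ} (ht0 : ‖pt L t0‖ < K) {c : ℤ} (hc : c = 1 ∨ c = -1) :
    ∃ W φ, EdgeSys K P L ∅ W φ ∅ ∧ ∃ s t, (∀ u, ‖pt L u‖ < K → s < u ∧ u < t) ∧
      (pt L s, pt L t) ∈ W ∧ φ (pt L s, pt L t) = c ∧ (∀ κ ∈ W, κ.2 ∉ rel (pt L s, pt L t)) := by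
  obtain ⟨W, φ, S, hφ, hfar, hside, hsph⟩ := exists_frame hK hPK L hc
  have hsph' : ∀ x : Pt, ‖x‖ = K → x ∈ wallSet W := hsph
  have hin : ∀ x : Pt, ‖x‖ < K → x ∉ wallSet W := by
    intro x hx hxW
    obtain ⟨κ, hκ, h⟩ := mem_wallSet.1 hxW
    exact hx.not_ge (hfar κ hκ x h)
  have hout : ∀ x ∈ wallSet W, ¬ ‖x‖ < K := fun x hx h => hin x h hx
  have hev : ∀ κ : Pt × Pt, ∀ s, ‖pt κ s‖ < K → ∀ᶠ t in 𝓝[>] s, pt κ t ∉ wallSet W := by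
    intro κ s hs
    have : ∀ᶠ t in 𝓝 s, ‖pt κ t‖ < K :=
      (continuous_pt κ).norm.continuousAt.eventually_lt continuousAt_const hs
    exact (this.filter_mono nhdsWithin_le_nhds).mono fun t => hin _
  obtain ⟨t1, ht1, h1C, h1f, h1K⟩ :=
    exists_first_hit (isClosed_wallSet W) hsph' hL ht0 (hev L t0 ht0)
  have hsw : ∀ t, pt L.swap t = pt L (1 - t) := pt_swap L
  have ht0' : ‖pt L.swap (1 - t0)‖ < K := by rw [hsw]; simpa using ht0
  obtain ⟨t2, ht2, h2C, h2f, h2K⟩ :=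
    exists_first_hit (isClosed_wallSet W) hsph' (κ := L.swap) hL.symm ht0' (hev _ _ ht0')
  rw [hsw] at h2C h2K
  set s := 1 - t2 with hs
  have hst0 : s < t0 := by linarith
  have hst : s < t1 := hst0.trans ht1
  have hfr : ∀ u ∈ Set.Ioo s t1, pt L u ∉ wallSet W := by
    intro u hu
    rcases lt_trichotomy u t0 with h | h | h
    · have := h2f (1 - u) ⟨by linarith, by linarith [hu.1]⟩
      rwa [hsw, sub_sub_cancel] at this
    · rw [h]; exact hin _ ht0
    · exact h1f u ⟨h, hu.2⟩
  have hsL : ∀ u, side L (pt L u) = 0 := side_pt_self L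
  have hnP : ∀ u, pt L u ∉ P := fun u h => hP _ h (hsL u)
  let N : Pt × Pt := (pt L s, pt L t1)
  have hNne : N.1 ≠ N.2 := fun h => hst.ne (pt_injective hL h)
  have hNr : rel N = pt L '' Set.Ioo s t1 := rel_pt L hst
  have hfree : ∀ κ ∈ W, Disjoint (rel N) (cl κ) := by
    intro κ hκ
    rw [hNr]
    refine Set.disjoint_left.2 ?_
    rintro _ ⟨u, hu, rfl⟩ hx
    exact hfr u hu (subset_wallSet hκ hx)
  have host : ∀ N' : Pt × Pt, rel N' = rel N → N'.2 ∈ wallSet W → N'.2 ∉ P → ‖N'.2‖ ≤ K →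
      ∃ δ ∈ W, Hosts δ N' := by
    intro N' hr hC hP' hK'
    obtain ⟨δ, hδ, hz⟩ := S.exists_mem_rel hC hP' hK'
    obtain ⟨δ', h, hh⟩ := exists_hosts (S.ne δ hδ) hz
      (by rw [hr]; exact (hfree δ hδ).mono_right (rel_subset_cl δ))
    refine ⟨δ', ?_, hh⟩
    rcases h with rfl | rfl
    · exact hδ
    · exact S.symm δ hδ
  have htip : ∀ v ∈ P, v ∉ rel N := by
    intro v hv h
    rw [hNr] at h
    obtain ⟨u, -, rfl⟩ := h
    exact hnP u hv
  obtain ⟨φ', S', hφ'⟩ := S.attach_const hφ hc hNne hfree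
    (Or.inr (host N rfl h1C (hnP _) h1K))
    (Or.inr (host N.swap (rel_swap N) h2C (hnP _) h2K)) htip
  have hchord : ∀ u, ‖pt L u‖ < K → s < u ∧ u < t1 := by
    intro u hu
    constructor
    · by_contra hc'
      exact hout _ h2C (norm_pt_lt hu ht0 (not_lt.1 hc') hst0.le)
    · by_contra hc'
      exact hout _ h1C (norm_pt_lt ht0 hu ht1.le (not_lt.1 hc'))
  have hheads : ∀ κ ∈ insert N (insert N.swap W), κ.2 ∉ rel N := by
    intro κ hκ hx
    simp only [mem_insert] at hκ
    rcases hκ with rfl | rfl | hκ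
    · exact snd_notMem_rel hNne hx
    · exact fst_notMem_rel hNne hx
    · exact Set.disjoint_left.1 (hfree κ hκ) hx (snd_mem_cl κ)
  refine ⟨_, φ', { toSys := S', cover := ?_, frame := ?_, edge := by simp, kind := ?_ }, s, t1,
    hchord, mem_insert_self _ _, hφ' _ (mem_insert_self _ _), hheads⟩
  · intro x hx hxL
    obtain ⟨u, rfl⟩ := exists_pt_of_side_eq_zero hL hxL
    refine subset_wallSet (κ := N) (mem_insert_self _ _) (rel_subset_cl N ?_)
    rw [hNr]
    exact ⟨u, hchord u hx, rfl⟩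
  · intro x hx
    obtain ⟨κ, hκ, h⟩ := mem_wallSet.1 (hsph x hx)
    refine ⟨κ, by simp [hκ], h, fun hc' => ?_⟩
    exact hside κ hκ _ ht0 (side_eq_zero_of_line hL hc'.1 hc'.2 (hsL t0))
  · intro κ hκ
    simp only [mem_insert] at hκ
    rcases hκ with rfl | rfl | hκ
    · exact Or.inr (Or.inr (Or.inr ⟨⟨hsL _, hsL _⟩, hheads⟩))
    · exact Or.inr (Or.inr (Or.inr ⟨⟨hsL _, hsL _⟩, by rw [rel_swap]; exact hheads⟩))
    · exact Or.inl (hfar κ hκ)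

lemma EdgeSys.disjoint_edge (I : EdgeSys K P L T W φ Mis) {e : Pt × Pt}
    (heT : ∀ e' ∈ T, Disjoint (cl e) (cl e')) (h1 : ‖e.1‖ < K) (h2 : ‖e.2‖ < K) {κ : Pt × Pt}
    (hκ : κ ∈ W) (hL : ¬ OnLine L κ) : Disjoint (cl e) (cl κ) := by
  rcases I.kind κ hκ with h | h | h | h
  · exact Set.disjoint_left.2 fun x hx hx' => (norm_lt_of_mem_cl h1 h2 hx).not_ge (h x hx')
  · exact heT κ h
  · rw [← cl_swap κ]; exact heT _ h
  · exact absurd h.1 hL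

lemma onLine_swap {κ : Pt × Pt} : OnLine L κ.swap ↔ OnLine L κ := And.comm

lemma EdgeSys.attach_edge (I : EdgeSys K P L T W φ Mis) {e : Pt × Pt} (hne : e.1 ≠ e.2)
    (heT : ∀ e' ∈ T, Disjoint (cl e) (cl e')) (hPK : ∀ v ∈ P, ‖v‖ < K) (h1 : e.1 ∈ P)
    (h2 : e.2 ∈ P) (htip : ∀ v ∈ P, v ∉ rel e) (hs : 0 < side L e.1 * side L e.2) :
    ∃ W' φ', EdgeSys K P L (insert e T) W' φ' Mis := by
  have hcl : ∀ x ∈ cl e, side L x ≠ 0 := by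
    rintro x ⟨t, ht, rfl⟩ h
    rw [side_pt] at h
    have e1 := sub_nonneg.2 ht.2
    have e2 := ht.1
    rcases pos_and_pos_or_neg_and_neg_of_mul_pos hs with ⟨p, q⟩ | ⟨p, q⟩ <;>
      rcases e2.eq_or_lt with h0 | h0 <;> nlinarith
  have hfree : ∀ κ ∈ W, Disjoint (rel e) (cl κ) := by
    intro κ hκ
    by_cases hκL : OnLine L κ
    · exact Set.disjoint_left.2 fun x hx hx' =>
        hcl x (rel_subset_cl e hx) (side_of_mem_cl_onLine hκL hx')
    · exact (I.disjoint_edge heT (hPK _ h1) (hPK _ h2) hκ hκL).mono_left (rel_subset_cl e)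
  have S' := I.toSys.attach hne 1 (-1) False hfree (Or.inl rfl) (Or.inr rfl)
    (fun h => absurd h (by tauto)) (Or.inl h2) (Or.inl h1) htip (fun h => h.elim)
    (fun μ hμ => ⟨I.tip μ (I.mis_sub hμ) _ h1, I.tip μ (I.mis_sub hμ) _ h2⟩)
  rw [if_neg not_false] at S'
  have hN1 := notMem_of_disjoint hfree
  have hN2 := swap_notMem_of_disjoint hfree
  have hφ : ∀ κ ∈ W, setSign φ e 1 (-1) κ = φ κ := fun κ hκ =>
    setSign_of_ne φ 1 (-1) (fun h => hN1 (h ▸ hκ)) (fun h => hN2 (h ▸ hκ))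
  refine ⟨_, _, { toSys := S', cover := ?_, frame := ?_, edge := ?_, kind := ?_ }⟩
  · intro x hx hxL
    obtain ⟨κ, hκ, h⟩ := mem_wallSet.1 (I.cover x hx hxL)
    exact mem_wallSet.2 ⟨κ, by simp [hκ], h⟩
  · intro x hx
    obtain ⟨κ, hκ, h⟩ := I.frame x hx
    exact ⟨κ, by simp [hκ], h⟩
  · intro e' he'
    rcases mem_insert.1 he' with rfl | he'
    · exact ⟨by simp, by simp, setSign_self _ _ _ _, setSign_swap _ hne _ _⟩
    · obtain ⟨a, b, c, d⟩ := I.edge e' he'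
      exact ⟨by simp [a], by simp [b], by rw [hφ _ a, c], by rw [hφ _ b, d]⟩
  · intro κ hκ
    simp only [mem_insert] at hκ ⊢
    rcases hκ with rfl | rfl | hκ
    · simp
    · simp
    · rcases I.kind κ hκ with h | h | h | ⟨h, h'⟩
      · exact Or.inl h
      · simp [h]
      · simp [h]
      · refine Or.inr (Or.inr (Or.inr ⟨h, ?_⟩))
        rintro κ' (rfl | rfl | hκ')
        · exact I.tip κ hκ _ h2
        · exact I.tip κ hκ _ h1
        · exact h' κ' hκ'

end

section

variable {K : ℝ} {P : Finset Pt} {L : Pt × Pt} {W Mis T : Finset (Pt × Pt)} {φ : Pt × Pt → ℤ}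

set_option maxHeartbeats 1000000 in
lemma EdgeSys.cross_edge (I : EdgeSys K P L T W φ Mis) (hP : ∀ v ∈ P, side L v ≠ 0)
    {e : Pt × Pt} (hne : e.1 ≠ e.2) (heT : ∀ e' ∈ T, Disjoint (cl e) (cl e'))
    (hPK : ∀ v ∈ P, ‖v‖ < K) (h1 : e.1 ∈ P) (h2 : e.2 ∈ P) (htip : ∀ v ∈ P, v ∉ rel e)
    {μ : Pt × Pt} (hμ : μ ∈ W) (hμL : OnLine L μ) (hμfree : ∀ κ ∈ W, κ.2 ∉ rel μ)
    (hμs : μ.swap ∉ Mis) {x : Pt} (hxμ : x ∈ rel μ) (hxe : x ∈ rel e) {N : Pt × Pt} {α : ℤ}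
    (hN : N = e ∧ α = 1 ∨ N = e.swap ∧ α = -1) (hA : 0 < side N μ.1) :
    ∃ W' φ' Mis', EdgeSys K P L (insert e T) W' φ' Mis' ∧ (x, μ.2) ∈ W' ∧
      φ' (x, μ.2) = -α ∧ (∀ κ ∈ W', κ.2 ∉ rel (x, μ.2)) ∧
      (Mis'.card = (Mis.erase μ).card + (if α ≠ φ μ then 1 else 0) +
        (if -α ≠ (if μ ∈ Mis then - φ μ else φ μ) then 1 else 0)) ∧
      ((x, μ.2) ∈ Mis' ↔ -α ≠ (if μ ∈ Mis then - φ μ else φ μ)) := by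
  have hxL : side L x = 0 := side_of_mem_cl_onLine hμL (rel_subset_cl μ hxμ)
  have hNP : N.1 ∈ P ∧ N.2 ∈ P := by
    rcases hN with ⟨rfl, -⟩ | ⟨rfl, -⟩
    · exact ⟨h1, h2⟩
    · exact ⟨h2, h1⟩
  have hNne : N.1 ≠ N.2 := by
    rcases hN with ⟨rfl, -⟩ | ⟨rfl, -⟩
    · exact hne
    · exact hne.symm
  have hrN : rel N = rel e := by
    rcases hN with ⟨rfl, -⟩ | ⟨rfl, -⟩
    · rfl
    · exact rel_swap e
  have hα : α = 1 ∨ α = -1 := by tauto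
  have hβ : -α = 1 ∨ -α = -1 := by rcases hα with h | h <;> rw [h] <;> simp
  have uniq : ∀ y ∈ rel e, side L y = 0 → y = x := by
    intro y hy hyL
    obtain ⟨s, -, rfl⟩ := hxe
    obtain ⟨t, -, rfl⟩ := hy
    rw [side_pt] at hyL hxL
    have h0 : side L e.1 ≠ 0 := hP _ h1
    have : side L e.1 * (t - s) = 0 := by linear_combination t * hxL - s * hyL
    rcases mul_eq_zero.1 this with h | h
    · exact absurd h h0
    · rw [sub_eq_zero.1 h]
  have hxκ : ∀ κ ∈ W, κ ≠ μ → κ ≠ μ.swap → x ∉ cl κ := by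
    intro κ hκ e1 e2 hx
    rcases mem_cl_cases hx with h | h | h
    · exact Set.disjoint_left.1 (I.disj κ hκ μ hμ e1 e2) h hxμ
    · exact hμfree _ (I.symm κ hκ) (by rw [h] at hxμ; exact hxμ)
    · exact hμfree κ hκ (h ▸ hxμ)
  have hfree : ∀ κ ∈ W, κ ≠ μ → κ ≠ μ.swap → Disjoint (rel N) (cl κ) := by
    intro κ hκ e1 e2
    rw [hrN]
    by_cases hκL : OnLine L κ
    · refine Set.disjoint_left.2 fun y hy hy' => ?_
      rw [uniq y hy (side_of_mem_cl_onLine hκL hy')] at hy'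
      exact hxκ κ hκ e1 e2 hy'
    · exact (I.disjoint_edge heT (hPK _ h1) (hPK _ h2) hκ hκL).mono_left (rel_subset_cl e)
  have tipW : ∀ κ ∈ W, N.1 ∉ rel κ ∧ N.2 ∉ rel κ := fun κ hκ =>
    ⟨I.tip κ hκ _ hNP.1, I.tip κ hκ _ hNP.2⟩
  obtain ⟨W', φ', Mis', S', mem, hφ, hφN, hφN', -, hφB, hcard, hmis⟩ :=
    I.toSys.cross hP hμ hμfree hμs hμL.1 hμL.2 hNne hxμ (hrN ▸ hxe) hA α (-α) hfree hα hβ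
      (fun h => absurd h (by tauto)) (Or.inl hNP.2) (Or.inl hNP.1)
      (fun v hv => hrN ▸ htip v hv) (fun ν hν _ => tipW ν (I.mis_sub hν))
  have hμne := I.ne μ hμ
  have heads : ∀ κ ∈ W', κ.2 = x ∨ κ.2 = μ.1 ∨ κ.2 = μ.2 ∨ κ.2 = N.1 ∨ κ.2 = N.2 ∨ κ ∈ W := by
    intro κ hκ
    rcases (mem κ).1 hκ with rfl | rfl | rfl | rfl | rfl | rfl | ⟨h, -⟩
    · simp
    · simp
    · simp
    · simp
    · simp
    · simp
    · exact Or.inr (Or.inr (Or.inr (Or.inr (Or.inr h))))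
  have freeW : ∀ κ ∈ W, (∀ κ' ∈ W, κ'.2 ∉ rel κ) → x ∉ rel κ → ∀ κ' ∈ W', κ'.2 ∉ rel κ := by
    intro κ hκ hf hx κ' hκ'
    rcases heads κ' hκ' with h | h | h | h | h | h
    · rwa [h]
    · rw [h]; exact hf _ (I.symm μ hμ)
    · rw [h]; exact hf _ hμ
    · rw [h]; exact (tipW κ hκ).1
    · rw [h]; exact (tipW κ hκ).2
    · exact hf κ' h
  have freeA : ∀ κ ∈ W', κ.2 ∉ rel (μ.1, x) := by
    intro κ hκ hc
    have hc' := rel_fst_subset hxμ hc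
    rcases heads κ hκ with h | h | h | h | h | h
    · rw [h] at hc
      exact snd_notMem_rel (κ := (μ.1, x)) (fun h => fst_notMem_rel hμne (by rw [show μ.1 = x from h]; exact hxμ)) hc
    · rw [h] at hc'; exact hμfree _ (I.symm μ hμ) hc'
    · rw [h] at hc'; exact hμfree _ hμ hc'
    · rw [h] at hc'; exact (tipW μ hμ).1 hc'
    · rw [h] at hc'; exact (tipW μ hμ).2 hc'
    · exact hμfree κ h hc'
  have freeB : ∀ κ ∈ W', κ.2 ∉ rel (x, μ.2) := by
    intro κ hκ hc
    have hc' := rel_snd_subset hxμ hc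
    rcases heads κ hκ with h | h | h | h | h | h
    · rw [h] at hc
      exact fst_notMem_rel (κ := (x, μ.2)) (fun h => snd_notMem_rel hμne (by rw [← show x = μ.2 from h]; exact hxμ)) hc
    · rw [h] at hc'; exact hμfree _ (I.symm μ hμ) hc'
    · rw [h] at hc'; exact hμfree _ hμ hc'
    · rw [h] at hc'; exact (tipW μ hμ).1 hc'
    · rw [h] at hc'; exact (tipW μ hμ).2 hc'
    · exact hμfree κ h hc'
  have keep : ∀ κ ∈ W, ¬ OnLine L κ → κ ∈ W' ∧ φ' κ = φ κ := by
    intro κ hκ hκL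
    have e1 : κ ≠ μ := fun h => hκL (h ▸ hμL)
    have e2 : κ ≠ μ.swap := fun h => hκL (h ▸ onLine_swap.2 hμL)
    exact ⟨(mem κ).2 (by tauto), hφ κ hκ e1 e2⟩
  have hBW : (x, μ.2) ∈ W' := (mem _).2 (Or.inl rfl)
  refine ⟨W', φ', Mis', { toSys := S', cover := ?_, frame := ?_, edge := ?_, kind := ?_ }, hBW, hφB,
    freeB, hcard, hmis⟩
  · intro y hy hyL
    obtain ⟨κ, hκ, h⟩ := mem_wallSet.1 (I.cover y hy hyL)
    have hyμ : y ∈ cl μ → y ∈ wallSet W' := by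
      rintro ⟨t, ht, rfl⟩
      obtain ⟨s, hs, rfl⟩ := hxμ
      rcases le_total t s with h | h
      · refine subset_wallSet (κ := (μ.1, pt μ s)) ((mem _).2 (by simp)) ?_
        have := cl_pt μ hs.1
        rw [pt_zero] at this
        rw [this]; exact ⟨t, ⟨ht.1, h⟩, rfl⟩
      · refine subset_wallSet (κ := (pt μ s, μ.2)) hBW ?_
        have := cl_pt μ hs.2
        rw [pt_one] at this
        rw [this]; exact ⟨t, ⟨h, ht.2⟩, rfl⟩
    by_cases e1 : κ = μ
    · exact hyμ (e1 ▸ h)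
    by_cases e2 : κ = μ.swap
    · rw [e2, cl_swap] at h; exact hyμ h
    · exact subset_wallSet ((mem κ).2 (by tauto)) h
  · intro y hy
    obtain ⟨κ, hκ, h, h'⟩ := I.frame y hy
    exact ⟨κ, (keep κ hκ h').1, h, h'⟩
  · intro e' he'
    have hNW : N ∈ W' := (mem N).2 (by simp)
    have hNW' : N.swap ∈ W' := (mem N.swap).2 (by simp)
    rcases mem_insert.1 he' with rfl | he'
    · rcases hN with ⟨rfl, rfl⟩ | ⟨rfl, rfl⟩
      · exact ⟨hNW, hNW', hφN, hφN'⟩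
      · rw [Prod.swap_swap] at hNW' hφN'
        exact ⟨hNW', hNW, by rw [hφN']; norm_num, hφN⟩
    · obtain ⟨a, b, c, d⟩ := I.edge e' he'
      have hnl : ¬ OnLine L e' := by
        intro hl
        have hf : φ e'.swap = φ e' := I.flat e' a (fun h => hP _ h hl.2)
        rw [c, d] at hf
        norm_num at hf
      obtain ⟨k1, k2⟩ := keep e' a hnl
      obtain ⟨k3, k4⟩ := keep e'.swap b (fun h => hnl (onLine_swap.1 h))
      exact ⟨k1, k3, by rw [k2, c], by rw [k4, d]⟩
  · intro κ hκ
    have on1 : OnLine L (μ.1, x) := ⟨hμL.1, hxL⟩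
    have on2 : OnLine L (x, μ.2) := ⟨hxL, hμL.2⟩
    have kN : e = N ∨ e = N.swap := by
      rcases hN with ⟨rfl, -⟩ | ⟨rfl, -⟩ <;> simp
    rcases (mem κ).1 hκ with rfl | rfl | rfl | rfl | rfl | rfl | ⟨h, e1, e2⟩
    · exact Or.inr (Or.inr (Or.inr ⟨on2, freeB⟩))
    · exact Or.inr (Or.inr (Or.inr ⟨onLine_swap.2 on2, by
        rw [show rel (μ.2, x) = rel (x, μ.2) from rel_swap (x, μ.2)]; exact freeB⟩))
    · exact Or.inr (Or.inr (Or.inr ⟨on1, freeA⟩))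
    · exact Or.inr (Or.inr (Or.inr ⟨onLine_swap.2 on1, by
        rw [show rel (x, μ.1) = rel (μ.1, x) from rel_swap (μ.1, x)]; exact freeA⟩))
    · rcases kN with h | h
      · simp [h]
      · simp [h]
    · rcases kN with h | h
      · simp [h]
      · simp [h]
    · rcases I.kind κ h with k | k | k | ⟨k, k'⟩
      · exact Or.inl k
      · simp [k]
      · simp [k]
      · exact Or.inr (Or.inr (Or.inr ⟨k, freeW κ h k' fun hx =>
          hxκ κ h e1 e2 (rel_subset_cl κ hx)⟩))

end

/-- A plane perfect matching `M` on points `P` in general position off the line of `L`. -/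
structure Setting (K : ℝ) (P : Finset Pt) (L : Pt × Pt) (M : Finset (Pt × Pt)) : Prop where
  pos : 0 < K
  bound : ∀ v ∈ P, ‖v‖ < K
  off : ∀ v ∈ P, side L v ≠ 0
  line : L.1 ≠ L.2
  gen : ∀ p ∈ P, ∀ q ∈ P, ∀ r ∈ P, p ≠ q → p ≠ r → q ≠ r → side (p, q) r ≠ 0
  ends : ∀ e ∈ M, e.1 ∈ P ∧ e.2 ∈ P ∧ e.1 ≠ e.2
  free : ∀ e ∈ M, ∀ e' ∈ M, e ≠ e' → Disjoint (cl e) (cl e')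
  cov : ∀ v ∈ P, ∃ e ∈ M, v = e.1 ∨ v = e.2

/-- The two endpoints of `e` are on different sides of the line of `L`. -/
def Cuts (L e : Pt × Pt) : Prop := side L e.1 * side L e.2 < 0

lemma Cuts.exists_mem_rel {L e : Pt × Pt} (h : Cuts L e) : ∃ x ∈ rel e, side L x = 0 := by
  have hd : side L e.1 - side L e.2 ≠ 0 := by
    intro hc
    have : side L e.1 = side L e.2 := by linarith
    unfold Cuts at h
    rw [this] at h
    nlinarith [mul_self_nonneg (side L e.2)]
  refine ⟨pt e (side L e.1 / (side L e.1 - side L e.2)), ⟨_, ?_, rfl⟩, ?_⟩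
  · rcases mul_neg_iff.1 h with ⟨a, b⟩ | ⟨a, b⟩
    · exact ⟨div_pos a (by linarith), by rw [div_lt_one] <;> linarith⟩
    · exact ⟨div_pos_of_neg_of_neg a (by linarith), by rw [div_lt_one_of_neg] <;> linarith⟩
  · rw [side_pt]; field_simp; ring

/-- A line through a point off the line of `L` does not contain an end of a dart on the line of
`L` if it meets its interior. -/
lemma side_fst_ne_of_cross {L e μ : Pt × Pt} {x : Pt} (ene : e.1 ≠ e.2) (hL : L.1 ≠ L.2)
    (hμ : μ.1 ≠ μ.2) (he : side L e.1 ≠ 0) (hx : side e x = 0) (hxμ : x ∈ rel μ)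
    (hμL : OnLine L μ) : side e μ.1 ≠ 0 := by
  intro h
  obtain ⟨s, hs⟩ := exists_pt_of_side_eq_zero ene h
  obtain ⟨t, ht⟩ := exists_pt_of_side_eq_zero ene hx
  have hst : s ≠ t := by
    rintro rfl
    exact fst_notMem_rel hμ (by rw [hs, ← ht]; exact hxμ)
  have h3 : side μ e.1 = 0 := by
    have h4 := side_of_mem_rel hxμ
    rw [ht, side_pt] at h4
    have h5 := side_fst μ
    rw [hs, side_pt] at h5
    have h6 : (s - t) * side μ e.1 = 0 := by linear_combination s * h4 - t * h5
    exact (mul_eq_zero.1 h6).resolve_left (sub_ne_zero.2 hst)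
  obtain ⟨c, hc0, hcs⟩ := exists_side_eq_mul hL hμ hμL.1 hμL.2
  rw [hcs] at h3
  exact he ((mul_eq_zero.1 h3).resolve_left hc0)

section

variable {K : ℝ} {P : Finset Pt} {L : Pt × Pt} {W Mis T M : Finset (Pt × Pt)} {φ : Pt × Pt → ℤ}

lemma Setting.tip (hS : Setting K P L M) {e : Pt × Pt} (he : e ∈ M) : ∀ v ∈ P, v ∉ rel e := by
  intro v hv hx
  obtain ⟨h1, h2, hne⟩ := hS.ends e he
  refine hS.gen _ h1 _ h2 v hv hne ?_ ?_ (side_of_mem_rel hx)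
  · rintro rfl; exact fst_notMem_rel hne hx
  · rintro rfl; exact snd_notMem_rel hne hx

lemma Setting.free_insert (hS : Setting K P L M) {e : Pt × Pt} (he : e ∈ M) (hT : T ⊆ M)
    (heT : e ∉ T) : ∀ e' ∈ T, Disjoint (cl e) (cl e') := fun e' he' =>
  hS.free e he e' (hT he') (fun h => heT (h ▸ he'))

/-- The dart of `e` pointing to the left side of `L`, with its sign. -/
lemma exists_dart {e : Pt × Pt} (h : Cuts L e) : ∃ N : Pt × Pt, ∃ α : ℤ,
    (N = e ∧ α = 1 ∨ N = e.swap ∧ α = -1) ∧ side L N.1 < 0 ∧ 0 < side L N.2 ∧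
      (α = 1 ↔ side L e.1 < 0) := by
  rcases mul_neg_iff.1 h with ⟨a, b⟩ | ⟨a, b⟩
  · exact ⟨e.swap, -1, Or.inr ⟨rfl, rfl⟩, b, a, by simp [a.le]⟩
  · exact ⟨e, 1, Or.inl ⟨rfl, rfl⟩, a, b, by simp [a]⟩

lemma Setting.exists_pair (hS : Setting K P L M) {e f : Pt × Pt} (he : e ∈ M) (hf : f ∈ M)
    (hce : Cuts L e) (hcf : Cuts L f) (hop : side L e.1 * side L f.1 < 0) {a b : ℝ}
    (ha : pt L a ∈ rel e) (hb : pt L b ∈ rel f) (hab : a < b) :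
    ∃ W φ, EdgeSys K P L {f, e} W φ ∅ := by
  obtain ⟨e1, e2, ene⟩ := hS.ends e he
  obtain ⟨f1, f2, fne⟩ := hS.ends f hf
  have hef : f ≠ e := by
    rintro rfl; nlinarith [mul_self_nonneg (side L f.1)]
  have haK := norm_lt_of_mem_cl (hS.bound _ e1) (hS.bound _ e2) (rel_subset_cl e ha)
  have hbK := norm_lt_of_mem_cl (hS.bound _ f1) (hS.bound _ f2) (rel_subset_cl f hb)
  obtain ⟨N, α, hN, hN1, hN2, hNα⟩ := exists_dart hce
  obtain ⟨N', α', hN', hN1', hN2', hNα'⟩ := exists_dart hcf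
  have hα : α = 1 ∨ α = -1 := by tauto
  have hαα : α' = -α := by
    have hα' : α' = 1 ∨ α' = -1 := by tauto
    rcases mul_neg_iff.1 hop with ⟨p, q⟩ | ⟨p, q⟩
    · have h1 : α ≠ 1 := fun h => by linarith [hNα.1 h]
      have h2 : α' = 1 := hNα'.2 q
      rw [h2, hα.resolve_left h1]; norm_num
    · have h1 : α' ≠ 1 := fun h => by linarith [hNα'.1 h]
      have h2 : α = 1 := hNα.2 p
      rw [h2, hα'.resolve_left h1]
  have hrN : rel N = rel e := by
    rcases hN with ⟨rfl, -⟩ | ⟨rfl, -⟩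
    · rfl
    · exact rel_swap e
  have hrN' : rel N' = rel f := by
    rcases hN' with ⟨rfl, -⟩ | ⟨rfl, -⟩
    · rfl
    · exact rel_swap f
  obtain ⟨W, φ, I, s, t, hst, hμ, hφμ, hfree⟩ :=
    exists_edgeSys_empty hS.pos hS.bound hS.off hS.line haK hα
  have hsL : ∀ u, side L (pt L u) = 0 := side_pt_self L
  obtain ⟨hsa, hat⟩ := hst a haK
  obtain ⟨hsb, hbt⟩ := hst b hbK
  have hA : 0 < side N (pt L s) := by
    rw [side_before N L a s (side_of_mem_rel (hrN ▸ ha))]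
    exact mul_pos (by linarith) (by linarith)
  have hA' : 0 < side N' (pt L a) := by
    rw [side_before N' L b a (side_of_mem_rel (hrN' ▸ hb))]
    exact mul_pos (by linarith) (by linarith)
  obtain ⟨W1, φ1, Mis1, I1, hμ1, hφ1, hfree1, hcard1, hmis1⟩ :=
    I.cross_edge hS.off ene (by simp) hS.bound e1 e2 (hS.tip he) hμ ⟨hsL s, hsL t⟩ hfree
      (notMem_empty _) (by rw [rel_pt L (hsa.trans hat)]; exact ⟨a, ⟨hsa, hat⟩, rfl⟩) ha hN hA
  simp only [notMem_empty, if_false, hφμ] at hmis1 hcard1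
  have hneg : -α ≠ α := by rcases hα with h | h <;> rw [h] <;> norm_num
  have hmem : (pt L a, pt L t) ∈ Mis1 := hmis1.2 hneg
  rw [if_pos hneg, if_neg (by simp)] at hcard1
  have hfe : ∀ e' ∈ insert e (∅ : Finset (Pt × Pt)), Disjoint (cl f) (cl e') := by
    intro e' he'
    simp only [insert_empty_eq, mem_singleton] at he'
    rw [he']; exact hS.free f hf e he hef
  obtain ⟨W2, φ2, Mis2, I2, -, -, -, hcard2, -⟩ :=
    I1.cross_edge hS.off fne hfe hS.bound f1 f2 (hS.tip hf) hμ1 ⟨hsL a, hsL t⟩ hfree1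
      (I1.mis_swap _ hmem) (by rw [rel_pt L hat]; exact ⟨b, ⟨hab, hbt⟩, rfl⟩) hb hN' hA'
  have hM2 : Mis2 = ∅ := by
    rw [← card_eq_zero, hcard2, if_pos hmem, hφ1, hαα, card_erase_of_mem hmem, hcard1]
    simp
  subst hM2
  exact ⟨W2, φ2, I2⟩

lemma EdgeSys.exists_crossed_wall (I : EdgeSys K P L T W φ Mis) {e : Pt × Pt}
    (heT : ∀ e' ∈ T, Disjoint (cl e) (cl e')) {x : Pt} (hx : x ∈ cl e) (hxK : ‖x‖ < K)
    (hxL : side L x = 0) (hP : ∀ v ∈ P, side L v ≠ 0) :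
    ∃ μ ∈ W, OnLine L μ ∧ (∀ κ ∈ W, κ.2 ∉ rel μ) ∧ μ.swap ∉ Mis ∧ x ∈ rel μ := by
  have hno : ∀ κ ∈ W, x ∈ cl κ → OnLine L κ ∧ ∀ κ' ∈ W, κ'.2 ∉ rel κ := by
    intro κ hκ h
    rcases I.kind κ hκ with k | k | k | k
    · exact absurd (k x h) (not_le.2 hxK)
    · exact absurd h (Set.disjoint_left.1 (heT κ k) hx)
    · exact absurd ((cl_swap κ).symm ▸ h) (Set.disjoint_left.1 (heT _ k) hx)
    · exact k
  obtain ⟨δ, hδ, hxδ⟩ := I.exists_mem_rel (I.cover x hxK hxL) (fun h => hP x h hxL) hxK.le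
  obtain ⟨h1, h2⟩ := hno δ hδ (rel_subset_cl δ hxδ)
  by_cases hm : δ.swap ∈ Mis
  · exact ⟨δ.swap, I.symm δ hδ, onLine_swap.2 h1, by rw [rel_swap]; exact h2,
      I.mis_swap _ hm, by rw [rel_swap]; exact hxδ⟩
  · exact ⟨δ, hδ, h1, h2, hm, hxδ⟩

lemma EdgeSys.insert_cut (I : EdgeSys K P L T W φ Mis) (hS : Setting K P L M) {e : Pt × Pt}
    (he : e ∈ M) (hT : T ⊆ M) (heT : e ∉ T) (hc : Cuts L e) :
    ∃ W' φ' Mis', EdgeSys K P L (insert e T) W' φ' Mis' ∧ Mis'.card ≤ Mis.card + 1 := by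
  obtain ⟨e1, e2, ene⟩ := hS.ends e he
  have hd := hS.free_insert he hT heT
  obtain ⟨x, hxe, hxL⟩ := hc.exists_mem_rel
  have hxK := norm_lt_of_mem_cl (hS.bound _ e1) (hS.bound _ e2) (rel_subset_cl e hxe)
  obtain ⟨μ, hμ, hμL, hfree, hms, hxμ⟩ :=
    I.exists_crossed_wall hd (rel_subset_cl e hxe) hxK hxL hS.off
  have hne : side e μ.1 ≠ 0 := side_fst_ne_of_cross ene hS.line (I.ne μ hμ) (hS.off _ e1)
    (side_of_mem_rel hxe) hxμ hμL
  have : ∃ N : Pt × Pt, ∃ α : ℤ, (N = e ∧ α = 1 ∨ N = e.swap ∧ α = -1) ∧ 0 < side N μ.1 := by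
    rcases lt_or_gt_of_ne hne with h | h
    · exact ⟨e.swap, -1, Or.inr ⟨rfl, rfl⟩, by rw [side_swap]; linarith⟩
    · exact ⟨e, 1, Or.inl ⟨rfl, rfl⟩, h⟩
  obtain ⟨N, α, hN, hA⟩ := this
  have hα : α = 1 ∨ α = -1 := by tauto
  obtain ⟨W', φ', Mis', I', -, -, -, hcard, -⟩ :=
    I.cross_edge hS.off ene hd hS.bound e1 e2 (hS.tip he) hμ hμL hfree hms hxμ hxe hN hA
  refine ⟨W', φ', Mis', I', ?_⟩
  by_cases hm : μ ∈ Mis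
  · have := card_erase_add_one hm
    rw [hcard]
    split_ifs <;> omega
  · rw [hcard, erase_eq_of_notMem hm, if_neg hm]
    rcases I.sign μ hμ with h | h <;> rcases hα with h' | h' <;> rw [h, h'] <;> simp

/-- Starting from two edges cut in opposite directions, all edges can be added with at most
`k - 2` sign mismatches, where `k` is the number of cut edges. -/
lemma Setting.exists_edgeSys (hS : Setting K P L M) {e f : Pt × Pt} (he : e ∈ M) (hf : f ∈ M)
    (hce : Cuts L e) (hcf : Cuts L f) (hop : side L e.1 * side L f.1 < 0) :
    ∃ W φ Mis, EdgeSys K P L M W φ Mis ∧ Mis.card + 2 ≤ (M.filter (Cuts L)).card := by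
  have hef : f ≠ e := by
    rintro rfl; nlinarith [mul_self_nonneg (side L f.1)]
  have start : ∃ W φ, EdgeSys K P L {f, e} W φ ∅ := by
    obtain ⟨x, hx, hxL⟩ := hce.exists_mem_rel
    obtain ⟨y, hy, hyL⟩ := hcf.exists_mem_rel
    obtain ⟨a, rfl⟩ := exists_pt_of_side_eq_zero hS.line hxL
    obtain ⟨b, rfl⟩ := exists_pt_of_side_eq_zero hS.line hyL
    rcases lt_trichotomy a b with h | h | h
    · exact hS.exists_pair he hf hce hcf hop hx hy h
    · rw [h] at hx
      exact absurd (rel_subset_cl f hy)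
        (Set.disjoint_left.1 (hS.free e he f hf hef.symm) (rel_subset_cl e hx))
    · rw [pair_comm]
      exact hS.exists_pair hf he hcf hce (by rwa [mul_comm]) hy hx h
  have key : ∀ U : Finset (Pt × Pt), U ⊆ M → Disjoint U {f, e} → ∃ W φ Mis,
      EdgeSys K P L (U ∪ {f, e}) W φ Mis ∧ Mis.card + 2 ≤ ((U ∪ {f, e}).filter (Cuts L)).card := by
    intro U
    induction U using Finset.induction_on with
    | empty =>
      intro _ _
      obtain ⟨W, φ, I⟩ := start
      refine ⟨W, φ, ∅, by simpa using I, ?_⟩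
      have : (∅ ∪ {f, e} : Finset (Pt × Pt)).filter (Cuts L) = {f, e} := by
        rw [empty_union, filter_true_of_mem]
        intro g hg
        simp only [mem_insert, mem_singleton] at hg
        rcases hg with rfl | rfl
        · exact hcf
        · exact hce
      rw [this, card_pair hef, card_empty]
    | insert g U hg ih =>
      intro hU hd
      rw [insert_subset_iff] at hU
      rw [disjoint_insert_left] at hd
      obtain ⟨W, φ, Mis, I, hcard⟩ := ih hU.2 hd.2
      have hsub : U ∪ {f, e} ⊆ M := union_subset hU.2 (by
        intro g hg
        simp only [mem_insert, mem_singleton] at hg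
        rcases hg with rfl | rfl
        · exact hf
        · exact he)
      have hgn : g ∉ U ∪ {f, e} := by simp only [mem_union]; tauto
      rw [insert_union]
      by_cases hgc : Cuts L g
      · obtain ⟨W', φ', Mis', I', hle⟩ := I.insert_cut hS hU.1 hsub hgn hgc
        refine ⟨W', φ', Mis', I', ?_⟩
        rw [filter_insert, if_pos hgc, card_insert_of_notMem (by simp only [mem_filter]; tauto)]
        omega
      · obtain ⟨g1, g2, gne⟩ := hS.ends g hU.1
        have hpos : 0 < side L g.1 * side L g.2 :=
          lt_of_le_of_ne (not_lt.1 hgc) (mul_ne_zero (hS.off _ g1) (hS.off _ g2)).symm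
        obtain ⟨W', φ', I'⟩ := I.attach_edge gne (hS.free_insert hU.1 hsub hgn) hS.bound g1 g2
          (hS.tip hU.1) hpos
        refine ⟨W', φ', Mis, I', ?_⟩
        rw [filter_insert, if_neg hgc]
        exact hcard
  have hpair : {f, e} ⊆ M := by
    intro g hg
    simp only [mem_insert, mem_singleton] at hg
    rcases hg with rfl | rfl
    · exact hf
    · exact he
  have := key (M \ {f, e}) sdiff_subset sdiff_disjoint
  rwa [sdiff_union_of_subset hpair] at this

end

/-- A wall system in which the edges of `M` have been prolonged beyond the points of `V`; the
prolongation at `v` ends at `z v`. -/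
structure RaySys (K : ℝ) (P : Finset Pt) (L : Pt × Pt) (M : Finset (Pt × Pt)) (V : Finset Pt)
    (z : Pt → Pt) (W : Finset (Pt × Pt)) (φ : Pt × Pt → ℤ) (Mis : Finset (Pt × Pt)) : Prop
    extends Sys K P L W φ Mis where
  cover : ∀ x : Pt, ‖x‖ < K → side L x = 0 → x ∈ wallSet W
  frame : ∀ x : Pt, ‖x‖ = K → ∃ κ ∈ W, x ∈ cl κ ∧ ¬ OnLine L κ
  edge : ∀ e ∈ M, e ∈ W ∧ e.swap ∈ W ∧ φ e = 1 ∧ φ e.swap = -1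
  tips : ∀ κ ∈ W, κ.2 ∈ P → κ ∈ M ∨ κ.swap ∈ M ∨ κ.2 ∈ V ∧ κ.1 = z κ.2
  ray : ∀ v ∈ V, (v, z v) ∈ W
  far_end : ∀ v ∈ V, z v ∉ P
  prolong : ∀ v ∈ V, ∀ κ : Pt × Pt, κ ∈ M ∨ κ.swap ∈ M → κ.2 = v → ∃ t > 1, z v = pt κ t

section

variable {K : ℝ} {P V : Finset Pt} {L : Pt × Pt} {W Mis M : Finset (Pt × Pt)} {φ : Pt × Pt → ℤ}
  {z : Pt → Pt}

lemma EdgeSys.raySys (I : EdgeSys K P L M W φ Mis) (hS : Setting K P L M) :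
    RaySys K P L M ∅ z W φ Mis where
  toSys := I.toSys
  cover := I.cover
  frame := I.frame
  edge := I.edge
  tips := by
    intro κ hκ h
    rcases I.kind κ hκ with k | k | k | ⟨k, -⟩
    · exact absurd (k _ (snd_mem_cl κ)) (not_le.2 (hS.bound _ h))
    · exact Or.inl k
    · exact Or.inr (Or.inl k)
    · exact absurd k.2 (hS.off _ h)
  ray := by simp
  far_end := by simp
  prolong := by simp

lemma Sys.notMem_cl_of_mem_mis (S : Sys K P L W φ Mis) {μ κ : Pt × Pt} (hμ : μ ∈ Mis) (hκ : κ ∈ W)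
    (e1 : κ ≠ μ) (e2 : κ ≠ μ.swap) {x : Pt} (hxμ : x ∈ rel μ) : x ∉ cl κ := by
  intro hx
  rcases mem_cl_cases hx with h | h | h
  · exact Set.disjoint_left.1 (S.disj κ hκ μ (S.mis_sub hμ) e1 e2) h hxμ
  · exact S.mis_free μ hμ _ (S.symm κ hκ) (by rw [h] at hxμ; exact hxμ)
  · exact S.mis_free μ hμ κ hκ (h ▸ hxμ)

lemma RaySys.extend (I : RaySys K P L M V z W φ Mis) (hoff : ∀ v ∈ P, side L v ≠ 0)
    (hends : ∀ e ∈ M, e.1 ∈ P) (hVP : V ⊆ P) {W' Mis' : Finset (Pt × Pt)} {φ' : Pt × Pt → ℤ}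
    (S' : Sys K P L W' φ' Mis') (keep : ∀ κ ∈ W, ¬ OnLine L κ → κ ∈ W' ∧ φ' κ = φ κ)
    (hcov : wallSet W ⊆ wallSet W') {v y : Pt} (hv : v ∉ V)
    (heads : ∀ κ ∈ W', κ.2 ∈ P → κ ∈ W ∨ κ = (y, v)) (hvy : (v, y) ∈ W') (hy : y ∉ P)
    (hpro : ∀ κ : Pt × Pt, κ ∈ M ∨ κ.swap ∈ M → κ.2 = v → ∃ t > 1, y = pt κ t) :
    RaySys K P L M (insert v V) (Function.update z v y) W' φ' Mis' where
  toSys := S'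
  cover x hx hL := hcov (I.cover x hx hL)
  frame x hx := by
    obtain ⟨κ, hκ, h, h'⟩ := I.frame x hx
    exact ⟨κ, (keep κ hκ h').1, h, h'⟩
  edge e he := by
    obtain ⟨a, b, c, d⟩ := I.edge e he
    have hnl : ¬ OnLine L e := fun h => hoff _ (hends e he) h.1
    obtain ⟨k1, k2⟩ := keep e a hnl
    obtain ⟨k3, k4⟩ := keep e.swap b (fun h => hnl (onLine_swap.1 h))
    exact ⟨k1, k3, by rw [k2, c], by rw [k4, d]⟩
  tips κ hκ h := by
    rcases heads κ hκ h with h1 | rfl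
    · rcases I.tips κ h1 h with k | k | ⟨k, k'⟩
      · exact Or.inl k
      · exact Or.inr (Or.inl k)
      · refine Or.inr (Or.inr ⟨mem_insert_of_mem k, ?_⟩)
        rw [Function.update_of_ne (fun h' : κ.2 = v => hv (h' ▸ k)), k']
    · simp
  ray u hu := by
    rcases eq_or_ne u v with rfl | huv
    · simpa using hvy
    · have hu' := (mem_insert.1 hu).resolve_left huv
      rw [Function.update_of_ne huv]
      exact (keep _ (I.ray u hu') fun h => hoff _ (hVP hu') h.1).1
  far_end u hu := by
    rcases eq_or_ne u v with rfl | huv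
    · simpa using hy
    · rw [Function.update_of_ne huv]
      exact I.far_end u ((mem_insert.1 hu).resolve_left huv)
  prolong u hu := by
    rcases eq_or_ne u v with rfl | huv
    · simpa using hpro
    · rw [Function.update_of_ne huv]
      exact I.prolong u ((mem_insert.1 hu).resolve_left huv)

set_option maxHeartbeats 1000000 in
lemma RaySys.insert_ray (I : RaySys K P L M V z W φ Mis) (hS : Setting K P L M) (hVP : V ⊆ P)
    {v : Pt} (hvP : v ∈ P) (hv : v ∉ V) :
    ∃ z' W' φ' Mis', RaySys K P L M (insert v V) z' W' φ' Mis' ∧ Mis'.card = Mis.card := by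
  obtain ⟨κ, hκM, hκv⟩ : ∃ κ : Pt × Pt, (κ ∈ M ∨ κ.swap ∈ M) ∧ κ.2 = v := by
    obtain ⟨e, he, h | h⟩ := hS.cov v hvP
    · exact ⟨e.swap, Or.inr (by simpa using he), h.symm⟩
    · exact ⟨e, Or.inl he, h.symm⟩
  have hκ0 : κ ∈ W ∧ κ.1 ∈ P ∧ κ.1 ≠ κ.2 := by
    rcases hκM with h | h
    · exact ⟨(I.edge _ h).1, (hS.ends _ h).1, (hS.ends _ h).2.2⟩
    · exact ⟨by simpa using (I.edge _ h).2.1, (hS.ends _ h).2.1, (hS.ends _ h).2.2.symm⟩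
  obtain ⟨hκW, hκ1, hκne⟩ := hκ0
  have hinj := pt_injective hκne
  have huniq : ∀ κ' : Pt × Pt, κ' ∈ M ∨ κ'.swap ∈ M → v = κ'.1 ∨ v = κ'.2 → κ' = κ ∨ κ' = κ.swap := by
    intro κ' h' hv'
    have hcl : v ∈ cl κ' := by
      rcases hv' with h | h
      · rw [h]; exact fst_mem_cl κ'
      · rw [h]; exact snd_mem_cl κ'
    have hcl' : v ∈ cl κ := hκv ▸ snd_mem_cl κ
    by_contra hc
    push Not at hc
    have key : ∀ e e' : Pt × Pt, e ∈ M → e' ∈ M → v ∈ cl e → v ∈ cl e' → e = e' := by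
      intro e e' he he' h h'
      by_contra hne
      exact Set.disjoint_left.1 (hS.free e he e' he' hne) h h'
    rcases hκM with h | h <;> rcases h' with h' | h'
    · exact hc.1 (key _ _ h' h hcl hcl')
    · exact hc.2 (by rw [← key _ _ h' h (by rwa [cl_swap]) hcl', Prod.swap_swap])
    · exact hc.2 (key _ _ h' h hcl (by rwa [cl_swap]))
    · exact hc.1 (Prod.swap_injective (key _ _ h' h (by rwa [cl_swap]) (by rwa [cl_swap])))
  have hev : ∀ t0, 1 ≤ t0 → (∀ κ' ∈ W, pt κ t0 ∈ cl κ' → ∀ t > t0, pt κ t ∉ cl κ') →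
      ∀ᶠ t in 𝓝[>] t0, pt κ t ∉ wallSet W := by
    intro t0 _ h
    have : ∀ κ' ∈ W, ∀ᶠ t in 𝓝[>] t0, pt κ t ∉ cl κ' := by
      intro κ' hκ'
      by_cases hx : pt κ t0 ∈ cl κ'
      · exact eventually_mem_nhdsWithin.mono (h κ' hκ' hx)
      · exact ((continuous_pt κ).continuousAt.eventually
          ((isClosed_cl κ').isOpen_compl.mem_nhds hx)).filter_mono nhdsWithin_le_nhds
    refine ((Filter.eventually_all_finset W).2 this).mono fun t ht h => ?_
    obtain ⟨κ', hκ', h⟩ := mem_wallSet.1 h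
    exact ht κ' hκ' h
  have hsph : ∀ x : Pt, ‖x‖ = K → x ∈ wallSet W := fun x hx => by
    obtain ⟨κ', h1, h2, -⟩ := I.frame x hx
    exact subset_wallSet h1 h2
  have hv1 : pt κ 1 = v := by rw [pt_one, hκv]
  have hend : ∀ t, 1 < t → pt κ t ∉ P := by
    intro t ht hP
    have h0 : pt κ t ≠ κ.1 := fun h => by
      have := hinj (h.trans (pt_zero κ).symm); linarith
    have h1 : pt κ t ≠ κ.2 := fun h => by
      have := hinj (h.trans (pt_one κ).symm); linarith
    exact hS.gen _ hκ1 _ (hκv ▸ hvP) _ hP hκne h0.symm h1.symm (side_pt_self κ t)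
  obtain ⟨t1, ht1, h1C, h1f, h1K⟩ := exists_first_hit (isClosed_wallSet W) hsph hκne (t0 := 1)
    (by rw [hv1]; exact hS.bound v hvP) (hev 1 le_rfl (by
      intro κ' hκ' hx t ht ht'
      rw [hv1] at hx
      have hκκ : κ' = κ ∨ κ' = κ.swap := by
        rcases mem_cl_cases hx with h | h | h
        · exact absurd h (I.tip κ' hκ' v hvP)
        · rcases I.tips κ'.swap (I.symm _ hκ') (by rw [Prod.snd_swap, ← h]; exact hvP) with k | k | ⟨k, -⟩
          · exact huniq κ' (Or.inr k) (Or.inl h)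
          · exact huniq κ' (Or.inl (by simpa using k)) (Or.inl h)
          · rw [Prod.snd_swap, ← h] at k; exact absurd k hv
        · rcases I.tips κ' hκ' (by rw [← h]; exact hvP) with k | k | ⟨k, -⟩
          · exact huniq κ' (Or.inl k) (Or.inr h)
          · exact huniq κ' (Or.inr k) (Or.inr h)
          · rw [← h] at k; exact absurd k hv
      have : pt κ t ∈ cl κ := by
        rcases hκκ with rfl | rfl
        · exact ht'
        · rwa [cl_swap] at ht'
      obtain ⟨s, hs, h⟩ := this
      have := hinj h
      subst this
      linarith [hs.2]))
  have hpro : ∀ t, 1 < t → ∀ κ' : Pt × Pt, κ' ∈ M ∨ κ'.swap ∈ M → κ'.2 = v →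
      ∃ s > 1, pt κ t = pt κ' s := by
    intro t ht κ' h h'
    rcases huniq κ' h (Or.inr h'.symm) with rfl | rfl
    · exact ⟨t, ht, rfl⟩
    · exact absurd (h'.trans hκv.symm) hκne
  have hrel : ∀ t, 1 < t → rel (v, pt κ t) = pt κ '' Set.Ioo 1 t := by
    intro t ht
    have := rel_pt κ ht
    rwa [hv1] at this
  have hvne : ∀ t, 1 < t → v ≠ pt κ t := fun t ht h => by
    have := hinj (hv1.trans h); linarith
  have htip : ∀ t, 1 < t → ∀ u ∈ P, u ∉ rel (v, pt κ t) := by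
    intro t ht u hu h
    rw [hrel t ht] at h
    obtain ⟨s, hs, rfl⟩ := h
    exact hend s hs.1 hu
  have hends : ∀ e ∈ M, e.1 ∈ P := fun e he => (hS.ends e he).1
  have hvoff : side L v ≠ 0 := hS.off v hvP
  have hvoff' : side L κ.2 ≠ 0 := hκv ▸ hvoff
  obtain ⟨δ, hδ, hzδ⟩ := I.exists_mem_rel h1C (hend t1 ht1) h1K
  by_cases hmis : ∀ μ ∈ Mis, pt κ t1 ∉ rel μ
  · have hfree : ∀ κ' ∈ W, Disjoint (rel (v, pt κ t1)) (cl κ') := by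
      intro κ' hκ'
      rw [hrel t1 ht1, Set.disjoint_left]
      rintro _ ⟨t, ht, rfl⟩ h
      exact h1f t ht (subset_wallSet hκ' h)
    obtain ⟨δ', hδ', hh⟩ := exists_hosts (N := (v, pt κ t1)) (I.ne δ hδ) hzδ
      ((hfree δ hδ).mono_right (rel_subset_cl δ))
    have hδW : δ' ∈ W := by
      rcases hδ' with rfl | rfl
      · exact hδ
      · exact I.symm δ hδ
    have hα := I.sign δ' hδW
    have S' := I.toSys.attach (N := (v, pt κ t1)) (hvne t1 ht1) (φ δ') (φ δ') False hfree hα hα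
      (fun _ => rfl) (Or.inr (Or.inr ⟨δ', hδW, hh, by simp⟩)) (Or.inl hvP) (htip t1 ht1)
      (fun h => h.elim) (fun μ hμ => ⟨I.tip μ (I.mis_sub hμ) v hvP, hmis μ hμ⟩)
    rw [if_neg not_false] at S'
    refine ⟨_, _, _, _, I.extend hS.off hends hVP S' ?_ ?_ hv ?_ (mem_insert_self _ _)
      (hend t1 ht1) (hpro t1 ht1), rfl⟩
    · intro κ' hκ' _
      refine ⟨by simp [hκ'], setSign_of_ne φ _ _ ?_ ?_⟩
      · rintro rfl; exact notMem_of_disjoint hfree hκ'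
      · rintro rfl; exact swap_notMem_of_disjoint hfree hκ'
    · intro x hx
      obtain ⟨κ', h, h'⟩ := mem_wallSet.1 hx
      exact subset_wallSet (by simp [h]) h'
    · intro κ' h h'
      rcases mem_insert.1 h with rfl | h
      · exact absurd h' (hend t1 ht1)
      rcases mem_insert.1 h with rfl | h
      · exact Or.inr rfl
      · exact Or.inl h
  · push Not at hmis
    obtain ⟨μ, hμ, hzμ⟩ := hmis
    have hμL : OnLine L μ := I.mis_line μ hμ
    have hμW := I.mis_sub hμ
    have hμne := I.ne μ hμW
    have hzL : side L (pt κ t1) = 0 := side_of_mem_cl_onLine hμL (rel_subset_cl μ hzμ)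
    have hLne : ∀ t, t1 < t → side L (pt κ t) ≠ 0 := by
      intro t ht h
      rw [side_pt] at h hzL
      have : (t - t1) * side L κ.2 = 0 := by
        have h3 : side L κ.1 * (t - t1) = 0 := by linear_combination t * hzL - t1 * h
        have h4 := (mul_eq_zero.1 h3).resolve_right (by linarith : t - t1 ≠ 0)
        rw [h4] at h hzL
        linear_combination h - hzL
      rcases mul_eq_zero.1 this with h | h
      · linarith
      · exact hvoff' h
    have hz_cl : ∀ κ' ∈ W, κ' ≠ μ → κ' ≠ μ.swap → pt κ t1 ∉ cl κ' := fun κ' hκ' e1 e2 =>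
      I.toSys.notMem_cl_of_mem_mis hμ hκ' e1 e2 hzμ
    have hzK : ‖pt κ t1‖ < K := by
      refine lt_of_le_of_ne h1K fun h => ?_
      obtain ⟨κ', h1, h2, h3⟩ := I.frame _ h
      refine hz_cl κ' h1 ?_ ?_ h2
      · rintro rfl; exact h3 hμL
      · rintro rfl; exact h3 (onLine_swap.2 hμL)
    obtain ⟨t2, ht2, h2C, h2f, h2K⟩ := exists_first_hit (isClosed_wallSet W) hsph hκne hzK
      (hev t1 ht1.le (by
        intro κ' hκ' hx t ht ht'
        have : OnLine L κ' := by
          by_contra hc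
          refine hz_cl κ' hκ' ?_ ?_ hx
          · rintro rfl; exact hc hμL
          · rintro rfl; exact hc (onLine_swap.2 hμL)
        exact hLne t ht (side_of_mem_cl_onLine this ht')))
    have h12 : 1 < t2 := ht1.trans ht2
    set y := pt κ t2 with hy
    obtain ⟨δ, hδ, hyδ⟩ := I.exists_mem_rel h2C (hend t2 h12) h2K
    have hyL : side L y ≠ 0 := hLne t2 ht2
    have hfree : ∀ κ' ∈ W, κ' ≠ μ → κ' ≠ μ.swap → Disjoint (rel (v, y)) (cl κ') := by
      intro κ' hκ' e1 e2
      rw [hrel t2 h12, Set.disjoint_left]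
      rintro _ ⟨t, ht, rfl⟩ h
      rcases lt_trichotomy t t1 with h3 | h3 | h3
      · exact h1f t ⟨ht.1, h3⟩ (subset_wallSet hκ' h)
      · rw [h3] at h; exact hz_cl κ' hκ' e1 e2 h
      · exact h2f t ⟨h3, ht.2⟩ (subset_wallSet hκ' h)
    have hδμ : ∀ μ' ∈ Mis, y ∉ rel μ' := fun μ' h h' =>
      hyL (side_of_mem_cl_onLine (I.mis_line μ' h) (rel_subset_cl μ' h'))
    obtain ⟨δ', hδ', hh⟩ := exists_hosts (N := (v, y)) (I.ne δ hδ) hyδ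
      ((hfree δ hδ (by rintro rfl; exact hδμ _ hμ hyδ)
        (by rintro rfl; rw [rel_swap] at hyδ; exact hδμ _ hμ hyδ)).mono_right (rel_subset_cl δ))
    have hδW : δ' ∈ W := by
      rcases hδ' with rfl | rfl
      · exact hδ
      · exact I.symm δ hδ
    have hα := I.sign δ' hδW
    have hx0 : pt κ t1 ∈ rel (v, y) := by
      rw [hrel t2 h12]; exact ⟨t1, ⟨ht1, ht2⟩, rfl⟩
    have hne : side (v, y) μ.1 ≠ 0 := side_fst_ne_of_cross (hvne t2 h12) hS.line hμne hvoff
      (side_of_mem_rel hx0) hzμ hμL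
    obtain ⟨N, hN, hA⟩ : ∃ N : Pt × Pt, (N = (v, y) ∨ N = (y, v)) ∧ 0 < side N μ.1 := by
      rcases lt_or_gt_of_ne hne with h | h
      · refine ⟨(v, y).swap, Or.inr rfl, ?_⟩
        rw [side_swap]; linarith
      · exact ⟨(v, y), Or.inl rfl, h⟩
    have hrN : rel N = rel (v, y) := by
      rcases hN with rfl | rfl
      · rfl
      · exact rel_swap (v, y)
    have hvμ : ∀ μ' ∈ Mis, v ∉ rel μ' := fun μ' h => I.tip μ' (I.mis_sub h) v hvP
    obtain ⟨W', φ', Mis', S', mem, hφ, -, -, -, -, hcard, -⟩ :=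
      I.toSys.cross hS.off hμW (I.mis_free μ hμ) (I.mis_swap μ hμ) hμL.1 hμL.2 (N := N)
        (by rcases hN with rfl | rfl
            · exact hvne t2 h12
            · exact (hvne t2 h12).symm) hzμ (hrN ▸ hx0) hA (φ δ') (φ δ')
        (by rw [hrN]; exact hfree) hα hα (fun _ => rfl)
        (by rcases hN with rfl | rfl
            · exact Or.inr (Or.inr ⟨δ', hδW, hh, rfl⟩)
            · exact Or.inl hvP)
        (by rcases hN with rfl | rfl
            · exact Or.inl hvP
            · exact Or.inr (Or.inr ⟨δ', hδW, hh, rfl⟩))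
        (by rw [hrN]; exact htip t2 h12)
        (by intro ν hν _
            rcases hN with rfl | rfl
            · exact ⟨hvμ ν hν, hδμ ν hν⟩
            · exact ⟨hδμ ν hν, hvμ ν hν⟩)
    have hyP := hend t2 h12
    have hzP := hend t1 ht1
    have hμ1P : μ.1 ∉ P := fun h => hS.off _ h hμL.1
    have hμ2P : μ.2 ∉ P := fun h => hS.off _ h hμL.2
    refine ⟨_, _, _, _, I.extend hS.off hends hVP S' ?_ ?_ hv ?_ (y := y) ?_ hyP (hpro t2 h12), ?_⟩
    · intro κ' hκ' hκL
      have e1 : κ' ≠ μ := fun h => hκL (h ▸ hμL)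
      have e2 : κ' ≠ μ.swap := fun h => hκL (h ▸ onLine_swap.2 hμL)
      exact ⟨(mem κ').2 (by tauto), hφ κ' hκ' e1 e2⟩
    · intro x hx
      obtain ⟨κ', h, h'⟩ := mem_wallSet.1 hx
      have hyμ : x ∈ cl μ → x ∈ wallSet W' := by
        rintro ⟨t, ht, rfl⟩
        obtain ⟨s, hs, hs'⟩ := hzμ
        rw [← hs'] at mem
        rcases le_total t s with h | h
        · refine subset_wallSet (κ := (μ.1, pt μ s)) ((mem _).2 (by simp)) ?_
          have := cl_pt μ hs.1
          rw [pt_zero] at this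
          rw [this]; exact ⟨t, ⟨ht.1, h⟩, rfl⟩
        · refine subset_wallSet (κ := (pt μ s, μ.2)) ((mem _).2 (by simp)) ?_
          have := cl_pt μ hs.2
          rw [pt_one] at this
          rw [this]; exact ⟨t, ⟨h, ht.2⟩, rfl⟩
      by_cases e1 : κ' = μ
      · exact hyμ (e1 ▸ h')
      by_cases e2 : κ' = μ.swap
      · rw [e2, cl_swap] at h'; exact hyμ h'
      · exact subset_wallSet ((mem κ').2 (by tauto)) h'
    · intro κ' h h'
      rcases (mem κ').1 h with rfl | rfl | rfl | rfl | rfl | rfl | ⟨h, -⟩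
      · exact absurd h' hμ2P
      · exact absurd h' hzP
      · exact absurd h' hzP
      · exact absurd h' hμ1P
      · rcases hN with rfl | rfl
        · exact absurd h' hyP
        · exact Or.inr rfl
      · rcases hN with rfl | rfl
        · exact Or.inr rfl
        · exact absurd h' hyP
      · exact Or.inl h
    · rcases hN with rfl | rfl
      · exact (mem _).2 (by simp)
      · exact (mem _).2 (by simp)
    · rw [hcard, if_pos hμ, card_erase_of_mem hμ]
      have h0 : 0 < Mis.card := card_pos.2 ⟨μ, hμ⟩
      have hs := I.sign μ hμW
      rcases hα with h | h <;> rcases hs with h' | h' <;> rw [h, h'] <;> norm_num <;> omega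

/-- If two edges cross the line of `L` in opposite directions, there is a complete wall system with
few misfits. -/
lemma Setting.exists_raySys (hS : Setting K P L M) {e f : Pt × Pt} (he : e ∈ M) (hf : f ∈ M)
    (hce : Cuts L e) (hcf : Cuts L f) (hop : side L e.1 * side L f.1 < 0) :
    ∃ z W φ Mis, RaySys K P L M P z W φ Mis ∧ Mis.card + 2 ≤ (M.filter (Cuts L)).card := by
  obtain ⟨W, φ, Mis, I, hcard⟩ := hS.exists_edgeSys he hf hce hcf hop
  have key : ∀ V ⊆ P, ∃ z W φ Mis, RaySys K P L M V z W φ Mis ∧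
      Mis.card + 2 ≤ (M.filter (Cuts L)).card := by
    intro V
    induction V using Finset.induction_on with
    | empty => exact fun _ => ⟨id, W, φ, Mis, I.raySys hS, hcard⟩
    | insert v V hv ih =>
      intro h
      obtain ⟨hvP, hVP⟩ := insert_subset_iff.1 h
      obtain ⟨z, W, φ, Mis, I, hc⟩ := ih hVP
      obtain ⟨z', W', φ', Mis', I', hc'⟩ := I.insert_ray hS hVP hvP hv
      exact ⟨z', W', φ', Mis', I', hc' ▸ hc⟩
  exact key P Subset.rfl

end

/-- `x` and `y` see each other in the open square of half-width `K`, with obstacles `C`. -/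
def Conn (K : ℝ) (C : Set Pt) (x y : Pt) : Prop := ‖x‖ < K ∧ ‖y‖ < K ∧ Disjoint (cl (x, y)) C

/-- Every point of `C` in the square is in the interior of a segment contained in `C`. -/
def Thick (K : ℝ) (C : Set Pt) : Prop :=
  ∀ z ∈ C, ‖z‖ < K → ∃ d : Pt, d ≠ 0 ∧ ∀ᶠ s in 𝓝 (0 : ℝ), z + s • d ∈ C

section

variable {K : ℝ} {C : Set Pt} {x y z : Pt}

lemma Conn.symm (h : Conn K C x y) : Conn K C y x :=
  ⟨h.2.1, h.1, by rw [show cl (y, x) = cl (x, y) from cl_swap (x, y)]; exact h.2.2⟩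

lemma Conn.refl (h : ‖x‖ < K) (hx : x ∉ C) : Conn K C x x := by
  refine ⟨h, h, Set.disjoint_left.2 ?_⟩
  rintro _ ⟨t, -, rfl⟩
  simpa [pt] using hx

lemma Conn.notMem (h : Conn K C x y) : y ∉ C :=
  Set.disjoint_left.1 h.2.2 (snd_mem_cl (x, y))

lemma Conn.of_mem (h : Conn K C x y) (hz : z ∈ cl (x, y)) : Conn K C x z := by
  refine ⟨h.1, norm_lt_of_mem_cl h.1 h.2.1 hz, h.2.2.mono_left ?_⟩
  exact convex_cl (κ := (x, z)) (by rw [cl_eq_segment]; exact convex_segment _ _) (fst_mem_cl (x, y)) hz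

lemma mem_cl_or_of_side_eq_zero (h : side (y, z) x = 0) {w : Pt} (hw : w ∈ cl (x, z)) :
    w ∈ cl (x, y) ∨ w ∈ cl (y, z) := by
  rcases eq_or_ne y z with rfl | hyz
  · exact Or.inl hw
  obtain ⟨t, rfl⟩ := exists_pt_of_side_eq_zero (δ := (y, z)) hyz h
  have h1 : cl (pt (y, z) t, z) = pt (y, z) '' segment ℝ t 1 := by
    ext w
    constructor
    · rintro ⟨u, hu, rfl⟩
      refine ⟨t + u * (1 - t), ?_, ?_⟩
      · rw [segment_eq_image']; exact ⟨u, hu, rfl⟩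
      · have := pt_pt (y, z) t 1 u
        rw [pt_one] at this; exact this.symm
    · rintro ⟨a, ha, rfl⟩
      rw [segment_eq_image'] at ha
      obtain ⟨u, hu, rfl⟩ := ha
      refine ⟨u, hu, ?_⟩
      have := pt_pt (y, z) t 1 u
      rw [pt_one] at this; exact this
  have h2 : cl (pt (y, z) t, y) = pt (y, z) '' segment ℝ t 0 := by
    ext w
    constructor
    · rintro ⟨u, hu, rfl⟩
      refine ⟨t + u * (0 - t), ?_, ?_⟩
      · rw [segment_eq_image']; exact ⟨u, hu, rfl⟩
      · have := pt_pt (y, z) t 0 u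
        rw [pt_zero] at this; exact this.symm
    · rintro ⟨a, ha, rfl⟩
      rw [segment_eq_image'] at ha
      obtain ⟨u, hu, rfl⟩ := ha
      refine ⟨u, hu, ?_⟩
      have := pt_pt (y, z) t 0 u
      rw [pt_zero] at this; exact this
  rw [h1] at hw
  rw [h2]
  obtain ⟨s, hs, rfl⟩ := hw
  rw [segment_eq_uIcc, Set.mem_uIcc] at hs
  rcases lt_or_ge s 0 with h0 | h0
  · exact Or.inl ⟨s, by rw [segment_eq_uIcc, Set.mem_uIcc]; rcases hs with h | h <;> grind, rfl⟩
  rcases le_or_gt s 1 with h3 | h3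
  · exact Or.inr ⟨s, ⟨h0, h3⟩, rfl⟩
  · exact Or.inl ⟨s, by rw [segment_eq_uIcc, Set.mem_uIcc]; rcases hs with h | h <;> grind, rfl⟩

lemma exists_coords {u v : Pt} (h : cr u v ≠ 0) (d : Pt) : ∃ a b : ℝ, d = a • u + b • v := by
  refine ⟨cr d v / cr u v, cr u d / cr u v, ?_⟩
  have h1 : cr u v * d.1 = cr d v * u.1 + cr u d * v.1 := by unfold cr; ring
  have h2 : cr u v * d.2 = cr d v * u.2 + cr u d * v.2 := by unfold cr; ring
  ext
  · simp only [Prod.fst_add, Prod.smul_fst, smul_eq_mul]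
    field_simp
    linear_combination h1
  · simp only [Prod.snd_add, Prod.smul_snd, smul_eq_mul]
    field_simp
    linear_combination h2

set_option maxHeartbeats 400000 in
lemma Conn.trans (hC : IsClosed C) (hT : Thick K C) (h1 : Conn K C x y) (h2 : Conn K C y z) :
    Conn K C x z := by
  refine ⟨h1.1, h2.2.1, ?_⟩
  by_cases hcol : side (y, z) x = 0
  · refine Set.disjoint_left.2 fun w hw hwC => ?_
    rcases mem_cl_or_of_side_eq_zero hcol hw with h | h
    · exact Set.disjoint_left.1 h1.2.2 h hwC
    · exact Set.disjoint_left.1 h2.2.2 h hwC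
  by_contra hnd
  obtain ⟨w, hw, hwC⟩ := Set.not_disjoint_iff.1 hnd
  obtain ⟨u1, hu1, rfl⟩ := hw
  let F : ℝ × ℝ → Pt := fun a => pt (x, pt (y, z) a.1) a.2
  have hF : Continuous F := by
    simp only [F, pt]
    fun_prop
  let D : Set (ℝ × ℝ) := (Set.Icc 0 1 ×ˢ Set.Icc 0 1) ∩ F ⁻¹' C
  have hD : IsCompact D := (isCompact_Icc.prod isCompact_Icc).inter_right (hC.preimage hF)
  have hDne : D.Nonempty := ⟨(1, u1), ⟨by simp, hu1⟩, by
    simp only [Set.mem_preimage, F, pt_one]; exact hwC⟩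
  obtain ⟨⟨s0, u2⟩, hsD, hmin⟩ := hD.exists_isMinOn hDne continuous_fst.continuousOn
  let E : Set ℝ := Set.Icc 0 1 ∩ {u | F (s0, u) ∈ C}
  have hE : IsCompact E := isCompact_Icc.inter_right (hC.preimage (by fun_prop : Continuous fun u : ℝ => F (s0, u)))
  obtain ⟨u0, huE, hmin'⟩ := hE.exists_isMinOn ⟨u2, hsD.1.2, hsD.2⟩ continuous_id.continuousOn
  have hs0 : s0 ∈ Set.Icc (0 : ℝ) 1 := hsD.1.1
  have hu0 : u0 ∈ Set.Icc (0 : ℝ) 1 := huE.1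
  have hFC : pt (x, pt (y, z) s0) u0 ∈ C := huE.2
  have hs0' : 0 < s0 := by
    refine lt_of_le_of_ne hs0.1 fun h => ?_
    rw [← h, pt_zero] at hFC
    exact Set.disjoint_left.1 h1.2.2 ⟨u0, hu0, rfl⟩ hFC
  have hu0' : 0 < u0 := by
    refine lt_of_le_of_ne hu0.1 fun h => ?_
    rw [← h, pt_zero] at hFC
    exact Set.disjoint_left.1 h1.2.2 (fst_mem_cl (x, y)) hFC
  have hu1' : u0 < 1 := by
    refine lt_of_le_of_ne hu0.2 fun h => ?_
    rw [h, pt_one] at hFC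
    exact Set.disjoint_left.1 h2.2.2 ⟨s0, hs0, rfl⟩ hFC
  have hq : ‖pt (y, z) s0‖ < K := norm_lt_of_mem_cl h2.1 h2.2.1 ⟨s0, hs0, rfl⟩
  obtain ⟨d, hd, hev⟩ := hT _ hFC (norm_lt_of_mem_cl h1.1 hq ⟨u0, hu0, rfl⟩)
  have hcr : cr (z - y) (pt (y, z) s0 - x) ≠ 0 := by
    intro h
    apply hcol
    simp only [cr, Prod.fst_sub, Prod.snd_sub, pt_fst, pt_snd] at h
    simp only [side_eq]
    linear_combination -h
  obtain ⟨a, b, hdab⟩ := exists_coords hcr d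
  -- a small step along `±d` gives a smaller parameter
  have key : ∀ σ : ℝ, 0 < u0 + σ * b → u0 + σ * b < 1 → 0 < s0 + σ * a / (u0 + σ * b) →
      pt (x, pt (y, z) s0) u0 + σ • d ∈ C → s0 + σ * a / (u0 + σ * b) ≤ 1 →
      0 ≤ σ * a ∧ (a = 0 → 0 ≤ σ * b) := by
    intro σ k1 k2 k3 k4 k5
    have hFe : F (s0 + σ * a / (u0 + σ * b), u0 + σ * b) = pt (x, pt (y, z) s0) u0 + σ • d := by
      rw [hdab]
      simp only [F, pt]
      ext <;> simp <;> field_simp <;> ring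
    have hm : (s0 + σ * a / (u0 + σ * b), u0 + σ * b) ∈ D :=
      ⟨⟨⟨k3.le, k5⟩, ⟨k1.le, k2.le⟩⟩, by rw [Set.mem_preimage, hFe]; exact k4⟩
    have := hmin hm
    simp only [Set.mem_ofPred_eq] at this
    refine ⟨?_, fun ha => ?_⟩
    · by_contra hc
      have := div_neg_of_neg_of_pos (not_le.1 hc) k1
      linarith
    · have hm' : u0 + σ * b ∈ E := ⟨⟨k1.le, k2.le⟩, by
        rw [ha] at hFe
        simp only [mul_zero, zero_div, add_zero] at hFe
        rw [Set.mem_ofPred_eq, hFe]; exact k4⟩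
      have := hmin' hm'
      simp only [id, Set.mem_ofPred_eq] at this
      linarith
  have hden : Tendsto (fun σ : ℝ => u0 + σ * b) (𝓝 0) (𝓝 u0) := by
    have : Continuous fun σ : ℝ => u0 + σ * b := by fun_prop
    simpa using this.tendsto 0
  have hnum : Tendsto (fun σ : ℝ => s0 + σ * a / (u0 + σ * b)) (𝓝 0) (𝓝 s0) := by
    have h3 : Tendsto (fun σ : ℝ => σ * a) (𝓝 0) (𝓝 0) := by
      have : Continuous fun σ : ℝ => σ * a := by fun_prop
      simpa using this.tendsto 0
    simpa using tendsto_const_nhds.add (h3.div hden hu0'.ne')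
  have hall : ∀ᶠ σ in 𝓝 (0 : ℝ), s0 + σ * a / (u0 + σ * b) ≤ 1 → 0 ≤ σ * a ∧ (a = 0 → 0 ≤ σ * b) := by
    filter_upwards [hden.eventually_const_lt hu0', hden.eventually_lt_const hu1',
      hnum.eventually_const_lt hs0', hev] with σ k1 k2 k3 k4 using key σ k1 k2 k3 k4
  have hall2 : ∀ᶠ σ in 𝓝 (0 : ℝ), (σ * a ≤ 0 → 0 ≤ σ * a ∧ (a = 0 → 0 ≤ σ * b)) := by
    filter_upwards [hall, hden.eventually_const_lt hu0'] with σ k1 k2 k3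
    refine k1 ?_
    have := div_nonpos_of_nonpos_of_nonneg k3 k2.le
    linarith [hs0.2]
  obtain ⟨ε, hε, hb⟩ := Metric.eventually_nhds_iff.1 hall2
  have p1 := hb (y := ε / 2) (by simp [abs_of_pos hε]; linarith)
  have p2 := hb (y := -(ε / 2)) (by simp [abs_of_pos hε]; linarith)
  have ha : a = 0 := by
    rcases le_total a 0 with h | h
    · have := (p1 (by nlinarith)).1
      nlinarith
    · have := (p2 (by nlinarith)).1
      nlinarith
  have hb0 : b = 0 := by
    have q1 := (p1 (by rw [ha]; simp)).2 ha
    have q2 := (p2 (by rw [ha]; simp)).2 ha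
    nlinarith
  apply hd
  rw [hdab, ha, hb0]; simp

/-- The cell of `x`. -/
def cell (K : ℝ) (C : Set Pt) (x : Pt) : Set Pt := {y | Conn K C x y}

lemma cell_eq (hC : IsClosed C) (hT : Thick K C) (h : Conn K C x y) : cell K C x = cell K C y :=
  Set.ext fun _ => ⟨fun h' => h.symm.trans hC hT h', fun h' => h.trans hC hT h'⟩

lemma convex_cell (hC : IsClosed C) (hT : Thick K C) (x : Pt) : Convex ℝ (cell K C x) := by
  rw [convex_iff_segment_subset]
  intro y hy z hz w hw
  rw [← cl_eq_segment (y, z)] at hw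
  exact Conn.trans hC hT hy (((Conn.symm hy).trans hC hT hz).of_mem hw)

lemma conn_iff (hC : IsClosed C) (hT : Thick K C) (hy : ‖y‖ < K) (hyC : y ∉ C) :
    Conn K C x y ↔ cell K C x = cell K C y :=
  ⟨cell_eq hC hT, fun h => by
    have : y ∈ cell K C y := Conn.refl hy hyC
    rw [← h] at this; exact this⟩

/-- The indicator function of a cell is locally constant. -/
lemma eventually_conn_iff (hC : IsClosed C) (hT : Thick K C) (hsph : ∀ x : Pt, ‖x‖ = K → x ∈ C)
    (x : Pt) (hy : y ∉ C) : ∀ᶠ z in 𝓝 y, (Conn K C x z ↔ Conn K C x y) := by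
  rcases lt_or_ge ‖y‖ K with h | h
  · have h1 : ∀ᶠ z in 𝓝 y, z ∉ C := hC.isOpen_compl.mem_nhds hy
    have h2 : ∀ᶠ z in 𝓝 y, ‖z‖ < K :=
      continuous_norm.continuousAt.eventually_lt continuousAt_const h
    obtain ⟨r, hr, hb⟩ := Metric.eventually_nhds_iff_ball.1 (h1.and h2)
    filter_upwards [Metric.ball_mem_nhds y hr] with z hz
    have hyz : Conn K C y z := by
      refine ⟨h, (hb z hz).2, Set.disjoint_left.2 fun w hw => (hb w ?_).1⟩
      exact convex_cl (convex_ball y r) (κ := (y, z)) (Metric.mem_ball_self hr) hz hw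
    exact ⟨fun h' => h'.trans hC hT hyz.symm, fun h' => h'.trans hC hT hyz⟩
  · have h' : K < ‖y‖ := lt_of_le_of_ne h fun h => hy (hsph y h.symm)
    filter_upwards [continuousAt_const.eventually_lt continuous_norm.continuousAt h'] with z hz
    exact ⟨fun k => absurd k.2.1 hz.not_gt, fun k => absurd k.2.1 h'.not_gt⟩

end

/-- The union of the walls that are not misfits. -/
def solid (W Mis : Finset (Pt × Pt)) : Set Pt := wallSet {κ ∈ W | κ ∉ Mis ∧ κ.swap ∉ Mis}

section

variable {K : ℝ} {P : Finset Pt} {L : Pt × Pt} {W Mis M : Finset (Pt × Pt)} {φ : Pt × Pt → ℤ}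
  {z : Pt → Pt}

lemma mem_solid {x : Pt} :
    x ∈ solid W Mis ↔ ∃ κ ∈ W, κ ∉ Mis ∧ κ.swap ∉ Mis ∧ x ∈ cl κ := by
  simp only [solid, mem_wallSet, mem_filter, and_assoc]

lemma isClosed_solid : IsClosed (solid W Mis) := isClosed_wallSet _

lemma solid_subset : solid W Mis ⊆ wallSet W := fun x hx => by
  obtain ⟨κ, h, -, -, h'⟩ := mem_solid.1 hx
  exact subset_wallSet h h'

lemma Sys.cl_subset_solid (S : Sys K P L W φ Mis) {κ : Pt × Pt} (hκ : κ ∈ W) (hL : ¬ OnLine L κ) :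
    cl κ ⊆ solid W Mis := fun _ hx =>
  mem_solid.2 ⟨κ, hκ, fun h => hL (S.mis_line κ h),
    fun h => hL (onLine_swap.1 (S.mis_line κ.swap h)), hx⟩

lemma Sys.rel_disjoint_solid (S : Sys K P L W φ Mis) {μ : Pt × Pt} (hμ : μ ∈ Mis) :
    Disjoint (rel μ) (solid W Mis) := by
  refine Set.disjoint_left.2 fun x hx hx' => ?_
  obtain ⟨κ, h1, h2, h3, h4⟩ := mem_solid.1 hx'
  refine S.notMem_cl_of_mem_mis hμ h1 ?_ ?_ hx h4
  · rintro rfl; exact h2 hμ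
  · rintro rfl; exact h3 (by simpa using hμ)

lemma Setting.exists_dart_to (hS : Setting K P L M) {v : Pt} (hv : v ∈ P) :
    ∃ κ : Pt × Pt, (κ ∈ M ∨ κ.swap ∈ M) ∧ κ.2 = v := by
  obtain ⟨e, he, h | h⟩ := hS.cov v hv
  · exact ⟨e.swap, Or.inr (by simpa using he), h.symm⟩
  · exact ⟨e, Or.inl he, h.symm⟩

lemma Setting.dart_ne (hS : Setting K P L M) {κ : Pt × Pt} (h : κ ∈ M ∨ κ.swap ∈ M) :
    κ.1 ≠ κ.2 := by
  rcases h with h | h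
  · exact (hS.ends _ h).2.2
  · exact (hS.ends _ h).2.2.symm

lemma Setting.dart_unique (hS : Setting K P L M) {κ κ' : Pt × Pt} (h : κ ∈ M ∨ κ.swap ∈ M)
    (h' : κ' ∈ M ∨ κ'.swap ∈ M) (he : κ.2 = κ'.2) : κ = κ' := by
  have key : ∀ e e' : Pt × Pt, e ∈ M → e' ∈ M → κ.2 ∈ cl e → κ.2 ∈ cl e' → e = e' := by
    intro e e' he he' h h'
    by_contra hne
    exact Set.disjoint_left.1 (hS.free e he e' he' hne) h h'
  have h1 : κ.2 ∈ cl κ := snd_mem_cl κ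
  have h2 : κ.2 ∈ cl κ' := he ▸ snd_mem_cl κ'
  rcases h with k | k <;> rcases h' with k' | k'
  · exact key _ _ k k' h1 h2
  · have := key _ _ k k' h1 (by rwa [cl_swap])
    rw [this] at he
    exact absurd he (hS.dart_ne (Or.inr k'))
  · have := key _ _ k' k h2 (by rwa [cl_swap])
    rw [this] at he
    exact absurd he.symm (hS.dart_ne (Or.inr k))
  · exact Prod.swap_injective (key _ _ k k' (by rwa [cl_swap]) (by rwa [cl_swap]))

namespace RaySys

lemma dart_mem (I : RaySys K P L M P z W φ Mis) {κ : Pt × Pt} (h : κ ∈ M ∨ κ.swap ∈ M) :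
    κ ∈ W ∧ κ.swap ∈ W ∧ φ κ.swap = - φ κ ∧ φ κ = if κ ∈ M then 1 else -1 := by
  rcases h with h | h
  · obtain ⟨a, b, c, d⟩ := I.edge κ h
    exact ⟨a, b, by rw [c, d], by rw [if_pos h, c]⟩
  · obtain ⟨a, b, c, d⟩ := I.edge _ h
    rw [Prod.swap_swap] at b d
    refine ⟨b, a, by rw [c, d]; rfl, ?_⟩
    rw [d, if_neg]
    intro hc
    have := (I.edge κ hc).2.2.1
    rw [d] at this
    norm_num at this

lemma sphere (I : RaySys K P L M P z W φ Mis) {x : Pt} (hx : ‖x‖ = K) : x ∈ solid W Mis := by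
  obtain ⟨κ, h, h', h''⟩ := I.frame x hx
  exact I.cl_subset_solid h h'' h'

lemma thick (I : RaySys K P L M P z W φ Mis) (hS : Setting K P L M) : Thick K (solid W Mis) := by
  have hrel : ∀ x, ∀ κ ∈ W, cl κ ⊆ solid W Mis → x ∈ rel κ →
      ∃ d : Pt, d ≠ 0 ∧ ∀ᶠ s in 𝓝 (0 : ℝ), x + s • d ∈ solid W Mis := by
    rintro _ κ hκ h ⟨t, ht, rfl⟩
    refine ⟨κ.2 - κ.1, sub_ne_zero.2 (I.ne κ hκ).symm, ?_⟩
    have h1 : ∀ᶠ s in 𝓝 (0 : ℝ), t + s ∈ Set.Ioo (0 : ℝ) 1 := by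
      have hc : Continuous fun s : ℝ => t + s := by fun_prop
      exact hc.continuousAt.eventually (isOpen_Ioo.mem_nhds (by simpa using ht))
    filter_upwards [h1] with s hs
    refine h ⟨t + s, ⟨hs.1.le, hs.2.le⟩, ?_⟩
    simp only [pt, add_smul, add_assoc]
  have hhead : ∀ κ ∈ W, κ ∉ Mis → κ.swap ∉ Mis → ‖κ.2‖ < K →
      ∃ d : Pt, d ≠ 0 ∧ ∀ᶠ s in 𝓝 (0 : ℝ), κ.2 + s • d ∈ solid W Mis := by
    intro κ hκ _ _ hK
    rcases I.head κ hκ with h | h | ⟨δ, hδ, h, -⟩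
    · obtain ⟨τ, hτ, hτv⟩ := hS.exists_dart_to h
      obtain ⟨t, ht, hzt⟩ := I.prolong _ h τ hτ hτv
      obtain ⟨hτW, -, -, -⟩ := I.dart_mem hτ
      have hne := hS.dart_ne hτ
      have hτL : ¬ OnLine L τ := fun hc => hS.off _ h (hτv ▸ hc.2)
      have hzL : ¬ OnLine L (κ.2, z κ.2) := fun hc => hS.off _ h hc.1
      refine ⟨τ.2 - τ.1, sub_ne_zero.2 hne.symm, ?_⟩
      have h1 : ∀ᶠ s in 𝓝 (0 : ℝ), 1 + s ∈ Set.Ioo (0 : ℝ) t := by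
        have hc : Continuous fun s : ℝ => 1 + s := by fun_prop
        exact hc.continuousAt.eventually (isOpen_Ioo.mem_nhds (by simpa using ht))
      filter_upwards [h1] with s hs
      have heq : κ.2 + s • (τ.2 - τ.1) = pt τ (1 + s) := by
        rw [← hτv]; simp only [pt, add_smul, one_smul]; abel
      rw [heq]
      rcases le_total (1 + s) 1 with h2 | h2
      · exact I.cl_subset_solid hτW hτL ⟨1 + s, ⟨hs.1.le, h2⟩, rfl⟩
      · refine I.cl_subset_solid (I.ray _ h) hzL ?_
        have h3 := cl_pt τ ht
        rw [pt_one, hτv, ← hzt] at h3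
        rw [h3]
        exact ⟨1 + s, ⟨h2, hs.2.le⟩, rfl⟩
    · rw [far_iff] at h
      exact absurd h hK.not_gt
    · refine hrel κ.2 δ hδ (fun x hx => mem_solid.2 ⟨δ, hδ, ?_, ?_, hx⟩) h.1
      · intro hc
        exact I.mis_free δ hc κ hκ h.1
      · intro hc
        refine I.mis_free _ hc κ hκ ?_
        rw [rel_swap]; exact h.1
  intro x hx hK
  obtain ⟨κ, hκ, h1, h2, h3⟩ := mem_solid.1 hx
  rcases mem_cl_cases h3 with h | h | h
  · exact hrel x κ hκ (fun y hy => mem_solid.2 ⟨κ, hκ, h1, h2, hy⟩) h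
  · have := hhead κ.swap (I.symm κ hκ) h2 (by simpa using h1) (by rw [Prod.snd_swap, ← h]; exact hK)
    rwa [Prod.snd_swap, ← h] at this
  · rw [h]
    exact hhead κ hκ h1 h2 (h ▸ hK)

lemma eventually_side_eq_zero (I : RaySys K P L M P z W φ Mis) (hS : Setting K P L M)
    {κ : Pt × Pt} (hκ : κ ∈ M ∨ κ.swap ∈ M) (hv : κ.2 ∈ P) :
    ∀ᶠ y in 𝓝 κ.2, y ∈ wallSet W → side κ y = 0 := by
  have : ∀ κ' ∈ W, ∀ᶠ y in 𝓝 κ.2, y ∈ cl κ' → side κ y = 0 := by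
    intro κ' hκ'
    by_cases hx : κ.2 ∈ cl κ'
    swap
    · filter_upwards [(isClosed_cl κ').isOpen_compl.mem_nhds hx] with y hy h using absurd h hy
    have hends : side κ κ'.1 = 0 ∧ side κ κ'.2 = 0 := by
      have hhead : ∀ τ ∈ W, τ.2 = κ.2 → side κ τ.1 = 0 ∧ side κ τ.2 = 0 := by
        intro τ hτ h
        have hdart : (τ ∈ M ∨ τ.swap ∈ M) → side κ τ.1 = 0 ∧ side κ τ.2 = 0 := fun hc => by
          rw [hS.dart_unique hc hκ h]; exact ⟨side_fst _, side_snd _⟩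
        rcases I.tips τ hτ (h ▸ hv) with k | k | ⟨-, k⟩
        · exact hdart (Or.inl k)
        · exact hdart (Or.inr k)
        · obtain ⟨t, -, ht⟩ := I.prolong _ hv κ hκ rfl
          rw [h] at k
          rw [k, h, ht]
          exact ⟨side_pt_self _ _, side_snd _⟩
      rcases mem_cl_cases hx with h | h | h
      · exact absurd h (I.tip κ' hκ' _ hv)
      · exact (hhead κ'.swap (I.symm _ hκ') h.symm).symm
      · exact hhead κ' hκ' h.symm
    refine Eventually.of_forall fun y hy => ?_
    obtain ⟨t, -, rfl⟩ := hy
    rw [side_pt, hends.1, hends.2]; ring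
  refine ((Filter.eventually_all_finset W).2 this).mono fun y hy h => ?_
  obtain ⟨κ', h1, h2⟩ := mem_wallSet.1 h
  exact hy κ' h1 h2

set_option maxHeartbeats 400000 in
/-- The sample point of a tip. -/
lemma exists_sample (I : RaySys K P L M P z W φ Mis) (hS : Setting K P L M)
    {κ : Pt × Pt} (hκ : κ ∈ M ∨ κ.swap ∈ M) (hv : κ.2 ∈ P) :
    ∃ w : Pt, ‖w‖ < K ∧ 0 < side L κ.2 * side L w ∧ w ∉ solid W Mis ∧
      (∀ y ∈ cl (κ.2, w), y ≠ κ.2 → y ∉ solid W Mis) ∧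
      ∀ h : Pt → ℤ, LC h (wallSet W) → (φ κ * hd h κ - φ κ.swap * tl h κ.swap) +
        (φ (z κ.2, κ.2) * hd h (z κ.2, κ.2) - φ (κ.2, z κ.2) * tl h (κ.2, z κ.2)) =
        2 * (φ κ * h w) := by
  have hne := hS.dart_ne hκ
  obtain ⟨t, ht, hzt⟩ := I.prolong _ hv κ hκ rfl
  obtain ⟨hκW, hκW', hφs, -⟩ := I.dart_mem hκ
  have e1 := I.eventually_side_eq_zero hS hκ hv
  have e2 : ∀ᶠ y in 𝓝 κ.2, ‖y‖ < K :=
    continuous_norm.continuousAt.eventually_lt continuousAt_const (hS.bound _ hv)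
  have e3 : ∀ᶠ y in 𝓝 κ.2, 0 < side L κ.2 * side L y :=
    continuousAt_const.eventually_lt ((continuous_side L).const_smul (side L κ.2)).continuousAt
      (mul_self_pos.2 (hS.off _ hv))
  obtain ⟨r, hr, hb⟩ := Metric.eventually_nhds_iff_ball.1 (e1.and (e2.and e3))
  have hLC : ∀ h : Pt → ℤ, LC h (wallSet W) → ∀ τ : Pt × Pt, (∀ q, side τ q ≠ 0 → side κ q ≠ 0) →
      ∀ a ∈ Metric.ball κ.2 r, ∀ b ∈ Metric.ball κ.2 r, 0 < side τ a → 0 < side τ b → h a = h b := by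
    intro h H τ hτ a ha b hb' ha' hb''
    refine H.eq_of_preconnected (K := Metric.ball κ.2 r ∩ {q | 0 < side τ q})
      ((convex_ball _ _).inter (side_pos_convex τ)).isPreconnected ?_ ⟨ha, ha'⟩ ⟨hb', hb''⟩
    intro q hq hq'
    exact hτ q hq.2.ne' ((hb q hq.1).1 hq')
  have hτ1 : ∀ q, side κ q ≠ 0 → side κ q ≠ 0 := fun q h => h
  have hτ2 : ∀ q, side κ.swap q ≠ 0 → side κ q ≠ 0 := fun q h h' => h (by rw [side_swap, h', neg_zero])
  have hsz : ∀ y, side (κ.2, z κ.2) y = (t - 1) * side κ y := fun y => by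
    rw [hzt]; simp only [side_eq, pt_fst, pt_snd]; ring
  have hsz' : ∀ y, side (z κ.2, κ.2) y = - side (κ.2, z κ.2) y := fun y => side_swap (κ.2, z κ.2) y
  have hvz : κ.2 ≠ z κ.2 := I.ne _ (I.ray _ hv)
  have ht' : 0 < t - 1 := sub_pos.2 ht
  have hvals : ∀ h : Pt → ℤ, LC h (wallSet W) → ∀ w ∈ Metric.ball κ.2 r,
      (0 < side κ w → hd h κ = h w ∧ tl h (κ.2, z κ.2) = h w) ∧
      (0 < side κ.swap w → tl h κ.swap = h w ∧ hd h (z κ.2, κ.2) = h w) := by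
    intro h H w hw
    refine ⟨fun hs => ⟨hd_eq_of_nhds hne ?_, tl_eq_of_nhds hvz ?_⟩,
      fun hs => ⟨tl_eq_of_nhds hne.symm ?_, hd_eq_of_nhds hvz.symm ?_⟩⟩
    · filter_upwards [Metric.ball_mem_nhds _ hr] with y hy h0
      exact hLC h H κ hτ1 _ hy _ hw h0 hs
    · filter_upwards [Metric.ball_mem_nhds κ.2 hr] with y hy h0
      rw [hsz] at h0
      exact hLC h H κ hτ1 _ hy _ hw (pos_of_mul_pos_right h0 ht'.le) hs
    · filter_upwards [Metric.ball_mem_nhds κ.2 hr] with y hy h0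
      exact hLC h H κ.swap hτ2 _ hy _ hw h0 hs
    · filter_upwards [Metric.ball_mem_nhds κ.2 hr] with y hy h0
      rw [hsz', hsz] at h0
      refine hLC h H κ.swap hτ2 _ hy _ hw ?_ hs
      rw [side_swap]
      nlinarith
  have hρ : φ (z κ.2, κ.2) = φ (κ.2, z κ.2) := I.flat _ (I.ray _ hv) (I.far_end _ hv)
  have hcl : ∀ τ : Pt × Pt, (∀ q, side τ q ≠ 0 → side κ q ≠ 0) → side τ κ.2 = 0 →
      ∀ w ∈ Metric.ball κ.2 r, 0 < side τ w → ∀ y ∈ cl (κ.2, w), y ≠ κ.2 → y ∉ solid W Mis := by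
    intro τ hτ h0 w hw hws y hy hyne hyS
    have hyb := convex_cl (convex_ball κ.2 r) (κ := (κ.2, w)) (Metric.mem_ball_self hr) hw hy
    have hs0 := (hb y hyb).1 (solid_subset hyS)
    obtain ⟨u, hu, rfl⟩ := hy
    refine hτ _ ?_ hs0
    rw [side_pt, h0, mul_zero, zero_add]
    refine mul_ne_zero ?_ hws.ne'
    rintro rfl
    exact hyne (pt_zero _)
  have hclw : ∀ τ : Pt × Pt, (∀ q, side τ q ≠ 0 → side κ q ≠ 0) →
      ∀ w ∈ Metric.ball κ.2 r, 0 < side τ w → w ∉ solid W Mis := fun τ hτ w hw hws hc =>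
    hτ w hws.ne' ((hb w hw).1 (solid_subset hc))
  have hmain : ∀ τ : Pt × Pt, (τ = κ ∧ φ (κ.2, z κ.2) = - φ κ ∨ τ = κ.swap ∧ φ (κ.2, z κ.2) = φ κ) →
      ∃ w ∈ Metric.ball κ.2 r, 0 < side τ w := by
    intro τ hτ
    have : τ.1 ≠ τ.2 ∧ side τ κ.2 = 0 := by
      rcases hτ with ⟨rfl, -⟩ | ⟨rfl, -⟩
      · exact ⟨hne, side_snd _⟩
      · exact ⟨hne.symm, by rw [side_swap, side_snd, neg_zero]⟩
    obtain ⟨w, h1, h2⟩ := ((frequently_side_pos this.1 this.2).and_eventually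
      (Metric.ball_mem_nhds κ.2 hr)).exists
    exact ⟨w, h2, h1⟩
  have hsgn := I.sign _ hκW
  have hsgn' := I.sign _ (I.ray _ hv)
  have hcase : φ (κ.2, z κ.2) = - φ κ ∨ φ (κ.2, z κ.2) = φ κ := by
    rcases hsgn with h | h <;> rcases hsgn' with h' | h' <;> rw [h, h'] <;> simp
  rcases hcase with h0 | h0
  · obtain ⟨w, hw, hws⟩ := hmain κ (Or.inl ⟨rfl, h0⟩)
    refine ⟨w, (hb w hw).2.1, (hb w hw).2.2, hclw κ hτ1 w hw hws, hcl κ hτ1 (side_snd _) w hw hws, fun h H => ?_⟩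
    obtain ⟨w', hw', hws'⟩ := ((frequently_side_pos (σ := κ.swap) hne.symm (x := κ.2)
      (by rw [side_swap, side_snd, neg_zero])).and_eventually (Metric.ball_mem_nhds κ.2 hr)).exists
    obtain ⟨a1, a2⟩ := (hvals h H w hw).1 hws
    obtain ⟨a3, a4⟩ := (hvals h H w' hws').2 hw'
    rw [a1, a2, a3, a4, hρ, h0, hφs]; ring
  · obtain ⟨w, hw, hws⟩ := hmain κ.swap (Or.inr ⟨rfl, h0⟩)
    refine ⟨w, (hb w hw).2.1, (hb w hw).2.2, hclw κ.swap hτ2 w hw hws, hcl κ.swap hτ2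
      (by rw [side_swap, side_snd, neg_zero]) w hw hws, fun h H => ?_⟩
    obtain ⟨w', hw', hws'⟩ := ((frequently_side_pos hne (side_snd κ)).and_eventually
      (Metric.ball_mem_nhds κ.2 hr)).exists
    obtain ⟨a1, a2⟩ := (hvals h H w' hws').1 hw'
    obtain ⟨a3, a4⟩ := (hvals h H w hw).2 hws
    rw [a1, a2, a3, a4, hρ, h0, hφs]; ring

end RaySys

end

/-- A closed obstacle set `C` whose complement in the square of half-width `K` has convex cells,
with a sample point `w v` in a cell adjacent to each `v ∈ B ∪ R`, such that each cell is balanced. -/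
structure CellSys (K : ℝ) (L : Pt × Pt) (B R : Finset Pt) (M : Finset (Pt × Pt)) (C : Set Pt)
    (w : Pt → Pt) (Mis : Finset (Pt × Pt)) : Prop where
  closed : IsClosed C
  thick : Thick K C
  edges : ∀ e ∈ M, cl e ⊆ C
  inside : ∀ v ∈ B ∪ R, ‖w v‖ < K
  notMem : ∀ v ∈ B ∪ R, w v ∉ C
  free : ∀ v ∈ B ∪ R, ∀ y ∈ cl (v, w v), y ≠ v → y ∉ C
  same_side : ∀ v ∈ B ∪ R, 0 < side L v * side L (w v)
  bal : ∀ x, #{b ∈ B | Conn K C x (w b)} = #{r ∈ R | Conn K C x (w r)}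
  half : ∀ x, |(#{r ∈ R | Conn K C x (w r) ∧ 0 < side L (w r)} : ℤ) -
    #{b ∈ B | Conn K C x (w b) ∧ 0 < side L (w b)}| ≤ #{μ ∈ Mis | Conn K C x (pt μ (1 / 2))}

section

variable {K : ℝ} {B R : Finset Pt} {L : Pt × Pt} {W Mis M : Finset (Pt × Pt)} {φ : Pt × Pt → ℤ}
  {z : Pt → Pt}

namespace RaySys

lemma exists_samples (I : RaySys K (B ∪ R) L M (B ∪ R) z W φ Mis) (hS : Setting K (B ∪ R) L M)
    (hBR : Disjoint B R) (hM : ∀ e ∈ M, e.1 ∈ B ∧ e.2 ∈ R) :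
    ∃ w : Pt → Pt, (∀ v ∈ B ∪ R, ‖w v‖ < K ∧ 0 < side L v * side L (w v) ∧ w v ∉ solid W Mis ∧
      ∀ y ∈ cl (v, w v), y ≠ v → y ∉ solid W Mis) ∧
      ∀ h : Pt → ℤ, LC h (wallSet W) → (∀ p, Far K p → ∀ᶠ y in 𝓝 p, h y = 0) →
        ∑ r ∈ R, h (w r) - ∑ b ∈ B, h (w b) +
          ∑ μ ∈ Mis, φ μ * (hd h μ - tl h μ.swap) = 0 := by
  have hex : ∀ v : Pt, ∃ κ : Pt × Pt, v ∈ B ∪ R → (κ ∈ M ∨ κ.swap ∈ M) ∧ κ.2 = v := fun v => by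
    by_cases hv : v ∈ B ∪ R
    · obtain ⟨κ, h⟩ := hS.exists_dart_to hv
      exact ⟨κ, fun _ => h⟩
    · exact ⟨(v, v), fun h => absurd h hv⟩
  choose κ hκ using hex
  have hex' : ∀ v : Pt, ∃ w : Pt, v ∈ B ∪ R → (‖w‖ < K ∧ 0 < side L v * side L w ∧ w ∉ solid W Mis ∧
      (∀ y ∈ cl (v, w), y ≠ v → y ∉ solid W Mis)) ∧
      ∀ h, LC h (wallSet W) → (φ (κ v) * hd h (κ v) - φ (κ v).swap * tl h (κ v).swap) +
        (φ (z v, v) * hd h (z v, v) - φ (v, z v) * tl h (v, z v)) = 2 * (φ (κ v) * h w) := by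
    intro v
    by_cases hv : v ∈ B ∪ R
    · obtain ⟨h1, h2⟩ := hκ v hv
      obtain ⟨w, a1, a2, a3, a4, a5⟩ := I.exists_sample hS h1 (by rw [h2]; exact hv)
      rw [h2] at a2 a4 a5
      exact ⟨w, fun _ => ⟨⟨a1, a2, a3, a4⟩, a5⟩⟩
    · exact ⟨v, fun h => absurd h hv⟩
  choose w hw using hex'
  refine ⟨w, fun v hv => (hw v hv).1, fun h H hfar => ?_⟩
  have hbal := I.toSys.balance hS.off H hfar
  set F : Pt × Pt → ℤ := fun κ => φ κ * hd h κ - φ κ.swap * tl h κ.swap with hF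
  have hne : ∀ v ∈ B ∪ R, κ v ≠ (z v, v) := by
    intro v hv hc
    obtain ⟨h1, h2⟩ := hκ v hv
    obtain ⟨t, ht, hz⟩ := I.prolong v hv _ h1 h2
    have : pt (κ v) t = pt (κ v) 0 := by rw [← hz, pt_zero, hc]
    have := pt_injective (hS.dart_ne h1) this
    linarith
  have hfib : ∀ v ∈ B ∪ R, {τ ∈ {τ ∈ W | τ.2 ∈ B ∪ R} | τ.2 = v} = {κ v, (z v, v)} := by
    intro v hv
    obtain ⟨h1, h2⟩ := hκ v hv
    ext τ
    simp only [mem_filter, mem_insert, mem_singleton]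
    constructor
    · rintro ⟨⟨hτ, hτ2⟩, rfl⟩
      rcases I.tips τ hτ hτ2 with k | k | ⟨-, k⟩
      · exact Or.inl (hS.dart_unique (Or.inl k) h1 h2.symm)
      · exact Or.inl (hS.dart_unique (Or.inr k) h1 h2.symm)
      · exact Or.inr (Prod.ext k rfl)
    · rintro (rfl | rfl)
      · exact ⟨⟨(I.dart_mem h1).1, by rw [h2]; exact hv⟩, h2⟩
      · exact ⟨⟨I.symm _ (I.ray v hv), hv⟩, rfl⟩
  have hsum : ∑ τ ∈ W with τ.2 ∈ B ∪ R, F τ = ∑ v ∈ B ∪ R, 2 * (φ (κ v) * h (w v)) := by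
    rw [← sum_fiberwise_of_maps_to (s := {τ ∈ W | τ.2 ∈ B ∪ R}) (t := B ∪ R) (g := Prod.snd)
      (fun τ hτ => (mem_filter.1 hτ).2)]
    refine sum_congr rfl fun v hv => ?_
    rw [hfib v hv, sum_pair (hne v hv)]
    exact (hw v hv).2 h H
  rw [hsum, sum_union hBR] at hbal
  have hB : ∑ b ∈ B, 2 * (φ (κ b) * h (w b)) = - (2 * ∑ b ∈ B, h (w b)) := by
    rw [mul_sum, ← sum_neg_distrib]
    refine sum_congr rfl fun b hb => ?_
    obtain ⟨h1, h2⟩ := hκ b (mem_union_left _ hb)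
    have : κ b ∉ M := fun hc => Finset.disjoint_left.1 hBR hb (h2 ▸ (hM _ hc).2)
    rw [(I.dart_mem h1).2.2.2, if_neg this]; ring
  have hR : ∑ r ∈ R, 2 * (φ (κ r) * h (w r)) = 2 * ∑ r ∈ R, h (w r) := by
    rw [mul_sum]
    refine sum_congr rfl fun r hr => ?_
    obtain ⟨h1, h2⟩ := hκ r (mem_union_right _ hr)
    have : κ r ∈ M := by
      refine h1.resolve_right fun hc => Finset.disjoint_right.1 hBR hr ?_
      have := (hM _ hc).1
      rwa [Prod.fst_swap, h2] at this
    rw [(I.dart_mem h1).2.2.2, if_pos this]; ring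
  rw [hB, hR] at hbal
  have h3 : ∑ μ ∈ Mis, 2 * φ μ * (hd h μ - tl h μ.swap) =
      2 * ∑ μ ∈ Mis, φ μ * (hd h μ - tl h μ.swap) := by
    rw [mul_sum]; exact sum_congr rfl fun _ _ => by ring
  rw [h3] at hbal
  linarith

lemma misfit_vals (I : RaySys K (B ∪ R) L M (B ∪ R) z W φ Mis) {μ : Pt × Pt} (hμ : μ ∈ Mis)
    {h : Pt → ℤ} {c c' : ℤ} (hc : ∀ t ∈ Set.Ioo (0 : ℝ) 1, ∀ᶠ y in 𝓝 (pt μ t),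
      (0 < side μ y → h y = c) ∧ (side μ y < 0 → h y = c')) : hd h μ = c ∧ tl h μ.swap = c' := by
  have hne := I.ne _ (I.mis_sub hμ)
  constructor
  · refine hd_eq hne ?_
    filter_upwards [Ioo_mem_nhdsLT (show (0 : ℝ) < 1 by norm_num)] with t ht
    exact (hc t ht).mono fun y hy => hy.1
  · refine tl_eq hne.symm ?_
    filter_upwards [Ioo_mem_nhdsGT (show (0 : ℝ) < 1 by norm_num)] with t ht
    unfold SideVal
    rw [pt_swap]
    refine (hc (1 - t) ⟨by linarith [ht.2], by linarith [ht.1]⟩).mono fun y hy h0 => hy.2 ?_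
    rw [side_swap] at h0
    linarith

lemma exists_cellSys (I : RaySys K (B ∪ R) L M (B ∪ R) z W φ Mis) (hS : Setting K (B ∪ R) L M)
    (hBR : Disjoint B R) (hM : ∀ e ∈ M, e.1 ∈ B ∧ e.2 ∈ R) :
    ∃ C w, CellSys K L B R M C w Mis := by
  obtain ⟨w, hw, hsum⟩ := I.exists_samples hS hBR hM
  have hC : IsClosed (solid W Mis) := isClosed_solid
  have hT := I.thick hS
  have hev : ∀ x y, y ∉ solid W Mis →
      ∀ᶠ q in 𝓝 y, (Conn K (solid W Mis) x q ↔ Conn K (solid W Mis) x y) := fun x y hy =>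
    eventually_conn_iff hC hT (fun x hx => I.sphere hx) x hy
  have hmid : ∀ x, ∀ μ ∈ Mis, ∀ t ∈ Set.Ioo (0 : ℝ) 1, ∀ᶠ q in 𝓝 (pt μ t),
      (Conn K (solid W Mis) x q ↔ Conn K (solid W Mis) x (pt μ (1 / 2))) := by
    intro x μ hμ t ht
    have hd := I.rel_disjoint_solid hμ
    have hmem : ∀ s ∈ Set.Ioo (0 : ℝ) 1, pt μ s ∈ rel μ := fun s hs => ⟨s, hs, rfl⟩
    have key := LC.eq_of_preconnected (C := solid W Mis)
      (h := fun y => if Conn K (solid W Mis) x y then 1 else 0) (K := rel μ)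
      (fun q hq => (hev x q hq).mono fun y hy => by simp only [hy])
      ((convex_Ioo (0 : ℝ) 1).isPreconnected.image _ (continuous_pt μ).continuousOn)
      (fun q hq => Set.disjoint_left.1 hd hq) (hmem t ht) (hmem (1 / 2) (by norm_num))
    have key' : Conn K (solid W Mis) x (pt μ t) ↔ Conn K (solid W Mis) x (pt μ (1 / 2)) := by
      by_cases h1 : Conn K (solid W Mis) x (pt μ t) <;>
        by_cases h2 : Conn K (solid W Mis) x (pt μ (1 / 2)) <;> simp_all
    exact (hev x _ (Set.disjoint_left.1 hd (hmem t ht))).mono fun q hq => hq.trans key'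
  have hfar : ∀ p, Far K p → ∀ᶠ y in 𝓝 p, ∀ x, ¬ Conn K (solid W Mis) x y := by
    intro p hp
    rw [far_iff] at hp
    filter_upwards [continuous_norm.continuousAt.eventually (lt_mem_nhds hp)] with y hy x hc
    exact hc.2.1.not_gt hy
  refine ⟨solid W Mis, w, hC, hT, fun e he => I.cl_subset_solid (I.edge e he).1
    fun hc => hS.off _ (hS.ends e he).1 hc.1, fun v hv => (hw v hv).1, fun v hv => (hw v hv).2.2.1,
    fun v hv => (hw v hv).2.2.2, fun v hv => (hw v hv).2.1, fun x => ?_, fun x => ?_⟩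
  · have key := hsum (fun y => if Conn K (solid W Mis) x y then 1 else 0)
      (LC.mono (fun q hq => (hev x q hq).mono fun y hy => by simp only [hy]) solid_subset)
      (fun p hp => (hfar p hp).mono fun y hy => if_neg (hy x))
    have h0 : ∀ μ ∈ Mis, φ μ * (hd (fun y => if Conn K (solid W Mis) x y then 1 else 0) μ -
        tl (fun y => if Conn K (solid W Mis) x y then 1 else 0) μ.swap) = 0 := by
      intro μ hμ
      obtain ⟨h1, h2⟩ := I.misfit_vals hμ
        (h := fun y => if Conn K (solid W Mis) x y then 1 else 0)
        (c := if Conn K (solid W Mis) x (pt μ (1 / 2)) then 1 else 0)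
        (c' := if Conn K (solid W Mis) x (pt μ (1 / 2)) then 1 else 0)
        (fun t ht => (hmid x μ hμ t ht).mono fun y hy => by simp only [hy]; simp)
      rw [h1, h2, sub_self, mul_zero]
    rw [sum_eq_zero h0, add_zero, sum_boole, sum_boole] at key
    have : (#{r ∈ R | Conn K (solid W Mis) x (w r)} : ℤ) = #{b ∈ B | Conn K (solid W Mis) x (w b)} := by
      linarith
    exact_mod_cast this.symm
  · have hLC : LC (fun y => if Conn K (solid W Mis) x y ∧ 0 < side L y then (1 : ℤ) else 0)
        (wallSet W) := by
      intro q hq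
      have h1 := hev x q fun h => hq (solid_subset h)
      by_cases hc : Conn K (solid W Mis) x q
      · have hs : side L q ≠ 0 := fun h => hq (I.cover q hc.2.1 h)
        have h2 : ∀ᶠ y in 𝓝 q, (0 < side L y ↔ 0 < side L q) := by
          rcases lt_or_gt_of_ne hs with h | h
          · filter_upwards [(continuous_side L).continuousAt.eventually (gt_mem_nhds h)] with y hy
            exact ⟨fun h' => absurd hy h'.not_gt, fun h' => absurd h h'.not_gt⟩
          · filter_upwards [(continuous_side L).continuousAt.eventually (lt_mem_nhds h)] with y hy
            exact ⟨fun _ => h, fun _ => hy⟩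
        filter_upwards [h1, h2] with y a1 a2
        simp only [a1, a2]
      · filter_upwards [h1] with y a1
        simp only [a1, hc, false_and]
    have key := hsum _ hLC
      (fun p hp => (hfar p hp).mono fun y hy => if_neg fun hc => hy x hc.1)
    rw [sum_boole, sum_boole] at key
    set S := ∑ μ ∈ Mis, φ μ * (hd (fun y => if Conn K (solid W Mis) x y ∧ 0 < side L y then (1 : ℤ)
      else 0) μ - tl (fun y => if Conn K (solid W Mis) x y ∧ 0 < side L y then (1 : ℤ) else 0) μ.swap)
      with hSdef
    have hS' : |S| ≤ #{μ ∈ Mis | Conn K (solid W Mis) x (pt μ (1 / 2))} := by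
      rw [← sum_boole]
      refine (abs_sum_le_sum_abs _ _).trans (sum_le_sum fun μ hμ => ?_)
      have hφ : |φ μ| = 1 := by
        rcases I.sign μ (I.mis_sub hμ) with h | h <;> rw [h] <;> norm_num
      rw [abs_mul, hφ, one_mul]
      obtain ⟨c, hc, hside⟩ := exists_side_eq_mul hS.line (I.ne μ (I.mis_sub hμ)) (I.mis_line μ hμ).1
        (I.mis_line μ hμ).2
      by_cases hx : Conn K (solid W Mis) x (pt μ (1 / 2))
      · rw [if_pos hx]
        rcases lt_or_gt_of_ne hc with hc | hc
        · obtain ⟨h1, h2⟩ := I.misfit_vals hμ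
            (h := fun y => if Conn K (solid W Mis) x y ∧ 0 < side L y then (1 : ℤ) else 0)
            (c := 0) (c' := 1) (fun t ht => (hmid x μ hμ t ht).mono fun y hy => by
              rw [hside]
              exact ⟨fun h => if_neg fun h' => by nlinarith [h'.2],
                fun h => if_pos ⟨hy.2 hx, by nlinarith⟩⟩)
          rw [h1, h2]; norm_num
        · obtain ⟨h1, h2⟩ := I.misfit_vals hμ
            (h := fun y => if Conn K (solid W Mis) x y ∧ 0 < side L y then (1 : ℤ) else 0)
            (c := 1) (c' := 0) (fun t ht => (hmid x μ hμ t ht).mono fun y hy => by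
              rw [hside]
              exact ⟨fun h => if_pos ⟨hy.2 hx, by nlinarith⟩,
                fun h => if_neg fun h' => by nlinarith [h'.2]⟩)
          rw [h1, h2]; norm_num
      · rw [if_neg hx]
        obtain ⟨h1, h2⟩ := I.misfit_vals hμ
            (h := fun y => if Conn K (solid W Mis) x y ∧ 0 < side L y then (1 : ℤ) else 0)
            (c := 0) (c' := 0) (fun t ht => (hmid x μ hμ t ht).mono fun y hy => by
              simp only [hy, hx, false_and]; simp)
        rw [h1, h2]; norm_num
    refine le_trans (le_of_eq ?_) hS'
    rw [← abs_neg]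
    congr 1
    linarith

end RaySys

end

section

/-- Among the bijections between two fibered types, there is one that cannot be improved by an
exchange inside a fiber. -/
lemma exists_opt_equiv {α β γ : Type*} [Fintype α] [Fintype β] (f : α → γ) (g : β → γ)
    (hfg : ∀ c, Fintype.card {a // f a = c} = Fintype.card {b // g b = c})
    (N : α → β → ℕ) (l : α → β → ℝ) :
    ∃ σ : α ≃ β, (∀ a, g (σ a) = f a) ∧ ∀ a a', a ≠ a' → f a = f a' →
      N a (σ a) + N a' (σ a') < N a (σ a') + N a' (σ a) ∨
      N a (σ a) + N a' (σ a') = N a (σ a') + N a' (σ a) ∧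
        l a (σ a) + l a' (σ a') ≤ l a (σ a') + l a' (σ a) := by
  have hne : Nonempty {σ : α ≃ β // ∀ a, g (σ a) = f a} :=
    ⟨Equiv.ofFiberEquiv fun c => Fintype.equivOfCardEq (hfg c), fun a => Equiv.ofFiberEquiv_map _ a⟩
  obtain ⟨⟨σ, hσ⟩, hmin⟩ := Finite.exists_min fun σ : {σ : α ≃ β // ∀ a, g (σ a) = f a} =>
    toLex (∑ a, N a (σ.1 a), ∑ a, l a (σ.1 a))
  refine ⟨σ, hσ, fun a a' hne hf => ?_⟩
  have hswap : ∀ {A : Type} [AddCommMonoid A] (m : α → β → A),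
      ∑ x, m x (σ (Equiv.swap a a' x)) + (m a (σ a) + m a' (σ a')) =
        ∑ x, m x (σ x) + (m a (σ a') + m a' (σ a)) := by
    intro A _ m
    have h1 : ∀ k : α → A, ∑ x, k x = k a + k a' + ∑ x ∈ univ \ {a, a'}, k x := fun k => by
      rw [← sum_pair hne, add_comm, sum_sdiff (subset_univ _)]
    rw [h1 fun x => m x (σ (Equiv.swap a a' x)), h1 fun x => m x (σ x), Equiv.swap_apply_left,
      Equiv.swap_apply_right]
    have h2 : ∑ x ∈ univ \ {a, a'}, m x (σ (Equiv.swap a a' x)) = ∑ x ∈ univ \ {a, a'}, m x (σ x) := by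
      refine sum_congr rfl fun x hx => ?_
      rw [Finset.mem_sdiff, Finset.mem_insert, Finset.mem_singleton, not_or] at hx
      rw [Equiv.swap_apply_of_ne_of_ne hx.2.1 hx.2.2]
    rw [h2]
    abel
  have := hmin ⟨(Equiv.swap a a').trans σ, fun x => by
    rw [Equiv.trans_apply, hσ]
    rcases eq_or_ne x a with rfl | h
    · rw [Equiv.swap_apply_left, hf]
    rcases eq_or_ne x a' with rfl | h'
    · rw [Equiv.swap_apply_right, hf]
    · rw [Equiv.swap_apply_of_ne_of_ne h h']⟩
  rw [Prod.Lex.toLex_le_toLex] at this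
  have e1 := hswap N
  have e2 := hswap l
  simp only [Equiv.trans_apply] at this
  rcases this with h | ⟨h, h'⟩
  · left; omega
  · right; exact ⟨by omega, by linarith⟩

/-- The Euclidean distance in the plane. -/
noncomputable def len (p q : Pt) : ℝ := dist (⟨p.1, p.2⟩ : ℂ) ⟨q.1, q.2⟩

lemma len_triangle (p q r : Pt) : len p r ≤ len p q + len q r := dist_triangle _ _ _

lemma len_add_len (κ : Pt × Pt) {t : ℝ} (ht : t ∈ Set.Icc (0 : ℝ) 1) :
    len κ.1 (pt κ t) + len (pt κ t) κ.2 = len κ.1 κ.2 := by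
  refine dist_add_dist_eq_iff.2 ⟨t, ht, ?_⟩
  apply Complex.ext <;> simp [AffineMap.lineMap_apply, pt_fst, pt_snd] <;> ring

lemma len_lt {p q r : Pt} {κ : Pt × Pt} (hp : side κ p = 0) (hq : side κ q = 0) (hpq : q ≠ p)
    (hr : side κ r ≠ 0) : len p r < len p q + len q r := by
  refine lt_of_le_of_ne (len_triangle p q r) fun h => ?_
  obtain ⟨t, -, ht⟩ := dist_add_dist_eq_iff.1 h.symm
  have hq' : q = pt (p, r) t := by
    have h1 := congrArg Complex.re ht
    have h2 := congrArg Complex.im ht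
    simp only [AffineMap.lineMap_apply, vsub_eq_sub, vadd_eq_add, Complex.add_re, Complex.add_im,
      Complex.real_smul, Complex.mul_re, Complex.mul_im, Complex.ofReal_re, Complex.ofReal_im,
      Complex.sub_re, Complex.sub_im] at h1 h2
    apply Prod.ext
    · rw [pt_fst]; simp only; linarith
    · rw [pt_snd]; simp only; linarith
  rw [hq', side_pt, hp, mul_zero, zero_add] at hq
  have : t = 0 := (mul_eq_zero.1 hq).resolve_right hr
  rw [this, pt_zero] at hq'
  exact hpq hq'

/-- Uncrossing two segments shortens them. -/
lemma len_uncross {e e' : Pt × Pt} {x : Pt} (hx : x ∈ rel e) (hx' : x ∈ rel e') (he : e.1 ≠ e.2)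
    (h : side e e'.2 ≠ 0) : len e.1 e'.2 + len e'.1 e.2 < len e.1 e.2 + len e'.1 e'.2 := by
  obtain ⟨t, ht, rfl⟩ := hx
  obtain ⟨t', ht', hx'⟩ := hx'
  have h1 := len_add_len e ⟨ht.1.le, ht.2.le⟩
  have h2 := len_add_len e' ⟨ht'.1.le, ht'.2.le⟩
  have h3 : len e.1 e'.2 < len e.1 (pt e t) + len (pt e t) e'.2 := by
    refine len_lt (side_fst e) (side_pt_self e t) (fun hc => ?_) h
    rw [← pt_zero e] at hc
    exact ht.1.ne' (pt_injective he (hc.trans (by rw [pt_zero])))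
  have h4 := len_triangle e'.1 (pt e t) e.2
  rw [hx'] at h2
  linarith

lemma exists_mem_rel_of_cuts {e e' : Pt × Pt} (h : Cuts e e') (h' : Cuts e' e) :
    ∃ x, x ∈ rel e ∧ x ∈ rel e' := by
  obtain ⟨x, hx, hx0⟩ := h.exists_mem_rel
  have he : e.1 ≠ e.2 := by
    intro hc
    unfold Cuts at h'
    rw [hc] at h'
    nlinarith [mul_self_nonneg (side e' e.2)]
  obtain ⟨t, rfl⟩ := exists_pt_of_side_eq_zero he hx0
  refine ⟨_, ⟨t, ?_, rfl⟩, hx⟩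
  have h1 : side e' (pt e t) = 0 := by
    obtain ⟨s, -, hs⟩ := hx
    rw [← hs, side_pt_self]
  rw [side_pt] at h1
  unfold Cuts at h'
  by_contra hc
  rw [Set.mem_Ioo, not_and_or, not_lt, not_lt] at hc
  have h2 : (1 - t) * side e' e.1 ^ 2 + t * (side e' e.1 * side e' e.2) = 0 := by
    linear_combination side e' e.1 * h1
  have h3 : (1 - t) * (side e' e.1 * side e' e.2) + t * side e' e.2 ^ 2 = 0 := by
    linear_combination side e' e.2 * h1
  rcases hc with hc | hc
  · have : 0 < side e' e.1 ^ 2 := sq_pos_of_ne_zero fun h0 => by rw [h0] at h'; simp at h'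
    nlinarith
  · have : 0 < side e' e.2 ^ 2 := sq_pos_of_ne_zero fun h0 => by rw [h0] at h'; simp at h'
    nlinarith

lemma cuts_of_mem {e e' : Pt × Pt} {x : Pt} (hx : side e x = 0) (hx' : x ∈ cl e')
    (h1 : side e e'.1 ≠ 0) (h2 : side e e'.2 ≠ 0) : Cuts e e' := by
  obtain ⟨t, ht, rfl⟩ := hx'
  rw [side_pt] at hx
  unfold Cuts
  by_contra hc
  have h3 : 0 < side e e'.1 * side e e'.2 := lt_of_le_of_ne (not_lt.1 hc) (mul_ne_zero h1 h2).symm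
  have h4 : (1 - t) * side e e'.1 ^ 2 + t * (side e e'.1 * side e e'.2) = 0 := by
    linear_combination side e e'.1 * hx
  have h5 : 0 < side e e'.1 ^ 2 := by positivity
  rcases ht.1.eq_or_lt with h | h
  · rw [← h] at h4; linarith
  · nlinarith [mul_pos h h3, mul_nonneg (sub_nonneg.2 ht.2) h5.le]

lemma eventually_cuts {f g f' g' : ℝ → Pt} (hf : Continuous f) (hg : Continuous g)
    (hf' : Continuous f') (hg' : Continuous g') (h : Cuts (f 0, g 0) (f' 0, g' 0)) :
    ∀ᶠ ε in 𝓝 (0 : ℝ), Cuts (f ε, g ε) (f' ε, g' ε) := by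
  unfold Cuts at h ⊢
  simp only [side_eq] at h ⊢
  refine ContinuousAt.eventually_lt (Continuous.continuousAt ?_) continuousAt_const h
  fun_prop

end

section

variable {K : ℝ} {B R : Finset Pt} {L : Pt × Pt} {M Mis : Finset (Pt × Pt)} {C : Set Pt}
  {w : Pt → Pt}

lemma card_univ_filter_coe (S : Finset Pt) (p : Pt → Prop) [DecidablePred p] :
    #{b : S | p b} = #{b ∈ S | p b} := by
  rw [card_filter, card_filter]
  exact sum_coe_sort S fun b => if p b then 1 else 0

namespace CellSys

lemma mem_cell (X : CellSys K L B R M C w Mis) {v : Pt} (hv : v ∈ B ∪ R) (hvK : ‖v‖ < K) {ε : ℝ}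
    (h0 : 0 < ε) (h1 : ε < 1) : pt (v, w v) ε ∈ cell K C (w v) := by
  have hcl : cl (w v, pt (v, w v) ε) = pt (v, w v) '' Set.Icc ε 1 := by
    rw [← cl_pt (v, w v) h1, pt_one, ← cl_swap]; rfl
  have hb : ∀ y ∈ cl (v, w v), ‖y‖ < K := fun y hy => norm_lt_of_mem_cl hvK (X.inside v hv) hy
  refine ⟨X.inside v hv, hb _ ⟨ε, ⟨h0.le, h1.le⟩, rfl⟩, ?_⟩
  rw [hcl, Set.disjoint_left]
  rintro _ ⟨s, hs, rfl⟩
  by_cases hne : v = w v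
  · have : pt (v, w v) s = w v := by rw [← hne]; simp [pt]
    rw [this]
    exact X.notMem v hv
  · refine X.free v hv _ ⟨s, ⟨h0.le.trans hs.1, hs.2⟩, rfl⟩ fun hc => ?_
    have h2 : pt (v, w v) s = pt (v, w v) 0 := by rw [hc, pt_zero]
    have := pt_injective (κ := (v, w v)) hne h2
    linarith [hs.1]

lemma cell_eq_of_cuts (X : CellSys K L B R M C w Mis) (hb : ∀ v ∈ B ∪ R, ‖v‖ < K) {e e' : Pt × Pt}
    (h1 : e.1 ∈ B ∪ R) (h2 : e.2 ∈ B ∪ R) (h1' : e'.1 ∈ B ∪ R) (h2' : e'.2 ∈ B ∪ R)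
    (he : cell K C (w e.1) = cell K C (w e.2)) (he' : cell K C (w e'.1) = cell K C (w e'.2))
    (h : Cuts e e') (h' : Cuts e' e) : cell K C (w e.1) = cell K C (w e'.1) := by
  have hc : ∀ v : Pt, Continuous (pt (v, w v)) := fun v => continuous_pt _
  have e1 := eventually_cuts (hc e.1) (hc e.2) (hc e'.1) (hc e'.2) (by simpa only [pt_zero] using h)
  have e2 := eventually_cuts (hc e'.1) (hc e'.2) (hc e.1) (hc e.2) (by simpa only [pt_zero] using h')
  obtain ⟨ε, ⟨k1, k2⟩, k3⟩ := (((e1.and e2).filter_mono nhdsWithin_le_nhds).and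
    (Ioo_mem_nhdsGT (show (0 : ℝ) < 1 by norm_num))).exists
  obtain ⟨x, hx, hx'⟩ := exists_mem_rel_of_cuts k1 k2
  have hmem : ∀ {v : Pt}, v ∈ B ∪ R → pt (v, w v) ε ∈ cell K C (w v) := fun hv =>
    X.mem_cell hv (hb _ hv) k3.1 k3.2
  have a1 : x ∈ cell K C (w e.1) := convex_cl (convex_cell X.closed X.thick _) (hmem h1)
    (by rw [he]; exact hmem h2) (rel_subset_cl _ hx)
  have a2 : x ∈ cell K C (w e'.1) := convex_cl (convex_cell X.closed X.thick _) (hmem h1')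
    (by rw [he']; exact hmem h2') (rel_subset_cl _ hx')
  exact (cell_eq X.closed X.thick a1).trans (cell_eq X.closed X.thick a2).symm

lemma not_cuts (X : CellSys K L B R M C w Mis) (hb : ∀ v ∈ B ∪ R, ‖v‖ < K) {e e' : Pt × Pt}
    (hM : e ∈ M) (h1' : e'.1 ∈ B ∪ R) (h2' : e'.2 ∈ B ∪ R)
    (he' : cell K C (w e'.1) = cell K C (w e'.2)) (h : Cuts e e') (h' : Cuts e' e) : False := by
  have hc : ∀ v : Pt, Continuous (pt (v, w v)) := fun v => continuous_pt _
  have e1 := eventually_cuts (continuous_const (y := e.1)) (continuous_const (y := e.2))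
    (hc e'.1) (hc e'.2) (by simpa only [pt_zero] using h)
  have e2 := eventually_cuts (hc e'.1) (hc e'.2) (continuous_const (y := e.1))
    (continuous_const (y := e.2)) (by simpa only [pt_zero] using h')
  obtain ⟨ε, ⟨k1, k2⟩, k3⟩ := (((e1.and e2).filter_mono nhdsWithin_le_nhds).and
    (Ioo_mem_nhdsGT (show (0 : ℝ) < 1 by norm_num))).exists
  obtain ⟨x, hx, hx'⟩ := exists_mem_rel_of_cuts k1 k2
  have hmem : ∀ {v : Pt}, v ∈ B ∪ R → pt (v, w v) ε ∈ cell K C (w v) := fun hv =>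
    X.mem_cell hv (hb _ hv) k3.1 k3.2
  have a2 : x ∈ cell K C (w e'.1) := convex_cl (convex_cell X.closed X.thick _) (hmem h1')
    (by rw [he']; exact hmem h2') (rel_subset_cl _ hx')
  exact Conn.notMem a2 (X.edges e hM (rel_subset_cl _ hx))

lemma card_cell (X : CellSys K L B R M C w Mis) (A : Set Pt) :
    #{b ∈ B | cell K C (w b) = A} = #{r ∈ R | cell K C (w r) = A} := by
  have key : ∀ v ∈ B ∪ R, cell K C (w v) = A →
      #{b ∈ B | cell K C (w b) = A} = #{r ∈ R | cell K C (w r) = A} := by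
    rintro v hv rfl
    have hiff : ∀ u ∈ B ∪ R, cell K C (w u) = cell K C (w v) ↔ Conn K C (w v) (w u) := fun u hu => by
      rw [conn_iff X.closed X.thick (X.inside u hu) (X.notMem u hu), eq_comm]
    rw [filter_congr fun u hu => hiff u (mem_union_left _ hu),
      filter_congr (s := R) fun u hu => hiff u (mem_union_right _ hu), X.bal]
  by_cases h : ∃ v ∈ B ∪ R, cell K C (w v) = A
  · obtain ⟨v, hv, h⟩ := h
    exact key v hv h
  · push Not at h
    rw [filter_false_of_mem fun b hb => h b (mem_union_left _ hb),
      filter_false_of_mem fun b hb => h b (mem_union_right _ hb)]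

/-- If in each cell all cutting edges are oriented the same way, there are at most as many of them
as there are misfits. -/
lemma card_cuts_le (X : CellSys K L B R M C w Mis) (hoff : ∀ v ∈ B ∪ R, side L v ≠ 0) (σ : B ≃ R)
    (hσ : ∀ b, cell K C (w (σ b)) = cell K C (w b))
    (hor : ∀ b b' : B, cell K C (w b) = cell K C (w b') → Cuts L (b.1, (σ b).1) →
      Cuts L (b'.1, (σ b').1) → 0 < side L b.1 * side L b'.1) :
    #{b : B | Cuts L (b.1, (σ b).1)} ≤ #Mis := by
  have hloc : ∀ a : B, #{b : B | Cuts L (b.1, (σ b).1) ∧ cell K C (w b) = cell K C (w a)} ≤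
      #{μ ∈ Mis | cell K C (pt μ (1 / 2)) = cell K C (w a)} := by
    intro a
    have hiff : ∀ u ∈ B ∪ R, ((cell K C (w u) = cell K C (w a) ∧ 0 < side L u) ↔
        (Conn K C (w a) (w u) ∧ 0 < side L (w u))) := fun u hu => by
      rw [conn_iff X.closed X.thick (X.inside u hu) (X.notMem u hu), eq_comm]
      have := X.same_side u hu
      exact and_congr_right fun _ =>
        ⟨fun h => pos_of_mul_pos_right this h.le, fun h => pos_of_mul_pos_left this h.le⟩
    have hhalf := X.half (w a)
    rw [← filter_congr fun u hu => hiff u (mem_union_left _ hu),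
      ← filter_congr (s := R) fun u hu => hiff u (mem_union_right _ hu),
      ← card_univ_filter_coe B, ← card_univ_filter_coe R] at hhalf
    have hR : #{r : R | cell K C (w r) = cell K C (w a) ∧ 0 < side L r.1} =
        #{b : B | cell K C (w b) = cell K C (w a) ∧ 0 < side L (σ b).1} := by
      rw [card_filter, card_filter, ← Equiv.sum_comp σ]
      simp only [hσ]
    rw [hR] at hhalf
    have hle : (#{μ ∈ Mis | Conn K C (w a) (pt μ (1 / 2))} : ℤ) ≤
        #{μ ∈ Mis | cell K C (pt μ (1 / 2)) = cell K C (w a)} := by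
      exact_mod_cast card_le_card (monotone_filter_right _ fun μ _ h =>
        (cell_eq X.closed X.thick h).symm)
    have hsub : ∀ b : B, (Cuts L (b.1, (σ b).1) ↔ ¬ (0 < side L b.1 ↔ 0 < side L (σ b).1)) := by
      intro b
      have h1 := hoff b.1 (mem_union_left _ b.2)
      have h2 := hoff (σ b).1 (mem_union_right _ (σ b).2)
      unfold Cuts
      rcases lt_or_gt_of_ne h1 with h1 | h1 <;> rcases lt_or_gt_of_ne h2 with h2 | h2
      · simp [h1.not_gt, h2.not_gt, (mul_pos_of_neg_of_neg h1 h2).not_gt]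
      · simp [h1.not_gt, h2, mul_neg_of_neg_of_pos h1 h2]
      · simp [h1, h2.not_gt, mul_neg_of_pos_of_neg h1 h2]
      · simp [h1, h2, (mul_pos h1 h2).not_gt]
    have hcard : (#{b : B | Cuts L (b.1, (σ b).1) ∧ cell K C (w b) = cell K C (w a)} : ℤ) ≤
        |(#{b : B | cell K C (w b) = cell K C (w a) ∧ 0 < side L (σ b).1} : ℤ) -
          #{b : B | cell K C (w b) = cell K C (w a) ∧ 0 < side L b.1}| := by
      rw [← sum_boole, ← sum_boole, ← sum_boole, ← sum_sub_distrib]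
      by_cases hex : ∃ b : B, (Cuts L (b.1, (σ b).1) ∧ cell K C (w b) = cell K C (w a)) ∧ 0 < side L b.1
      · obtain ⟨b, ⟨hb1, hb2⟩, hb3⟩ := hex
        refine le_trans ?_ (neg_le_abs _)
        rw [← sum_neg_distrib]
        refine sum_le_sum fun b' _ => ?_
        by_cases h1 : cell K C (w b') = cell K C (w a)
        swap
        · simp [h1]
        by_cases h2 : Cuts L (b'.1, (σ b').1)
        · have h3 := hor b b' (hb2.trans h1.symm) hb1 h2
          have h4 : 0 < side L b'.1 := pos_of_mul_pos_right h3 hb3.le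
          have h5 := (hsub b').1 h2
          have h6 : ¬ 0 < side L (σ b').1 := fun h => h5 ⟨fun _ => h, fun _ => h4⟩
          simp [h1, h2, h4, h6]
        · have h5 := not_not.1 (mt (hsub b').2 h2)
          simp [h1, h2, h5]
      · push Not at hex
        refine le_trans ?_ (le_abs_self _)
        refine sum_le_sum fun b' _ => ?_
        by_cases h1 : cell K C (w b') = cell K C (w a)
        swap
        · simp [h1]
        by_cases h2 : Cuts L (b'.1, (σ b').1)
        · have h4 := (hex b' ⟨h2, h1⟩).not_gt
          have h5 := (hsub b').1 h2
          have h6 : 0 < side L (σ b').1 := by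
            by_contra h
            exact h5 ⟨fun k => absurd k h4, fun k => absurd k h⟩
          simp [h1, h2, h4, h6]
        · have h5 := not_not.1 (mt (hsub b').2 h2)
          simp [h1, h2, h5]
    exact_mod_cast hcard.trans (hhalf.trans hle)
  calc #{b : B | Cuts L (b.1, (σ b).1)}
      = ∑ A ∈ univ.image fun b : B => cell K C (w b),
          #((univ.filter fun b : B => Cuts L (b.1, (σ b).1)).filter fun b : B => cell K C (w b) = A) :=
        card_eq_sum_card_fiberwise fun b _ => mem_image_of_mem _ (mem_univ b)
    _ ≤ ∑ A ∈ univ.image fun b : B => cell K C (w b), #{μ ∈ Mis | cell K C (pt μ (1 / 2)) = A} := by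
        refine sum_le_sum fun A hA => ?_
        obtain ⟨a, -, rfl⟩ := mem_image.1 hA
        rw [filter_filter]
        exact hloc a
    _ ≤ #Mis := by
        rw [sum_card_fiberwise_eq_card_filter]
        exact card_filter_le _ _

end CellSys

end

section

variable {K : ℝ} {B R : Finset Pt} {L : Pt × Pt} {M Mis : Finset (Pt × Pt)} {C : Set Pt}
  {w : Pt → Pt}

lemma Setting.side_ne_of_ne (hS : Setting K (B ∪ R) L M) (hBR : Disjoint B R) {b r : Pt} (hb : b ∈ B)
    (hr : r ∈ R) {v : Pt} (hv : v ∈ B ∪ R) (h1 : v ≠ b) (h2 : v ≠ r) : side (b, r) v ≠ 0 :=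
  hS.gen b (mem_union_left _ hb) r (mem_union_right _ hr) v hv (hBR.forall_ne_finset hb hr)
    h1.symm h2.symm

/-- Two segments with four different endpoints in general position cross properly if they meet. -/
lemma Setting.cuts (hS : Setting K (B ∪ R) L M) (hBR : Disjoint B R) {b r b' r' x : Pt} (hb : b ∈ B)
    (hr : r ∈ R) (hb' : b' ∈ B) (hr' : r' ∈ R) (hbb : b ≠ b') (hrr : r ≠ r') (hx : x ∈ cl (b, r))
    (hx' : x ∈ cl (b', r')) : Cuts (b, r) (b', r') := by
  refine cuts_of_mem (x := x) ?_ hx' ?_ ?_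
  · obtain ⟨t, -, rfl⟩ := hx
    exact side_pt_self _ t
  · exact hS.side_ne_of_ne hBR hb hr (mem_union_left _ hb') hbb.symm (hBR.forall_ne_finset hb' hr)
  · exact hS.side_ne_of_ne hBR hb hr (mem_union_right _ hr') (hBR.forall_ne_finset hb hr').symm hrr.symm

lemma eq_of_mem_cl_of_mem_cl {p q q' x : Pt} (h : side (p, q) q' ≠ 0) (hx : x ∈ cl (p, q))
    (hx' : x ∈ cl (p, q')) : x = p := by
  obtain ⟨t, -, rfl⟩ := hx
  obtain ⟨s, -, hs⟩ := hx'
  have h1 := side_pt_self (p, q) t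
  rw [← hs, side_pt, side_fst (p, q), mul_zero, zero_add] at h1
  rw [(mul_eq_zero.1 h1).resolve_right h, pt_zero] at hs
  exact hs.symm

lemma not_cuts_iff {e : Pt × Pt} (h1 : side L e.1 ≠ 0) (h2 : side L e.2 ≠ 0) :
    ¬ Cuts L e ↔ 0 < side L e.1 * side L e.2 := by
  unfold Cuts
  rw [not_lt]
  exact ⟨fun h => lt_of_le_of_ne h (mul_ne_zero h1 h2).symm, le_of_lt⟩

lemma mul_neg_iff_of_ne {u v : ℝ} (hu : u ≠ 0) (hv : v ≠ 0) : u * v < 0 ↔ ¬ (0 < u ↔ 0 < v) := by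
  rcases lt_or_gt_of_ne hu with h1 | h1 <;> rcases lt_or_gt_of_ne hv with h2 | h2
  · simp [h1.not_gt, h2.not_gt, (mul_pos_of_neg_of_neg h1 h2).le]
  · simp [h1.not_gt, h2, mul_neg_of_neg_of_pos h1 h2]
  · simp [h1, h2.not_gt, mul_neg_of_pos_of_neg h1 h2]
  · simp [h1, h2, (mul_pos h1 h2).le]

lemma card_cuts_exchange {p q r s : ℝ} (hp : p ≠ 0) (hq : q ≠ 0) (hr : r ≠ 0) (hs : s ≠ 0)
    (h : ¬ p * q < 0 → ¬ r * s < 0 → 0 < p * r) :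
    (if p * s < 0 then 1 else 0) + (if r * q < 0 then 1 else 0) ≤
      (if p * q < 0 then 1 else 0) + if r * s < 0 then 1 else 0 := by
  replace h : ¬ p * q < 0 → ¬ r * s < 0 → ¬ p * r < 0 := fun h1 h2 => (h h1 h2).not_gt
  rw [mul_neg_iff_of_ne hp hq, mul_neg_iff_of_ne hr hs, mul_neg_iff_of_ne hp hr] at h
  simp only [mul_neg_iff_of_ne hp hq, mul_neg_iff_of_ne hr hs, mul_neg_iff_of_ne hp hs,
    mul_neg_iff_of_ne hr hq]
  by_cases a1 : 0 < p <;> by_cases a2 : 0 < q <;> by_cases a3 : 0 < r <;> by_cases a4 : 0 < s <;>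
    simp [a1, a2, a3, a4] at h ⊢

/-- Two segments that do not cut the line and meet are on the same side of it. -/
lemma side_mul_side_pos {e e' : Pt × Pt} {x : Pt} (he : side L e.1 ≠ 0) (he' : side L e'.1 ≠ 0)
    (h : 0 < side L e.1 * side L e.2) (h' : 0 < side L e'.1 * side L e'.2) (hx : x ∈ cl e)
    (hx' : x ∈ cl e') : 0 < side L e.1 * side L e'.1 := by
  have key : ∀ {e : Pt × Pt}, side L e.1 ≠ 0 → 0 < side L e.1 * side L e.2 → x ∈ cl e →
      0 < side L e.1 * side L x := by
    rintro e he h ⟨t, ht, rfl⟩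
    rw [side_pt]
    have := mul_self_pos.2 he
    rcases ht.1.eq_or_lt with h0 | h0
    · rw [← h0]; linarith
    · nlinarith [mul_pos h0 h, mul_nonneg (sub_nonneg.2 ht.2) this.le]
  have := mul_pos (key he h hx) (key he' h' hx')
  rw [mul_mul_mul_comm] at this
  exact pos_of_mul_pos_left this (mul_self_nonneg _)

lemma CellSys.exists_equiv (X : CellSys K L B R M C w Mis) (hS : Setting K (B ∪ R) L M)
    (hBR : Disjoint B R) (hM : ∀ e ∈ M, e.1 ∈ B ∧ e.2 ∈ R) :
    ∃ σ : B ≃ R, (∀ b b', b ≠ b' → Disjoint (cl (b.1, (σ b).1)) (cl (b'.1, (σ b').1))) ∧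
      #{b : B | Cuts L (b.1, (σ b).1)} ≤ #Mis ∧
      ∀ e ∈ M, ∀ b : B, ∀ x, x ∈ cl e → x ∈ cl (b.1, (σ b).1) → e = (b.1, (σ b).1) ∨
        (x = e.1 ∧ x = b.1) ∨ (x = e.2 ∧ x = (σ b).1) := by
  obtain ⟨σ, hσ, hopt⟩ := exists_opt_equiv (fun b : B => cell K C (w b)) (fun r : R => cell K C (w r))
    (fun A => by
      rw [Fintype.card_subtype, Fintype.card_subtype,
        card_univ_filter_coe B fun v => cell K C (w v) = A,
        card_univ_filter_coe R fun v => cell K C (w v) = A, X.card_cell])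
    (fun b r => if Cuts L (b.1, r.1) then 1 else 0) (fun b r => len b r)
  have hbB : ∀ b : B, b.1 ∈ B ∪ R := fun b => mem_union_left _ b.2
  have hrR : ∀ r : R, r.1 ∈ B ∪ R := fun r => mem_union_right _ r.2
  have hoffB := fun b : B => hS.off b.1 (hbB b)
  have hoffR := fun r : R => hS.off r.1 (hrR r)
  refine ⟨σ, fun b b' hne => ?_, X.card_cuts_le hS.off σ hσ fun b b' hbb h h' => ?_,
    fun e he b x hx hx' => ?_⟩
  · rw [Set.disjoint_left]
    intro x hx hx'
    have hbb : b.1 ≠ b'.1 := fun h => hne (Subtype.ext h)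
    have hrr : (σ b).1 ≠ (σ b').1 := fun h => hne (σ.injective (Subtype.ext h))
    have c1 := hS.cuts hBR b.2 (σ b).2 b'.2 (σ b').2 hbb hrr hx hx'
    have c2 := hS.cuts hBR b'.2 (σ b').2 b.2 (σ b).2 hbb.symm hrr.symm hx' hx
    have hcell := X.cell_eq_of_cuts hS.bound (e := (b.1, (σ b).1)) (e' := (b'.1, (σ b').1))
      (hbB b) (hrR _) (hbB b') (hrR _) (hσ b).symm (hσ b').symm c1 c2
    obtain ⟨y, hy, hy'⟩ := exists_mem_rel_of_cuts c1 c2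
    have hlen := len_uncross hy hy' (hBR.forall_ne_finset b.2 (σ b).2)
      (right_ne_zero_of_mul (ne_of_lt c1))
    have hcross : ¬ Cuts L (b.1, (σ b).1) → ¬ Cuts L (b'.1, (σ b').1) →
        0 < side L b.1 * side L b'.1 := by
      rw [not_cuts_iff (hoffB _) (hoffR _), not_cuts_iff (hoffB _) (hoffR _)]
      exact fun h1 h2 => side_mul_side_pos (hoffB b) (hoffB b') h1 h2 (rel_subset_cl _ hy)
        (rel_subset_cl _ hy')
    have hcount : (if Cuts L (b.1, (σ b').1) then 1 else 0) + (if Cuts L (b'.1, (σ b).1) then 1 else 0) ≤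
        (if Cuts L (b.1, (σ b).1) then 1 else 0) + if Cuts L (b'.1, (σ b').1) then 1 else 0 := by
      exact card_cuts_exchange (hoffB b) (hoffR _) (hoffB b') (hoffR _) hcross
    rcases hopt b b' hne hcell with h | ⟨-, h⟩
    · exact absurd hcount (not_le.2 h)
    · exact absurd hlen (not_lt.2 h)
  · by_contra hneg
    have hneg' : side L b.1 * side L b'.1 < 0 :=
      lt_of_le_of_ne (not_lt.1 hneg) (mul_ne_zero (hoffB b) (hoffB b'))
    have hne : b ≠ b' := by
      rintro rfl
      exact hneg'.not_ge (mul_self_nonneg _)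
    have hflip : ∀ {u v t : ℝ}, u * v < 0 → v * t < 0 → ¬ u * t < 0 := by
      intro u v t h1 h2 h3
      have : 0 < (u * v) * (v * t) := mul_pos_of_neg_of_neg h1 h2
      nlinarith [mul_self_nonneg v]
    have n1 : ¬ Cuts L (b.1, (σ b').1) := hflip hneg' h'
    have n2 : ¬ Cuts L (b'.1, (σ b).1) := hflip (by rw [mul_comm]; exact hneg') h
    rcases hopt b b' hne hbb with k | ⟨k, -⟩
    · rw [if_pos h, if_pos h', if_neg n1, if_neg n2] at k
      omega
    · rw [if_pos h, if_pos h', if_neg n1, if_neg n2] at k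
      omega
  · obtain ⟨hB, hR⟩ := hM e he
    by_cases h1 : e.1 = b.1 <;> by_cases h2 : e.2 = (σ b).1
    · exact Or.inl (Prod.ext h1 h2)
    · right; left
      have : x = e.1 := by
        refine eq_of_mem_cl_of_mem_cl (q := e.2) (q' := (σ b).1) ?_ hx (by rw [h1]; exact hx')
        exact hS.side_ne_of_ne hBR hB hR (hrR _) (hBR.forall_ne_finset hB (σ b).2).symm (Ne.symm h2)
      exact ⟨this, this.trans h1⟩
    · right; right
      have : x = e.2 := by
        refine eq_of_mem_cl_of_mem_cl (q := e.1) (q' := b.1) ?_ (by rw [← cl_swap] at hx; exact hx)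
          (by rw [h2, ← cl_swap]; exact hx')
        have := hS.side_ne_of_ne hBR hB hR (hbB b) (Ne.symm h1) (hBR.forall_ne_finset b.2 hR)
        rw [show (e.2, e.1) = Prod.swap (e.1, e.2) from rfl, side_swap]
        exact neg_ne_zero.2 this
      exact ⟨this, this.trans h2⟩
    · have c1 := hS.cuts hBR hB hR b.2 (σ b).2 h1 h2 hx hx'
      have c2 := hS.cuts hBR b.2 (σ b).2 hB hR (Ne.symm h1) (Ne.symm h2) hx' hx
      exact (X.not_cuts hS.bound he (hbB b) (hrR _) (hσ b).symm c1 c2).elim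

end

section

variable {B R : Finset Pt} {L : Pt × Pt} {M : Finset (Pt × Pt)}

/-- Two points of the line `a * x + b * y = c`. -/
noncomputable def lineBase (a b c : ℝ) : Pt × Pt :=
  ((a * c / (a ^ 2 + b ^ 2), b * c / (a ^ 2 + b ^ 2)),
    (a * c / (a ^ 2 + b ^ 2) + b, b * c / (a ^ 2 + b ^ 2) - a))

lemma sq_add_sq_ne_zero {a b : ℝ} (h : (a, b) ≠ ((0 : ℝ), (0 : ℝ))) : a ^ 2 + b ^ 2 ≠ 0 := by
  intro hc
  refine h (Prod.ext ?_ ?_)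
  · simp only; nlinarith [sq_nonneg a, sq_nonneg b]
  · simp only; nlinarith [sq_nonneg a, sq_nonneg b]

lemma side_lineBase {a b c : ℝ} (h : (a, b) ≠ ((0 : ℝ), (0 : ℝ))) (q : Pt) :
    side (lineBase a b c) q = a * q.1 + b * q.2 - c := by
  have := sq_add_sq_ne_zero h
  rw [side_eq, lineBase]
  field_simp
  ring

lemma lineBase_ne {a b c : ℝ} (h : (a, b) ≠ ((0 : ℝ), (0 : ℝ))) :
    (lineBase a b c).1 ≠ (lineBase a b c).2 := by
  intro hc
  rw [lineBase, Prod.ext_iff] at hc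
  simp only at hc
  exact h (Prod.ext (by simp only; linarith [hc.2]) (by simp only; linarith [hc.1]))

lemma crosses_iff {a b c : ℝ} (h : (a, b) ≠ ((0 : ℝ), (0 : ℝ))) {e : Pt × Pt}
    (h1 : side (lineBase a b c) e.1 ≠ 0) (h2 : side (lineBase a b c) e.2 ≠ 0) :
    Crosses a b c e ↔ Cuts (lineBase a b c) e := by
  constructor
  · rintro ⟨x, hx, hx'⟩
    rw [← cl_eq_segment] at hx
    exact cuts_of_mem (by rw [side_lineBase h]; linarith) hx h1 h2
  · intro hc
    obtain ⟨x, hx, hx'⟩ := hc.exists_mem_rel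
    rw [side_lineBase h] at hx'
    exact ⟨x, by rw [← cl_eq_segment]; exact rel_subset_cl _ hx, by linarith⟩

lemma collinear_of_side_eq_zero {p q r : Pt} (hpq : p ≠ q) (h : side (p, q) r = 0) :
    Collinear ℝ ({p, q, r} : Set Pt) := by
  obtain ⟨t, rfl⟩ := exists_pt_of_side_eq_zero (δ := (p, q)) hpq h
  refine (collinear_iff_of_mem (p₀ := p) (by simp)).2 ⟨q - p, ?_⟩
  simp only [Set.mem_insert_iff, Set.mem_singleton_iff, forall_eq_or_imp, forall_eq]
  refine ⟨⟨0, by simp⟩, ⟨1, by simp⟩, ⟨t, ?_⟩⟩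
  simp only [pt, vadd_eq_add, add_comm]

lemma _root_.IsBRMatching.setting (hM : IsBRMatching B R M) (hBR : Disjoint B R) (hgen : GenPos (B ∪ R))
    (hL : L.1 ≠ L.2) (hoff : ∀ v ∈ B ∪ R, side L v ≠ 0) : ∃ K, Setting K (B ∪ R) L M := by
  refine ⟨1 + ∑ v ∈ B ∪ R, ‖v‖, ?_, fun v hv => ?_, hoff, hL, fun p hp q hq r hr h1 h2 h3 h => ?_,
    fun e he => ?_, fun e he e' he' hne => ?_, fun v hv => ?_⟩
  · have : 0 ≤ ∑ v ∈ B ∪ R, ‖v‖ := sum_nonneg fun v _ => norm_nonneg v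
    linarith
  · have := single_le_sum (f := fun v : Pt => ‖v‖) (fun v _ => norm_nonneg v) hv
    linarith
  · exact hgen p hp q hq r hr h1 h2 h3 (collinear_of_side_eq_zero h1 h)
  · obtain ⟨h1, h2⟩ := hM.1 e he
    exact ⟨mem_union_left _ h1, mem_union_right _ h2, hBR.forall_ne_finset h1 h2⟩
  · rw [cl_eq_segment, cl_eq_segment, Set.disjoint_iff_inter_eq_empty]
    exact hM.2.2.2 e he e' he' hne
  · rcases mem_union.1 hv with hv | hv
    · obtain ⟨e, ⟨he, h⟩, -⟩ := hM.2.1 v hv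
      exact ⟨e, he, Or.inl h.symm⟩
    · obtain ⟨e, ⟨he, h⟩, -⟩ := hM.2.2.1 v hv
      exact ⟨e, he, Or.inr h.symm⟩

lemma _root_.IsBRMatching.card_filter_fst (hM : IsBRMatching B R M) (p : Pt → Prop) :
    #{e ∈ M | p e.1} = #{b ∈ B | p b} := by
  refine card_bij (fun e _ => e.1) (fun e he => ?_) (fun e he e' he' h => ?_) (fun b hb => ?_)
  · obtain ⟨h1, h2⟩ := mem_filter.1 he
    exact mem_filter.2 ⟨(hM.1 e h1).1, h2⟩
  · have h1 := (mem_filter.1 he).1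
    exact (hM.2.1 e.1 (hM.1 e h1).1).unique ⟨h1, rfl⟩ ⟨(mem_filter.1 he').1, h.symm⟩
  · obtain ⟨h1, h2⟩ := mem_filter.1 hb
    obtain ⟨e, ⟨he, rfl⟩, -⟩ := hM.2.1 b h1
    exact ⟨e, mem_filter.2 ⟨he, h2⟩, rfl⟩

lemma _root_.IsBRMatching.card_filter_snd (hM : IsBRMatching B R M) (p : Pt → Prop) :
    #{e ∈ M | p e.2} = #{r ∈ R | p r} := by
  refine card_bij (fun e _ => e.2) (fun e he => ?_) (fun e he e' he' h => ?_) (fun b hb => ?_)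
  · obtain ⟨h1, h2⟩ := mem_filter.1 he
    exact mem_filter.2 ⟨(hM.1 e h1).2, h2⟩
  · have h1 := (mem_filter.1 he).1
    exact (hM.2.2.1 e.2 (hM.1 e h1).2).unique ⟨h1, rfl⟩ ⟨(mem_filter.1 he').1, h.symm⟩
  · obtain ⟨h1, h2⟩ := mem_filter.1 hb
    obtain ⟨e, ⟨he, rfl⟩, -⟩ := hM.2.2.1 b h1
    exact ⟨e, mem_filter.2 ⟨he, h2⟩, rfl⟩

/-- For a line bisecting both colors, there are cutting edges of both orientations. -/
lemma _root_.IsBRMatching.exists_opposite (hM : IsBRMatching B R M) (hoff : ∀ v ∈ B ∪ R, side L v ≠ 0)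
    (hcard : #{b ∈ B | side L b < 0} = #{r ∈ R | side L r < 0}) {e : Pt × Pt} (he : e ∈ M)
    (hc : Cuts L e) : ∃ f ∈ M, Cuts L f ∧ side L e.1 * side L f.1 < 0 := by
  rw [← hM.card_filter_fst fun v => side L v < 0, ← hM.card_filter_snd fun v => side L v < 0] at hcard
  have hoff1 : ∀ f ∈ M, side L f.1 ≠ 0 := fun f hf => hoff _ (mem_union_left _ (hM.1 f hf).1)
  have hoff2 : ∀ f ∈ M, side L f.2 ≠ 0 := fun f hf => hoff _ (mem_union_right _ (hM.1 f hf).2)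
  by_contra! hno
  unfold Cuts at hc hno
  rcases lt_or_gt_of_ne (hoff1 e he) with h | h
  · have hsub : M.filter (fun f => side L f.2 < 0) ⊆ M.filter fun f => side L f.1 < 0 := by
      intro f hf
      obtain ⟨h1, h2⟩ := mem_filter.1 hf
      refine mem_filter.2 ⟨h1, lt_of_not_ge fun h3 => ?_⟩
      have h4 := lt_of_le_of_ne h3 (hoff1 f h1).symm
      have := hno f h1 (mul_neg_of_pos_of_neg h4 h2)
      linarith [mul_neg_of_neg_of_pos h h4]
    have heq := eq_of_subset_of_card_le hsub hcard.le
    have : e ∈ M.filter fun f => side L f.2 < 0 := by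
      rw [heq]; exact mem_filter.2 ⟨he, h⟩
    linarith [mul_pos_of_neg_of_neg h (mem_filter.1 this).2]
  · have hsub : M.filter (fun f => side L f.1 < 0) ⊆ M.filter fun f => side L f.2 < 0 := by
      intro f hf
      obtain ⟨h1, h2⟩ := mem_filter.1 hf
      refine mem_filter.2 ⟨h1, lt_of_not_ge fun h3 => ?_⟩
      have h4 := lt_of_le_of_ne h3 (hoff2 f h1).symm
      have := hno f h1 (mul_neg_of_neg_of_pos h2 h4)
      linarith [mul_neg_of_pos_of_neg h h2]
    have heq := eq_of_subset_of_card_le hsub hcard.ge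
    have : e ∈ M.filter fun f => side L f.1 < 0 := by
      rw [heq]; exact mem_filter.2 ⟨he, neg_of_mul_neg_right hc h.le⟩
    exact (mem_filter.1 this).2.not_gt h

/-- A matching cut by a bisecting line is compatible with one that is cut at least two times
less. -/
lemma _root_.IsBRMatching.exists_compatible (hM : IsBRMatching B R M) (hBR : Disjoint B R)
    (hgen : GenPos (B ∪ R)) (hL : L.1 ≠ L.2) (hoff : ∀ v ∈ B ∪ R, side L v ≠ 0)
    (hcard : #{b ∈ B | side L b < 0} = #{r ∈ R | side L r < 0})
    (hpos : (M.filter (Cuts L)).Nonempty) :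
    ∃ M', IsBRMatching B R M' ∧ Compatible M M' ∧ #(M'.filter (Cuts L)) + 2 ≤ #(M.filter (Cuts L)) := by
  obtain ⟨e, he⟩ := hpos
  obtain ⟨heM, hce⟩ := mem_filter.1 he
  obtain ⟨f, hfM, hcf, hef⟩ := hM.exists_opposite hoff hcard heM hce
  obtain ⟨K, hS⟩ := hM.setting hBR hgen hL hoff
  obtain ⟨z, W, φ, Mis, I, hle⟩ := hS.exists_raySys heM hfM hce hcf hef
  obtain ⟨C, w, X⟩ := I.exists_cellSys hS hBR hM.1
  obtain ⟨σ, h1, h2, h3⟩ := X.exists_equiv hS hBR hM.1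
  refine ⟨univ.image fun b : B => (b.1, (σ b).1), ⟨?_, ?_, ?_, ?_⟩, ?_, ?_⟩
  · intro e he
    obtain ⟨b, -, rfl⟩ := mem_image.1 he
    exact ⟨b.2, (σ b).2⟩
  · intro b hb
    refine ⟨(b, (σ ⟨b, hb⟩).1), ⟨mem_image.2 ⟨⟨b, hb⟩, mem_univ _, rfl⟩, rfl⟩, ?_⟩
    rintro _ ⟨he, rfl⟩
    obtain ⟨b', -, rfl⟩ := mem_image.1 he
    rfl
  · intro r hr
    refine ⟨((σ.symm ⟨r, hr⟩).1, r), ⟨mem_image.2 ⟨σ.symm ⟨r, hr⟩, mem_univ _, ?_⟩, rfl⟩, ?_⟩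
    · simp
    · rintro _ ⟨he, rfl⟩
      obtain ⟨b', -, rfl⟩ := mem_image.1 he
      simp
  · intro e he e' he' hne
    obtain ⟨b, -, rfl⟩ := mem_image.1 he
    obtain ⟨b', -, rfl⟩ := mem_image.1 he'
    have := h1 b b' fun h => hne (by rw [h])
    rwa [cl_eq_segment, cl_eq_segment, Set.disjoint_iff_inter_eq_empty] at this
  · intro e he e' he'
    obtain ⟨b, -, rfl⟩ := mem_image.1 he'
    rw [or_iff_not_imp_left]
    rintro hne x ⟨hx, hx'⟩
    rw [← cl_eq_segment] at hx hx'
    rcases h3 e he b x hx hx' with h | ⟨h, h'⟩ | ⟨h, h'⟩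
    · exact absurd h hne
    · exact ⟨Or.inl h, Or.inl h'⟩
    · exact ⟨Or.inr h, Or.inr h'⟩
  · rw [filter_image]
    have := card_image_le (s := univ.filter fun b : B => Cuts L (b.1, (σ b).1))
      (f := fun b : B => (b.1, (σ b).1))
    omega

lemma _root_.IsBRMatching.exists_tCompatible (hBR : Disjoint B R) (hgen : GenPos (B ∪ R)) (hL : L.1 ≠ L.2)
    (hoff : ∀ v ∈ B ∪ R, side L v ≠ 0)
    (hcard : #{b ∈ B | side L b < 0} = #{r ∈ R | side L r < 0}) (k : ℕ) :
    ∀ M, IsBRMatching B R M → #(M.filter (Cuts L)) = k →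
      ∃ Ml, IsBRMatching B R Ml ∧ (∀ e ∈ Ml, ¬ Cuts L e) ∧ TCompatible B R (k / 2) M Ml := by
  induction k using Nat.strong_induction_on with
  | _ k ih =>
    intro M hM hk
    rcases (M.filter (Cuts L)).eq_empty_or_nonempty with h | h
    · exact ⟨M, hM, fun e he => filter_eq_empty_iff.1 h he, 0, Nat.zero_le _, fun _ => M, rfl, rfl,
        fun _ _ => hM, fun i hi => absurd hi (Nat.not_lt_zero i)⟩
    · obtain ⟨M', hM', hcomp, hle⟩ := hM.exists_compatible hBR hgen hL hoff hcard h
      obtain ⟨Ml, hMl, hno, m, hm, f, hf0, hfm, hf, hf'⟩ := ih _ (by omega) M' hM' rfl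
      refine ⟨Ml, hMl, hno, m + 1, by omega, fun i => i.casesOn M f, rfl, hfm, fun i hi => ?_,
        fun i hi => ?_⟩
      · cases i with
        | zero => exact hM
        | succ i => exact hf i (by omega)
      · cases i with
        | zero => rw [← hf0] at hcomp; exact hcomp
        | succ i => exact hf' i (by omega)

end

end WallSystem

/-- If `k` edges of the BR-matching `M` cross the ham-sandwich cut
`ℓ`, then there is a BR-matching `M^ℓ` with no edge intersecting `ℓ` such that `M` and
`M^ℓ` are `⌊k/2⌋`-compatible. -/
theorem exists_matching_avoiding_cut_half_k (n : ℕ) (B R : Finset Pt)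
    (hdisj : B ∩ R = ∅) (hB : B.card = n) (hR : R.card = n)
    (hgen : GenPos (B ∪ R))
    (M : Finset (Pt × Pt)) (hM : IsBRMatching B R M)
    (a b c : ℝ) (hcut : IsHamSandwichCut a b c B R n)
    (k : ℕ) (hk : k = (M.filter fun e => Crosses a b c e).card) :
    ∃ Ml : Finset (Pt × Pt), IsBRMatching B R Ml ∧
      (∀ e ∈ Ml, ¬ Crosses a b c e) ∧
      TCompatible B R (k / 2) M Ml := by
  obtain ⟨hab, hoff, hcards⟩ := hcut
  have hoff' : ∀ v ∈ B ∪ R, WallSystem.side (WallSystem.lineBase a b c) v ≠ 0 := fun v hv h => by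
    rw [WallSystem.side_lineBase hab] at h
    exact hoff v hv (by linarith)
  have hcross : ∀ {M}, IsBRMatching B R M → ∀ e ∈ M,
      (Crosses a b c e ↔ WallSystem.Cuts (WallSystem.lineBase a b c) e) := fun hM e he =>
    WallSystem.crosses_iff hab (hoff' _ (mem_union_left _ (hM.1 e he).1))
      (hoff' _ (mem_union_right _ (hM.1 e he).2))
  obtain ⟨Ml, hMl, hno, hT⟩ := IsBRMatching.exists_tCompatible
    (disjoint_iff_inter_eq_empty.2 hdisj) hgen (WallSystem.lineBase_ne hab) hoff'
    (by
      simp only [WallSystem.side_lineBase hab, sub_neg]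
      rcases hcards with h | h
      · rw [h.1, h.2.1]
      · rw [h.1, h.2.1]) k M hM (by rw [hk, filter_congr (hcross hM)])
  exact ⟨Ml, hMl, fun e he h => hno e he ((hcross hMl e he).1 h), hT⟩
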